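/- arXiv:0910.0267 — 4 statements merged into one kernel-verified Lean document; each statement's English description precedes it below -/
import Mathlib

section
/- Let G = A∗_C be an HNN extension with base group A and associated subgroups C and D, and let N be a nontrivial normal subgroup of G with N ∩ C = {1}. Then N is finitely generated if and only if the subgroup NC generated by N and C has finite index in G and N ∩ A is finitely generated. -/
namespace Subgroup

variable {G : Type*} [Group G]

/-- A subgroup `P` of a finitely generated group `N` is finitely generated as soon as there is a
left `P`-equivariant map `ψ : N → P` for which right multiplication by any fixed element of `N`
changes `ψ` by finitely many increments only. -/
theorem FG.of_finite_increments {N P : Subgroup G} (hN : N.FG) (hPN : P ≤ N) (ψ : G → G)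
    (hψ : ∀ n ∈ N, ψ n ∈ P) (hmul : ∀ p ∈ P, ∀ n ∈ N, ψ (p * n) = p * ψ n)
    (hfin : ∀ s ∈ N, ((fun n ↦ (ψ n)⁻¹ * ψ (n * s)) '' N).Finite) : P.FG := by
  obtain ⟨S, rfl, hS⟩ := (Subgroup.fg_iff _).1 hN
  set I : Set G := ⋃ s ∈ S, (fun n ↦ (ψ n)⁻¹ * ψ (n * s)) '' (closure S : Set G) with hI
  have hIfin : I.Finite := hS.biUnion fun s hs ↦ hfin s (subset_closure hs)
  have key : ∀ s ∈ closure S, ∀ n ∈ closure S,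
      (ψ n)⁻¹ * ψ (n * s) ∈ closure (insert (ψ 1) I) := by
    intro s hs
    induction hs using closure_induction with
    | mem s hs =>
      intro n hn
      exact subset_closure (Or.inr (Set.mem_biUnion hs ⟨n, hn, rfl⟩))
    | one => simp
    | mul x y hx hy ihx ihy =>
      intro n hn
      have := mul_mem (ihx n hn) (ihy (n * x) (mul_mem hn hx))
      simpa [mul_assoc] using this
    | inv x hx ih =>
      intro n hn
      have := inv_mem (ih (n * x⁻¹) (mul_mem hn (inv_mem hx)))
      simpa [mul_assoc] using this
  refine (Subgroup.fg_iff _).2 ⟨insert (ψ 1) I, le_antisymm ?_ ?_, hIfin.insert _⟩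
  · rw [closure_le]
    rintro x (rfl | hx)
    · exact hψ 1 (one_mem _)
    · simp only [hI, Set.mem_iUnion] at hx
      obtain ⟨s, hs, n, hn, rfl⟩ := hx
      exact mul_mem (inv_mem (hψ n hn)) (hψ _ (mul_mem hn (subset_closure hs)))
  · intro p hp
    have h1 : ψ 1 ∈ closure (insert (ψ 1) I) := subset_closure (Or.inl rfl)
    have h2 := mul_mem (mul_mem h1 (key p (hPN hp) 1 (one_mem _))) (inv_mem h1)
    have h3 := hmul p hp 1 (one_mem _)
    rw [mul_one] at h3
    simpa [h3] using h2

/-- If `N` is finitely generated and there is a left `N ⊓ B`-invariant equivalence relation such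
that `N ⊓ B` acts freely on the classes of elements of `N`, and, for each `s ∈ N`, every `n ∈ N`
outside finitely many cosets of `B` is equivalent to `n * s`, then `N ⊓ B` is finitely generated. -/
theorem FG.inf_of_equivalence {N B : Subgroup G} (hN : N.FG) {r : G → G → Prop}
    (hr : Equivalence r) (hmul : ∀ p ∈ N ⊓ B, ∀ x y, r x y → r (p * x) (p * y))
    (hfree : ∀ p ∈ N ⊓ B, ∀ n ∈ N, r (p * n) n → p = 1)
    (hfin : ∀ s ∈ N, ∃ F : Set G, F.Finite ∧ ∀ n ∈ N, ¬ r n (n * s) → ∃ f ∈ F, n * f ∈ B) :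
    (N ⊓ B).FG := by
  let R : Setoid G :=
    { r := fun x y ↦ ∃ p ∈ N ⊓ B, r (p * x) y
      iseqv :=
        { refl := fun x ↦ ⟨1, one_mem _, by simpa using hr.refl x⟩
          symm := by
            rintro x y ⟨p, hp, h⟩
            exact ⟨p⁻¹, inv_mem hp, by simpa using hr.symm (hmul _ (inv_mem hp) _ _ h)⟩
          trans := by
            rintro x y z ⟨p, hp, h⟩ ⟨q, hq, h'⟩
            refine ⟨q * p, mul_mem hq hp, ?_⟩
            rw [mul_assoc]
            exact hr.trans (hmul q hq _ _ h) h' } }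
  have hex : ∀ n, ∃ p ∈ N ⊓ B, r (p * (Quotient.mk R n).out) n := fun n ↦
    Quotient.mk_out (s := R) n
  choose ψ hψ hψr using hex
  have huniq : ∀ n ∈ N, ∀ p ∈ N ⊓ B, r (p * (Quotient.mk R n).out) n → p = ψ n := by
    intro n hn p hp h
    have h1 := hmul (p * (ψ n)⁻¹) (mul_mem hp (inv_mem (hψ n))) _ _ (hψr n)
    have h2 : r (p * (ψ n)⁻¹ * n) n := by
      refine hr.trans (hr.symm h1) ?_
      simpa [mul_assoc] using h
    exact mul_inv_eq_one.1 (hfree _ (mul_mem hp (inv_mem (hψ n))) n hn h2)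
  have hequiv : ∀ p ∈ N ⊓ B, ∀ n ∈ N, ψ (p * n) = p * ψ n := by
    intro p hp n hn
    refine (huniq _ (mul_mem hp.1 hn) _ (mul_mem hp (hψ n)) ?_).symm
    have h1 : Quotient.mk R (p * n) = Quotient.mk R n :=
      Quotient.sound (s := R) ⟨p⁻¹, inv_mem hp, by simpa using hr.refl n⟩
    rw [h1, mul_assoc]
    exact hmul p hp _ _ (hψr n)
  have hrel : ∀ m ∈ N, ∀ n ∈ N, r m n → ψ m = ψ n := by
    intro m hm n hn h
    have h1 : Quotient.mk R m = Quotient.mk R n :=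
      Quotient.sound (s := R) ⟨1, one_mem _, by simpa using h⟩
    exact huniq n hn _ (hψ m) (h1 ▸ hr.trans (hψr m) h)
  refine hN.of_finite_increments inf_le_left ψ (fun n _ ↦ hψ n) hequiv fun s hs ↦ ?_
  obtain ⟨F, hF, hFs⟩ := hfin s hs
  have hsub : ∀ f, ((fun n ↦ (ψ n)⁻¹ * ψ (n * s)) '' {n | n ∈ N ∧ n * f ∈ B}).Subsingleton := by
    rintro f _ ⟨m, ⟨hm, hmf⟩, rfl⟩ _ ⟨n, ⟨hn, hnf⟩, rfl⟩
    have hp : m * n⁻¹ ∈ N ⊓ B :=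
      ⟨N.mul_mem hm (N.inv_mem hn), by
        simpa [mul_assoc] using B.mul_mem hmf (B.inv_mem hnf)⟩
    obtain ⟨p, rfl⟩ : ∃ p, m = p * n := ⟨m * n⁻¹, by simp⟩
    rw [mul_inv_cancel_right] at hp
    simp only [mul_assoc, hequiv p hp n hn, hequiv p hp (n * s) (mul_mem hn hs)]
    simp
  refine ((Set.finite_singleton 1).union (hF.biUnion fun f _ ↦ (hsub f).finite)).subset ?_
  rintro _ ⟨n, hn, rfl⟩
  by_cases h : r n (n * s)
  · left
    simp [hrel n hn _ (mul_mem hn hs) h]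
  · right
    obtain ⟨f, hf, hnf⟩ := hFs n hn h
    exact Set.mem_biUnion hf ⟨n, ⟨hn, hnf⟩, rfl⟩

end Subgroup

namespace HNNExtension

variable {A : Type*} [Group A] {C D : Subgroup A} {φ : C ≃* D}

theorem apply_eq_apply_one {α : Type*} {f : HNNExtension A C D φ → α}
    (hof : ∀ g a, f (g * of a) = f g) (ht : ∀ g, f (g * t⁻¹) = f g) (g : HNNExtension A C D φ) :
    f g = f 1 := by
  suffices ∀ x g, f (g * x) = f g by simpa using this g 1
  intro x
  induction x using induction_on with
  | of a => exact fun g ↦ hof g a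
  | t =>
    intro g
    have h := ht (g * t)
    rw [mul_inv_cancel_right] at h
    exact h.symm
  | mul x y hx hy => exact fun g ↦ by rw [← mul_assoc, hy, hx]
  | inv x hx => exact fun g ↦ by simpa using (hx (g * x⁻¹)).symm

theorem t_zpow_mem_map_of {B : Subgroup A} {k : ℤ}
    (h : (t : HNNExtension A C D φ) ^ k ∈ B.map of) : k = 0 := by
  let f : HNNExtension A C D φ →* Multiplicative ℤ :=
    lift 1 (Multiplicative.ofAdd 1) (by simp)
  obtain ⟨b, -, hb⟩ := h
  have h1 := congrArg f hb
  simp only [f, lift_of, map_zpow, lift_t, MonoidHom.one_apply] at h1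
  have h2 := congrArg Multiplicative.toAdd h1
  simpa using h2.symm

theorem t_mul_mul_inv_t_mem_range {c : HNNExtension A C D φ} (hc : c ∈ C.map of) :
    t * c * t⁻¹ ∈ (of : A →* HNNExtension A C D φ).range := by
  obtain ⟨c, hc, rfl⟩ := hc
  exact ⟨φ ⟨c, hc⟩, equiv_eq_conj ⟨c, hc⟩⟩

/-- The set `H` of group elements moving the base vertex of the Bass–Serre tree across the edge
stabilized by `C`, which joins the base vertex to its image under `t⁻¹`. -/
structure IsHalfTree (H : Set (HNNExtension A C D φ)) : Prop where
  one_notMem : 1 ∉ H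
  inv_t_mem : t⁻¹ ∈ H
  mul_of_mem_iff : ∀ g a, g * of a ∈ H ↔ g ∈ H
  mul_inv_t_mem_iff : ∀ g, g ∉ C.map of → (g * t⁻¹ ∈ H ↔ g ∈ H)

open Classical in
theorem exists_isHalfTree : ∃ H : Set (HNNExtension A C D φ), IsHalfTree H := by
  let T : Equiv.Perm (HNNExtension A C D φ × Bool) :=
    { toFun := fun x ↦ (x.1 * t⁻¹, xor x.2 (decide (x.1 ∈ C.map of)))
      invFun := fun x ↦ (x.1 * t, xor x.2 (decide (x.1 * t ∈ C.map of)))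
      left_inv := fun x ↦ by simp
      right_inv := fun x ↦ by simp }
  let R : A →* Equiv.Perm (HNNExtension A C D φ × Bool) :=
    { toFun := fun a ↦ (Equiv.mulRight (of a)⁻¹).prodCongr (Equiv.refl _)
      map_one' := by ext x <;> simp
      map_mul' := fun a b ↦ by ext x <;> simp [mul_assoc] }
  let ρ : HNNExtension A C D φ →* Equiv.Perm (HNNExtension A C D φ × Bool) :=
    lift R T fun c ↦ by
      ext x
      · have h : (of (c : A) : HNNExtension A C D φ)⁻¹ * t⁻¹ = t⁻¹ * (of (φ c : A))⁻¹ := by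
          rw [← mul_inv_rev, ← mul_inv_rev, t_mul_of]
        simp [R, T, mul_assoc, h]
      · have h : (x.1 * (of (c : A))⁻¹ ∈ C.map (of : A →* HNNExtension A C D φ)) ↔
            x.1 ∈ C.map of :=
          Subgroup.mul_mem_cancel_right _ (inv_mem (Subgroup.mem_map_of_mem _ c.2))
        simp [R, T, -Subgroup.mem_map, h]
  have hof : ∀ a x, ρ (of a) x = (x.1 * (of a)⁻¹, x.2) := fun a x ↦ by
    simp [ρ, R, Equiv.prodCongr_apply, Prod.map]
  have ht : ∀ x, ρ t x = (x.1 * t⁻¹, xor x.2 (decide (x.1 ∈ C.map of))) := fun x ↦ by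
    simp only [ρ, lift_t]; rfl
  have hfst : ∀ g x, (ρ g x).1 = x.1 * g⁻¹ := by
    intro g
    induction g using induction_on with
    | of a => simp [hof]
    | t => simp [ht]
    | mul x y hx hy => simp [hx, hy, mul_assoc]
    | inv x hx =>
      intro y
      have := hx (ρ x⁻¹ y)
      rw [← Equiv.Perm.mul_apply, ← map_mul, mul_inv_cancel, map_one, Equiv.Perm.one_apply] at this
      simp only [this, inv_inv, inv_mul_cancel_right]
  have hinv : ∀ g, ρ g⁻¹ (1, false) = (g, (ρ g⁻¹ (1, false)).2) := fun g ↦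
    Prod.ext (by rw [hfst, inv_inv, one_mul]) rfl
  have hmul : ∀ g x, ρ (g * x)⁻¹ (1, false) = ρ x⁻¹ (g, (ρ g⁻¹ (1, false)).2) := fun g x ↦ by
    rw [← hinv, mul_inv_rev, map_mul, Equiv.Perm.mul_apply]
  refine ⟨{g | (ρ g⁻¹ (1, false)).2 = true}, ?_, ?_, ?_, ?_⟩
  · rw [Set.mem_ofPred_eq, inv_one, map_one]
    simp
  · rw [Set.mem_ofPred_eq, inv_inv, ht]
    simp [-Subgroup.mem_map, one_mem]
  · intro g a
    simp only [Set.mem_ofPred_eq, hmul]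
    rw [← map_inv, hof]
  · intro g hg
    simp only [Set.mem_ofPred_eq, hmul]
    rw [inv_inv, ht]
    simp [hg, -Subgroup.mem_map]

namespace IsHalfTree

variable {H : Set (HNNExtension A C D φ)} (hH : IsHalfTree H)
include hH

theorem notMem_of_mem_range {g : HNNExtension A C D φ}
    (hg : g ∈ (of : A →* HNNExtension A C D φ).range) : g ∉ H := by
  obtain ⟨a, rfl⟩ := hg
  simpa [hH.one_notMem] using hH.mul_of_mem_iff 1 a

theorem mul_inv_t_mem {g : HNNExtension A C D φ} (hg : g ∈ C.map of) : g * t⁻¹ ∈ H := by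
  obtain ⟨c, hc, rfl⟩ := hg
  have h := of_mul_inv_t (φ := φ) ⟨c, hc⟩
  simp only at h
  rw [h, hH.mul_of_mem_iff]
  exact hH.inv_t_mem

theorem notMem_of_mem_map {g : HNNExtension A C D φ} (hg : g ∈ C.map of) : g ∉ H :=
  hH.notMem_of_mem_range (Subgroup.map_le_range _ _ hg)

/-- A half tree not containing the edge associated with `g` lies on one side of that edge. -/
theorem inv_mul_mem_iff {g z : HNNExtension A C D φ} (hg : g ∉ C.map of) (hz : z ∈ H ↔ g ∉ H) :
    g⁻¹ * z ∈ H ↔ g⁻¹ ∈ H := by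
  let f : HNNExtension A C D φ → Prop := fun z ↦
    ((z ∈ H ↔ g ∉ H) ∧ g⁻¹ * z ∈ H) ∨ (¬ (z ∈ H ↔ g ∉ H) ∧ g⁻¹ ∈ H)
  have h1 : f z = f 1 := by
    refine apply_eq_apply_one (fun x a ↦ ?_) (fun x ↦ ?_) z
    · simp only [f, ← mul_assoc, hH.mul_of_mem_iff]
    · by_cases hx : x ∈ C.map of
      · have h1 := hH.notMem_of_mem_map hx
        have h2 := hH.mul_inv_t_mem hx
        have h3 : g⁻¹ * x ∉ C.map of := fun h ↦
          hg (by simpa using inv_mem ((Subgroup.mul_mem_cancel_right _ hx).1 h))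
        have h4 := hH.mul_inv_t_mem_iff _ h3
        have h5 : g⁻¹ * x ∈ H ↔ g⁻¹ ∈ H := by
          obtain ⟨c, hc, rfl⟩ := hx
          exact hH.mul_of_mem_iff _ _
        rw [mul_assoc] at h4
        simp only [f, h4, h5, h1, h2]
        by_cases g ∈ H <;> simp_all
      · have h1 := hH.mul_inv_t_mem_iff x hx
        by_cases h2 : g⁻¹ * x ∈ C.map of
        · have h3 : x ∈ H ↔ g ∈ H := by
            obtain ⟨c, hc, h⟩ := h2
            rw [show x = g * of c by rw [h]; simp, hH.mul_of_mem_iff]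
          simp only [f, h1, h3]
          by_cases g ∈ H <;> simp_all
        · have h3 := hH.mul_inv_t_mem_iff _ h2
          rw [mul_assoc] at h3
          simp only [f, h1, h3]
  have h2 : f 1 ↔ g⁻¹ ∈ H := by
    simp only [f, mul_one, ← or_and_right, em, true_and]
  rw [← h2, ← h1]
  simp only [f, hz, true_and, not_true_eq_false, false_and, or_false]

theorem exists_finite_crossing (y : HNNExtension A C D φ) :
    ∃ F : Set (HNNExtension A C D φ), F.Finite ∧
      ∀ g, ¬ (g * y ∈ H ↔ g ∈ H) → ∃ f ∈ F, g * f ∈ C.map of := by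
  induction y using induction_on with
  | of a => exact ⟨∅, Set.finite_empty, fun g h ↦ absurd (hH.mul_of_mem_iff g a) h⟩
  | t =>
    refine ⟨{t}, Set.finite_singleton _, fun g h ↦ ⟨t, rfl, ?_⟩⟩
    by_contra hg
    have := hH.mul_inv_t_mem_iff _ hg
    rw [mul_inv_cancel_right] at this
    exact h this.symm
  | mul x y hx hy =>
    obtain ⟨F, hF, hFx⟩ := hx
    obtain ⟨F', hF', hFy⟩ := hy
    refine ⟨F ∪ (fun f ↦ x * f) '' F', hF.union (hF'.image _), fun g h ↦ ?_⟩
    by_cases hgx : g * x ∈ H ↔ g ∈ H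
    · obtain ⟨f, hf, hgf⟩ := hFy (g * x) (by rwa [hgx, mul_assoc])
      exact ⟨x * f, Or.inr ⟨f, hf, rfl⟩, by rwa [← mul_assoc]⟩
    · obtain ⟨f, hf, hgf⟩ := hFx g hgx
      exact ⟨f, Or.inl hf, hgf⟩
  | inv x hx =>
    obtain ⟨F, hF, hFx⟩ := hx
    refine ⟨(fun f ↦ x⁻¹ * f) '' F, hF.image _, fun g h ↦ ?_⟩
    obtain ⟨f, hf, hgf⟩ := hFx (g * x⁻¹) (by rw [inv_mul_cancel_right]; exact fun h' ↦ h h'.symm)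
    exact ⟨x⁻¹ * f, ⟨f, hf, rfl⟩, by rwa [← mul_assoc]⟩

theorem finite_zpow_crossing {m : HNNExtension A C D φ}
    (hm : ∀ k : ℤ, m ^ k ∈ C.map of → k = 0) (y w : HNNExtension A C D φ) :
    {k : ℤ | ¬ (m ^ k * w ∈ H ↔ m ^ k * y ∈ H)}.Finite := by
  obtain ⟨F, hF, h⟩ := hH.exists_finite_crossing (y⁻¹ * w)
  have hsub : ∀ f, {k : ℤ | m ^ k * y * f ∈ C.map of}.Subsingleton := by
    intro f k hk l hl
    have h1 := mul_mem (Set.mem_ofPred_eq ▸ hk : m ^ k * y * f ∈ C.map of)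
      (inv_mem (Set.mem_ofPred_eq ▸ hl : m ^ l * y * f ∈ C.map of))
    have h2 : m ^ k * y * f * (m ^ l * y * f)⁻¹ = m ^ (k - l) := by
      rw [zpow_sub]; group
    exact sub_eq_zero.1 (hm _ (h2 ▸ h1))
  refine (hF.biUnion fun f _ ↦ (hsub f).finite).subset fun k hk ↦ ?_
  obtain ⟨f, hf, hkf⟩ := h (m ^ k * y) (by simpa [mul_assoc] using hk)
  exact Set.mem_biUnion hf hkf

theorem t_zpow_mem_iff (k : ℤ) : t ^ k ∈ H ↔ k < 0 := by
  have hstep : ∀ k : ℤ, k ≠ 0 → (t ^ (k - 1) ∈ H ↔ t ^ k ∈ H) := fun k hk ↦ by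
    rw [zpow_sub_one]
    exact hH.mul_inv_t_mem_iff _ fun h ↦ hk (t_zpow_mem_map_of h)
  induction k using Int.induction_on with
  | zero => simpa using hH.one_notMem
  | succ n ih =>
    have h := hstep (n + 1) (by omega)
    rw [add_sub_cancel_right] at h
    exact h.symm.trans (Iff.trans ih (by omega))
  | pred n ih =>
    rcases n with _ | n
    · simpa using hH.inv_t_mem
    · exact (hstep _ (by push_cast; omega)).trans (Iff.trans ih (by push_cast; omega))

variable {N : Subgroup (HNNExtension A C D φ)}

/-- A normal subgroup acting freely on the edges of the Bass–Serre tree contains an element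
which is hyperbolic with axis through the edge stabilized by `C`. -/
theorem exists_hyperbolic (hN : N.Normal) (hne : N ≠ ⊥) (hNC : N ⊓ C.map of = ⊥) :
    ∃ n ∈ N, n ≠ 1 ∧ ∀ g ∈ H, n * g ∈ H := by
  by_contra! hcon
  have hC : ∀ n ∈ N, n ≠ 1 → n ∉ C.map of := fun n hn hn1 hnC ↦
    hn1 ((Subgroup.mem_bot).1 (hNC ▸ Subgroup.mem_inf.2 ⟨hn, hnC⟩))
  have hnest : ∀ n ∈ N, n ≠ 1 → ∀ z, (z ∈ H ↔ n⁻¹ ∉ H) → (n * z ∈ H ↔ n ∈ H) := by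
    intro n hn hn1 z hz
    have := hH.inv_mul_mem_iff (hC n⁻¹ (inv_mem hn) (by simpa using hn1)) hz
    rwa [inv_inv] at this
  have hin : ∀ n ∈ N, n ≠ 1 → (n ∈ H ↔ n⁻¹ ∈ H) := by
    intro n hn hn1
    constructor
    · intro h
      by_contra h'
      obtain ⟨g, hg, hg'⟩ := hcon n hn hn1
      exact hg' ((hnest n hn hn1 g (by grind)).2 h)
    · intro h'
      by_contra h
      obtain ⟨g, hg, hg'⟩ := hcon n⁻¹ (inv_mem hn) (by simpa using hn1)
      have := hnest n hn hn1 (n⁻¹ * g) (by grind)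
      rw [mul_inv_cancel_left] at this
      grind
  obtain ⟨n, hn, hn1⟩ := N.ne_bot_iff_exists_ne_one.1 hne |> fun ⟨n, hn⟩ ↦
    (⟨n, n.2, fun h ↦ hn (Subtype.ext h)⟩ : ∃ n ∈ N, n ≠ 1)
  have hconj : ∀ k : ℤ, t ^ k * n * (t ^ k)⁻¹ ∈ N ∧ t ^ k * n * (t ^ k)⁻¹ ≠ 1 := fun k ↦
    ⟨hN.conj_mem _ hn _, by simpa using hn1⟩
  have hfin := hH.finite_zpow_crossing (m := t) (fun k ↦ t_zpow_mem_map_of) 1 n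
  obtain ⟨k, hk, hkn⟩ := (Set.Iio_infinite (0 : ℤ)).exists_notMem_finite hfin
  obtain ⟨l, hl, hln⟩ := (Set.Ioi_infinite (0 : ℤ)).exists_notMem_finite hfin
  simp only [Set.mem_ofPred_eq, not_not, mul_one, hH.t_zpow_mem_iff] at hkn hln
  rw [Set.mem_Iio] at hk
  rw [Set.mem_Ioi] at hl
  obtain ⟨hp, hp1⟩ := hconj k
  obtain ⟨hq, hq1⟩ := hconj l
  have htk := hH.t_zpow_mem_iff k
  have htl := hH.t_zpow_mem_iff l
  have hpk : t ^ k * n * (t ^ k)⁻¹ * t ^ k ∈ H := by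
    rw [inv_mul_cancel_right]; exact hkn.2 hk
  have hql : t ^ l * n * (t ^ l)⁻¹ * t ^ l ∉ H := by
    rw [inv_mul_cancel_right, hln]; omega
  generalize t ^ k * n * (t ^ k)⁻¹ = p at *
  generalize t ^ l * n * (t ^ l)⁻¹ = q at *
  have hpH : p ∈ H := by
    by_contra h
    have h' := mt (hin p hp hp1).2 h
    exact h ((hnest p hp hp1 (t ^ k) (by grind)).1 hpk)
  have hqH : q ∉ H := by
    intro h
    have h' := (hin q hq hq1).1 h
    exact hql ((hnest q hq hq1 (t ^ l) (by grind)).2 h)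
  have hpq : p * q ≠ 1 := by
    intro h
    have h1 := hin p hp hp1
    rw [inv_eq_of_mul_eq_one_right h] at h1
    exact hqH (h1.1 hpH)
  obtain ⟨g, hg, hg'⟩ := hcon (p * q) (mul_mem hp hq) hpq
  have h1 := hnest q hq hq1 g
  have h2 := hnest p hp hp1 (q * g)
  have h3 := hin p hp hp1
  have h4 := hin q hq hq1
  rw [mul_assoc] at hg'
  grind

theorem exists_crossing (hN : N.Normal) (hne : N ≠ ⊥) (hNC : N ⊓ C.map of = ⊥)
    (x : HNNExtension A C D φ) : ∃ n ∈ N, ¬ (x * n ∈ H ↔ x ∈ H) := by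
  obtain ⟨n, hn, hn1, hnH⟩ := hH.exists_hyperbolic hN hne hNC
  have hC : ∀ n ∈ N, n ∈ C.map of → n = 1 := fun n hn hnC ↦
    (Subgroup.mem_bot).1 (hNC ▸ Subgroup.mem_inf.2 ⟨hn, hnC⟩)
  obtain ⟨y, hy, hny⟩ : ∃ y ∈ H, n⁻¹ * y ∉ H := by
    by_contra! h
    have hiff : ∀ g, n * g ∈ H ↔ g ∈ H := fun g ↦
      ⟨fun hg ↦ by simpa using h _ hg, hnH g⟩
    have h1 := hH.mul_inv_t_mem_iff n fun h' ↦ hn1 (hC n hn h')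
    have h2 := hiff 1
    rw [mul_one] at h2
    exact hH.one_notMem (h2.1 (h1.1 ((hiff _).2 hH.inv_t_mem)))
  have hpow : ∀ k : ℕ, ∀ g ∈ H, n ^ k * g ∈ H := by
    intro k
    induction k with
    | zero => simp
    | succ k ih =>
      intro g hg
      rw [pow_succ, mul_assoc]
      exact ih _ (hnH g hg)
  have hzpow : ∀ k : ℤ, n ^ k * y ∈ H ↔ 0 ≤ k := by
    intro k
    obtain ⟨k, rfl | rfl⟩ := k.eq_nat_or_neg
    · simpa using hpow k y hy
    · rcases k with _ | k
      · simpa using hy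
      · have h1 : n ^ (-((k + 1 : ℕ) : ℤ)) * y ∉ H := by
          intro h
          apply hny
          have h2 := hpow k _ h
          rwa [← zpow_natCast, ← mul_assoc, ← zpow_add,
            show ((k : ℤ) + -((k + 1 : ℕ) : ℤ)) = -1 by push_cast; ring, zpow_neg_one] at h2
        exact iff_of_false h1 (by push_cast; omega)
  have hord : ∀ k : ℤ, n ^ k ∈ C.map of → k = 0 := by
    intro k hk
    have h1 := hC _ (zpow_mem hn k) hk
    have h2 := hzpow (-1 - k)
    have h3 := hzpow (-1)
    rw [sub_eq_add_neg, zpow_add, zpow_neg _ k, h1, inv_one, mul_one] at h2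
    have h4 := hzpow (-1 + k)
    rw [zpow_add, h1, mul_one] at h4
    grind
  have hfin := hH.finite_zpow_crossing hord x y
  by_contra! hcon
  have hx : ∀ k : ℤ, n ^ k * x ∈ H ↔ x ∈ H := fun k ↦ by
    have h := hcon (x⁻¹ * n ^ k * x⁻¹⁻¹) (hN.conj_mem _ (zpow_mem hn k) x⁻¹)
    rwa [inv_inv, mul_assoc x⁻¹, mul_inv_cancel_left] at h
  obtain ⟨k, hk, hkn⟩ := (Set.Iio_infinite (0 : ℤ)).exists_notMem_finite hfin
  obtain ⟨l, hl, hln⟩ := (Set.Ioi_infinite (0 : ℤ)).exists_notMem_finite hfin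
  simp only [Set.mem_ofPred_eq, not_not, hzpow, hx] at hkn hln
  rw [Set.mem_Iio] at hk
  rw [Set.mem_Ioi] at hl
  grind

theorem finiteIndex_of_fg (hN : N.Normal) (hne : N ≠ ⊥) (hNC : N ⊓ C.map of = ⊥)
    (hfg : N.FG) : (N ⊔ C.map of).FiniteIndex := by
  obtain ⟨S, rfl, hS⟩ := (Subgroup.fg_iff _).1 hfg
  choose F hF hFc using hH.exists_finite_crossing
  have key : ∀ n ∈ Subgroup.closure S, ∀ g, ¬ (g * n ∈ H ↔ g ∈ H) →
      ∃ f ∈ ⋃ s ∈ S, F s, ∃ m ∈ Subgroup.closure S, g * m * f ∈ C.map of := by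
    intro n hn
    induction hn using Subgroup.closure_induction with
    | mem s hs =>
      intro g hg
      obtain ⟨f, hf, hgf⟩ := hFc s g hg
      exact ⟨f, Set.mem_biUnion hs hf, 1, one_mem _, by rwa [mul_one]⟩
    | one => simp
    | mul x y hx hy ihx ihy =>
      intro g hg
      by_cases h : g * x ∈ H ↔ g ∈ H
      · obtain ⟨f, hf, m, hm, hgf⟩ := ihy (g * x) (by rwa [h, mul_assoc])
        exact ⟨f, hf, x * m, mul_mem hx hm, by rwa [← mul_assoc]⟩
      · exact ihx g h
    | inv x hx ih =>
      intro g hg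
      obtain ⟨f, hf, m, hm, hgf⟩ :=
        ih (g * x⁻¹) (by rw [inv_mul_cancel_right]; exact fun h' ↦ hg h'.symm)
      exact ⟨f, hf, x⁻¹ * m, mul_mem (inv_mem hx) hm, by rwa [← mul_assoc]⟩
  set N := Subgroup.closure S
  suffices Finite (HNNExtension A C D φ ⧸ (N ⊔ C.map of)) from
    Subgroup.finiteIndex_of_finite_quotient
  refine Set.finite_univ_iff.1
    (((hS.biUnion fun s _ ↦ hF s).image QuotientGroup.mk).subset fun q _ ↦ ?_)
  obtain ⟨x, rfl⟩ := QuotientGroup.mk_surjective q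
  obtain ⟨n, hn, hx⟩ := hH.exists_crossing hN hne hNC x⁻¹
  obtain ⟨f, hf, m, hm, hc⟩ := key n hn x⁻¹ hx
  refine ⟨f, hf, (QuotientGroup.eq.2 ?_).symm⟩
  have h1 : x⁻¹ * m⁻¹ * x⁻¹⁻¹ ∈ N := hN.conj_mem _ (inv_mem hm) x⁻¹
  have h2 := mul_mem (Subgroup.mem_sup_left h1 : _ ∈ N ⊔ C.map of) (Subgroup.mem_sup_right hc)
  simpa [mul_assoc, -Subgroup.mem_map] using h2

/-- A group element fixing every side of every edge at the base vertex fixes that vertex. -/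
theorem mem_range_of_forall {g : HNNExtension A C D φ}
    (h₁ : ∀ a, of a * g ∉ H) (h₂ : ∀ a, t⁻¹ * of a * g ∈ H) :
    g ∈ (of : A →* HNNExtension A C D φ).range := by
  let f : HNNExtension A C D φ → Prop := fun g ↦ g ∉ (of : A →* HNNExtension A C D φ).range ∧
    (∀ a, of a * g ∉ H) ∧ ∀ a, t⁻¹ * of a * g ∈ H
  have hof : ∀ g a, g * of a ∈ (of : A →* HNNExtension A C D φ).range ↔
      g ∈ (of : A →* HNNExtension A C D φ).range := fun g a ↦
    Subgroup.mul_mem_cancel_right _ ⟨a, rfl⟩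
  have h : f g = f 1 := by
    refine apply_eq_apply_one (fun x a ↦ ?_) (fun x ↦ ?_) g
    · simp only [f, ← mul_assoc, hH.mul_of_mem_iff, hof]
    · by_cases hx : x ∈ (of : A →* HNNExtension A C D φ).range
      · have h1 : ¬ f x := fun h ↦ h.1 hx
        have h2 : ¬ f (x * t⁻¹) := by
          obtain ⟨a, rfl⟩ := hx
          intro h
          refine h.2.1 a⁻¹ ?_
          rw [← mul_assoc, ← map_mul, inv_mul_cancel, map_one, one_mul]
          exact hH.inv_t_mem
        simp only [h1, h2]
      · by_cases hx' : x * t⁻¹ ∈ (of : A →* HNNExtension A C D φ).range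
        · have h1 : ¬ f (x * t⁻¹) := fun h ↦ h.1 hx'
          have h2 : ¬ f x := by
            obtain ⟨a, ha⟩ := hx'
            obtain rfl : of a * t = x := by rw [ha, inv_mul_cancel_right]
            intro h
            have h3 := h.2.2 a⁻¹
            rw [mul_assoc, ← mul_assoc (of a⁻¹), ← map_mul, inv_mul_cancel, map_one, one_mul,
              inv_mul_cancel] at h3
            exact hH.one_notMem h3
          simp only [h1, h2]
        · have h1 : ∀ a, of a * (x * t⁻¹) ∈ H ↔ of a * x ∈ H := by
            intro a
            rw [← mul_assoc]
            refine hH.mul_inv_t_mem_iff _ fun h ↦ hx ?_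
            exact (Subgroup.mul_mem_cancel_left _ (⟨a, rfl⟩ : of a ∈ of.range)).1
              (Subgroup.map_le_range _ _ h)
          have h2 : ∀ a, t⁻¹ * of a * (x * t⁻¹) ∈ H ↔ t⁻¹ * of a * x ∈ H := by
            intro a
            rw [← mul_assoc]
            refine hH.mul_inv_t_mem_iff _ fun h ↦ hx' ?_
            refine (Subgroup.mul_mem_cancel_left _ (⟨a, rfl⟩ : of a ∈ of.range)).1 ?_
            simpa only [mul_assoc, mul_inv_cancel_left] using t_mul_mul_inv_t_mem_range h
          simp only [f, hx, hx', h1, h2]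
  by_contra hg
  exact (h ▸ (⟨hg, h₁, h₂⟩ : f g) : f 1).1 (one_mem _)

theorem fg_inf_range (hN : N.Normal) (hNC : N ⊓ C.map of = ⊥) (hfg : N.FG) :
    (N ⊓ (of : A →* HNNExtension A C D φ).range).FG := by
  have hC : ∀ n ∈ N, n ≠ 1 → n ∉ C.map of := fun n hn hn1 hnC ↦
    hn1 ((Subgroup.mem_bot).1 (hNC ▸ Subgroup.mem_inf.2 ⟨hn, hnC⟩))
  have hnest : ∀ n ∈ N, n ≠ 1 → ∀ z, (z ∈ H ↔ n⁻¹ ∉ H) → (n * z ∈ H ↔ n ∈ H) := by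
    intro n hn hn1 z hz
    have := hH.inv_mul_mem_iff (hC n⁻¹ (inv_mem hn) (by simpa using hn1)) hz
    rwa [inv_inv] at this
  let e : HNNExtension A C D φ → HNNExtension A C D φ → Prop := fun x y ↦
    ∀ a, (of a * x ∈ H ↔ of a * y ∈ H) ∧ (t⁻¹ * of a * x ∈ H ↔ t⁻¹ * of a * y ∈ H)
  let r : HNNExtension A C D φ → HNNExtension A C D φ → Prop := fun x y ↦
    x = y ∨ (x ∉ (of : A →* HNNExtension A C D φ).range ∧
      y ∉ (of : A →* HNNExtension A C D φ).range ∧ e x y)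
  refine hfg.inf_of_equivalence (r := r) ⟨fun x ↦ Or.inl rfl, ?_, ?_⟩ ?_ ?_ ?_
  · rintro x y (rfl | ⟨hx, hy, h⟩)
    · exact Or.inl rfl
    · exact Or.inr ⟨hy, hx, fun a ↦ ⟨(h a).1.symm, (h a).2.symm⟩⟩
  · rintro x y z (rfl | ⟨hx, hy, h⟩) (rfl | ⟨hy', hz, h'⟩)
    · exact Or.inl rfl
    · exact Or.inr ⟨hy', hz, h'⟩
    · exact Or.inr ⟨hx, hy, h⟩
    · exact Or.inr ⟨hx, hz, fun a ↦ ⟨(h a).1.trans (h' a).1, (h a).2.trans (h' a).2⟩⟩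
  · rintro _ ⟨-, p, rfl⟩ x y (rfl | ⟨hx, hy, h⟩)
    · exact Or.inl rfl
    · refine Or.inr ⟨?_, ?_, fun a ↦ ?_⟩
      · rwa [Subgroup.mul_mem_cancel_left _ (⟨p, rfl⟩ : of p ∈ of.range)]
      · rwa [Subgroup.mul_mem_cancel_left _ (⟨p, rfl⟩ : of p ∈ of.range)]
      · have := h (a * p)
        simpa only [map_mul, mul_assoc] using this
  · rintro p ⟨hpN, hpA⟩ n hn (h | ⟨-, hnA, h⟩)
    · exact mul_eq_right.1 h
    by_contra hp1
    have hbranch : ∃ a, of a * n ∈ H ∨ t⁻¹ * of a * n ∉ H := by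
      by_contra! hcon
      exact hnA (hH.mem_range_of_forall (fun a ↦ (hcon a).1) fun a ↦ (hcon a).2)
    obtain ⟨a, ha | ha⟩ := hbranch
    · have hqN := hN.conj_mem p hpN (of a)
      have hq1 : of a * p * (of a)⁻¹ ≠ 1 := by simpa using hp1
      have hqA : of a * p * (of a)⁻¹ ∈ (of : A →* HNNExtension A C D φ).range :=
        mul_mem (mul_mem ⟨a, rfl⟩ hpA) (inv_mem ⟨a, rfl⟩)
      have h1 := hnest _ hqN hq1 (of a * n)
        (iff_of_true ha (hH.notMem_of_mem_range (inv_mem hqA)))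
      rw [mul_assoc, inv_mul_cancel_left, mul_assoc, (h a).1] at h1
      exact hH.notMem_of_mem_range hqA (h1.1 ha)
    · have hq : ∀ p ∈ N, p ≠ 1 → p ∈ (of : A →* HNNExtension A C D φ).range →
          t⁻¹ * of a * p * (t⁻¹ * of a)⁻¹ ∈ H := by
        intro p hpN hp1 hpA
        have hqN := hN.conj_mem p hpN (t⁻¹ * of a)
        refine (hH.mul_inv_t_mem_iff _ (hC _ hqN (mt conj_eq_one_iff.1 hp1))).1 ?_
        obtain ⟨p, rfl⟩ := hpA
        have h1 : (t⁻¹ * of a * of p * (t⁻¹ * of a)⁻¹ * t⁻¹ : HNNExtension A C D φ) =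
            t⁻¹ * of (a * p * a⁻¹) := by
          simp [mul_assoc]
        rw [h1, hH.mul_of_mem_iff]
        exact hH.inv_t_mem
      have hqN := hN.conj_mem p hpN (t⁻¹ * of a)
      have hqH := hq p hpN hp1 hpA
      have hqH' := hq p⁻¹ (inv_mem hpN) (by simpa using hp1) (inv_mem hpA)
      rw [← conj_inv] at hqH'
      have h1 := hnest _ hqN (mt conj_eq_one_iff.1 hp1) (t⁻¹ * of a * n)
        (iff_of_false ha (not_not.2 hqH'))
      rw [mul_assoc _ (t⁻¹ * of a)⁻¹, inv_mul_cancel_left, mul_assoc, (h a).2] at h1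
      exact ha (h1.2 hqH)
  · intro s hs
    obtain ⟨F, hF, hFs⟩ := hH.exists_finite_crossing s
    refine ⟨{1, s} ∪ (F ∪ (fun f ↦ f * t⁻¹) '' F),
      (Set.toFinite _).union (hF.union (hF.image _)), fun n hn hr ↦ ?_⟩
    by_cases hnA : n ∈ (of : A →* HNNExtension A C D φ).range
    · exact ⟨1, by simp, by rwa [mul_one]⟩
    by_cases hnsA : n * s ∈ (of : A →* HNNExtension A C D φ).range
    · exact ⟨s, by simp, hnsA⟩
    have he : ¬ e n (n * s) := fun h ↦ hr (Or.inr ⟨hnA, hnsA, h⟩)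
    obtain ⟨a, ha⟩ := not_forall.1 he
    by_cases h1 : of a * n * s ∈ H ↔ of a * n ∈ H
    · have h2 : ¬ (t⁻¹ * of a * n * s ∈ H ↔ t⁻¹ * of a * n ∈ H) := fun h2 ↦
        ha ⟨by rw [← mul_assoc, h1], by rw [← mul_assoc, h2]⟩
      obtain ⟨f, hf, h⟩ := hFs _ h2
      refine ⟨f * t⁻¹, Or.inr (Or.inr ⟨f, hf, rfl⟩), ?_⟩
      refine (Subgroup.mul_mem_cancel_left _ (⟨a, rfl⟩ : of a ∈ of.range)).1 ?_
      simpa only [mul_assoc, mul_inv_cancel_left] using t_mul_mul_inv_t_mem_range h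
    · obtain ⟨f, hf, h⟩ := hFs _ h1
      refine ⟨f, Or.inr (Or.inl hf), ?_⟩
      refine (Subgroup.mul_mem_cancel_left _ (⟨a, rfl⟩ : of a ∈ of.range)).1 ?_
      rw [← mul_assoc]
      exact Subgroup.map_le_range _ _ h

end IsHalfTree
end HNNExtension

/-- If `N ⊓ C = ⊥` then every element of `G` factors as `n * x * c`, where `n ∈ N` is unique,
`c ∈ C`, and `x` is the chosen representative of its coset modulo `N ⊔ C`. -/
theorem Subgroup.exists_equivariant_section {G : Type*} [Group G] {N C : Subgroup G}
    (hN : N.Normal) (hNC : N ⊓ C = ⊥) : ∃ ν : G → G, (∀ g, ν g ∈ N) ∧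
      (∀ n ∈ N, ∀ g, ν (n * g) = n * ν g) ∧ (∀ c ∈ C, ∀ g, ν (g * c) = ν g) ∧
      ∀ g, ∃ c ∈ C, g = ν g * (g : G ⧸ (N ⊔ C)).out * c := by
  have hex : ∀ g : G, ∃ n ∈ N, ∃ c ∈ C, g = n * (g : G ⧸ (N ⊔ C)).out * c := by
    intro g
    have h : (g : G ⧸ (N ⊔ C)).out⁻¹ * g ∈ N ⊔ C :=
      QuotientGroup.eq.1 (QuotientGroup.out_eq' _)
    obtain ⟨n, hn, c, hc, h⟩ := Subgroup.mem_sup_of_normal_left.1 h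
    refine ⟨_, hN.conj_mem n hn (g : G ⧸ (N ⊔ C)).out, c, hc, ?_⟩
    rw [inv_mul_cancel_right, mul_assoc, h, mul_inv_cancel_left]
  choose ν hν c hc hg using hex
  have huniq : ∀ n ∈ N, ∀ m ∈ N, ∀ c ∈ C, ∀ d ∈ C, ∀ x, n * x * c = m * x * d → n = m := by
    intro n hn m hm c hc d hd x h
    have h1 : x⁻¹ * (m⁻¹ * n) * x⁻¹⁻¹ = d * c⁻¹ := by
      rw [inv_inv, eq_mul_inv_iff_mul_eq, mul_assoc, mul_assoc, mul_assoc, ← mul_assoc n, h]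
      group
    have h2 : x⁻¹ * (m⁻¹ * n) * x⁻¹⁻¹ ∈ N ⊓ C :=
      ⟨hN.conj_mem _ (N.mul_mem (N.inv_mem hm) hn) _, h1 ▸ C.mul_mem hd (C.inv_mem hc)⟩
    rw [hNC, Subgroup.mem_bot, conj_eq_one_iff, inv_mul_eq_one] at h2
    exact h2.symm
  refine ⟨ν, hν, fun n hn g ↦ ?_, fun d hd g ↦ ?_, fun g ↦ ⟨c g, hc g, hg g⟩⟩
  · have h : ((n * g : G) : G ⧸ (N ⊔ C)) = g := by
      refine (QuotientGroup.eq.2 (Subgroup.mem_sup_left ?_)).symm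
      simpa [mul_assoc] using hN.conj_mem n hn g⁻¹
    refine huniq _ (hν _) _ (mul_mem hn (hν g)) _ (hc (n * g)) _ (hc g) (g : G ⧸ (N ⊔ C)).out ?_
    have h1 := hg (n * g)
    rw [h] at h1
    rw [← h1, mul_assoc n, mul_assoc n, ← hg]
  · have h : ((g * d : G) : G ⧸ (N ⊔ C)) = g :=
      (QuotientGroup.eq.2 (Subgroup.mem_sup_right (by simpa using hd))).symm
    refine huniq _ (hν _) _ (hν g) _ (hc (g * d)) _ (mul_mem (hc g) hd)
      (g : G ⧸ (N ⊔ C)).out ?_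
    have h1 := hg (g * d)
    rw [h] at h1
    rw [← h1, ← mul_assoc, ← hg]

namespace HNNExtension

variable {A : Type*} [Group A] {C D : Subgroup A} {φ : C ≃* D}
  {N : Subgroup (HNNExtension A C D φ)}

theorem fg_of_finiteIndex (hN : N.Normal) (hNC : N ⊓ C.map of = ⊥)
    (hfin : (N ⊔ C.map of).FiniteIndex)
    (hfg : (N ⊓ (of : A →* HNNExtension A C D φ).range).FG) : N.FG := by
  obtain ⟨ν, hν, hνN, hνC, hνx⟩ := Subgroup.exists_equivariant_section hN hNC
  set K := N ⊔ C.map of with hK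
  have : Finite (HNNExtension A C D φ ⧸ K) := inferInstance
  let X : HNNExtension A C D φ ⧸ K → HNNExtension A C D φ := Quotient.out
  let L : Subgroup (HNNExtension A C D φ) :=
    ⨆ q, (N ⊓ (of : A →* HNNExtension A C D φ).range).map (MulAut.conj (X q)).toMonoidHom
  have hL : L.FG := Subgroup.FG.iSup _ fun q ↦ by
    obtain ⟨S, hS, hSf⟩ := (Subgroup.fg_iff _).1 hfg
    exact (Subgroup.fg_iff _).2 ⟨_, by rw [← MonoidHom.map_closure, hS], hSf.image _⟩
  have hLN : L ≤ N := iSup_le fun q ↦ by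
    rintro _ ⟨p, hp, rfl⟩
    exact hN.conj_mem p hp.1 _
  have hfinite : ∀ u : HNNExtension A C D φ, (∀ c ∈ C.map of, u * c * u⁻¹ ∈ (of : A →*
      HNNExtension A C D φ).range) → ∃ T : Set (HNNExtension A C D φ), T.Finite ∧ T ⊆ N ∧
      ∀ q, ∀ a, ∃ l ∈ L, ∃ τ ∈ T, ν (X q * of a * u) = l * τ := by
    intro u hu
    have hrep : ∀ κ : HNNExtension A C D φ ⧸ K, ∃ b : A,
        (∃ a : A, ((of a * u : HNNExtension A C D φ) : HNNExtension A C D φ ⧸ K) = κ) →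
        ((of b * u : HNNExtension A C D φ) : HNNExtension A C D φ ⧸ K) = κ := by
      intro κ
      by_cases h : ∃ a : A, ((of a * u : HNNExtension A C D φ) : HNNExtension A C D φ ⧸ K) = κ
      · exact ⟨h.choose, fun _ ↦ h.choose_spec⟩
      · exact ⟨1, fun h' ↦ absurd h' h⟩
    choose b hb using hrep
    refine ⟨Set.range fun z : (HNNExtension A C D φ ⧸ K) × (HNNExtension A C D φ ⧸ K) ↦
      ν (X z.1 * of (b z.2) * u), Set.finite_range _, ?_, fun q a ↦ ?_⟩
    · rintro _ ⟨z, rfl⟩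
      exact hν _
    · let κ : HNNExtension A C D φ ⧸ K := QuotientGroup.mk (of a * u)
      have h1 : (of (b κ) * u)⁻¹ * (of a * u) ∈ K := QuotientGroup.eq.1 (hb κ ⟨a, rfl⟩)
      obtain ⟨n, hn, c, hc, h⟩ := Subgroup.mem_sup_of_normal_left.1 h1
      have h2 : of a * u = of (b κ) * (u * n * u⁻¹) * u * c := by
        rw [inv_mul_eq_iff_eq_mul.1 h.symm]
        group
      have h3 : of (b κ) * (u * n * u⁻¹) * (of (b κ))⁻¹ =
          of a * (u * c * u⁻¹)⁻¹ * (of (b κ))⁻¹ := by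
        rw [← mul_inv_eq_iff_eq_mul] at h2
        have : of (b κ) * (u * n * u⁻¹) = of a * u * c⁻¹ * u⁻¹ := by rw [h2]; group
        rw [this]
        group
      have hp : of (b κ) * (u * n * u⁻¹) * (of (b κ))⁻¹ ∈
          N ⊓ (of : A →* HNNExtension A C D φ).range :=
        by
        refine ⟨hN.conj_mem _ (hN.conj_mem n hn u) _, ?_⟩
        rw [h3]
        exact Subgroup.mul_mem _ (Subgroup.mul_mem _ ⟨a, rfl⟩ (Subgroup.inv_mem _ (hu c hc)))
          (Subgroup.inv_mem _ ⟨b κ, rfl⟩)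
      refine ⟨_, Subgroup.mem_iSup_of_mem q (Subgroup.mem_map_of_mem _ hp), _, ⟨(q, κ), rfl⟩, ?_⟩
      simp only [MulEquiv.coe_toMonoidHom, MulAut.conj_apply]
      rw [← hνN _ (hN.conj_mem _ hp.1 _), ← hνC c hc (_ * (X q * of (b κ) * u)),
        mul_assoc (X q) (of a), h2]
      congr 1
      group
  obtain ⟨T₁, hT₁, hT₁N, h₁⟩ := hfinite 1 fun c hc ↦ by
    simpa [-Subgroup.mem_map] using Subgroup.map_le_range _ _ hc
  obtain ⟨T₂, hT₂, hT₂N, h₂⟩ := hfinite t fun c hc ↦ t_mul_mul_inv_t_mem_range hc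
  let M : Subgroup (HNNExtension A C D φ) := L ⊔ Subgroup.closure (insert (ν 1) (T₁ ∪ T₂))
  have hM : M.FG := hL.sup
    ((Subgroup.fg_iff _).2 ⟨_, rfl, (hT₁.union hT₂).insert _⟩)
  have hMN : M ≤ N := sup_le hLN <| (Subgroup.closure_le _).2 <|
    Set.insert_subset (hν 1) (Set.union_subset hT₁N hT₂N)
  have hTM : insert (ν 1) (T₁ ∪ T₂) ⊆ (M : Set (HNNExtension A C D φ)) := fun x hx ↦
    Subgroup.mem_sup_right (Subgroup.subset_closure hx)
  have hmem : ∀ q a, ν (X q * of a) ∈ M ∧ ν (X q * of a * t) ∈ M := by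
    intro q a
    obtain ⟨l, hl, τ, hτ, h⟩ := h₁ q a
    obtain ⟨l', hl', τ', hτ', h'⟩ := h₂ q a
    rw [mul_one] at h
    rw [h, h']
    exact ⟨mul_mem (Subgroup.mem_sup_left hl) (hTM (Or.inr (Or.inl hτ))),
      mul_mem (Subgroup.mem_sup_left hl') (hTM (Or.inr (Or.inr hτ')))⟩
  have hstep : ∀ g a, ∃ m ∈ M, ∃ m' ∈ M, ν (g * of a) = ν g * m ∧ ν (g * t) = ν g * m' := by
    intro g a
    obtain ⟨_, ⟨c, hc, rfl⟩, h⟩ := hνx g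
    refine ⟨_, (hmem g (c * a)).1, _, (hmem g c).2, ?_, ?_⟩
    · rw [← hνN _ (hν g), map_mul]
      nth_rewrite 1 [h]
      simp only [X, mul_assoc]
    · rw [← hνN _ (hν g)]
      nth_rewrite 1 [h]
      simp only [X, mul_assoc]
  have hconst : ∀ g, (ν g ∈ M) = (ν 1 ∈ M) := by
    refine apply_eq_apply_one (fun g a ↦ ?_) fun g ↦ ?_
    · obtain ⟨m, hm, -, -, h, -⟩ := hstep g a
      rw [h, M.mul_mem_cancel_right hm]
    · obtain ⟨-, -, m, hm, -, h⟩ := hstep (g * t⁻¹) 1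
      rw [inv_mul_cancel_right] at h
      rw [h, M.mul_mem_cancel_right hm]
  have hν1 : ν 1 ∈ M := hTM (Or.inl rfl)
  suffices N ≤ M from le_antisymm this hMN ▸ hM
  intro n hn
  have h := hνN n hn 1
  rw [mul_one] at h
  exact (M.mul_mem_cancel_right hν1).1 (h ▸ (hconst n).symm ▸ hν1)

end HNNExtension

/-- Let `G = A∗_C` be an HNN extension with base group `A` and associated
subgroups `C` and `D`, and let `N` be a nontrivial normal subgroup of `G` with `N ∩ C = {1}`.
Then `N` is finitely generated if and only if the subgroup `N ⊔ C` generated by `N` and `C`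
has finite index in `G` and `N ⊓ A` is finitely generated. -/
theorem stmt_14 {A : Type*} [Group A] (C D : Subgroup A) (φ : C ≃* D)
    (N : Subgroup (HNNExtension A C D φ)) (hNnorm : N.Normal) (hNne : N ≠ ⊥)
    (hNC : N ⊓ Subgroup.map (HNNExtension.of : A →* HNNExtension A C D φ) C = ⊥) :
    N.FG ↔ (N ⊔ Subgroup.map (HNNExtension.of : A →* HNNExtension A C D φ) C).FiniteIndex ∧
      (N ⊓ (HNNExtension.of : A →* HNNExtension A C D φ).range).FG := by
  obtain ⟨H, hH⟩ := HNNExtension.exists_isHalfTree (φ := φ)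
  exact ⟨fun h ↦ ⟨hH.finiteIndex_of_fg hNnorm hNne hNC h, hH.fg_inf_range hNnorm hNC h⟩,
    fun h ↦ HNNExtension.fg_of_finiteIndex hNnorm hNC h.1 h.2⟩
end

section
/- Let G = A∗_C be an HNN extension with base group A and associated subgroups C and D, and let N be a nontrivial finitely generated normal subgroup of G with N ∩ C = {1}. Let a = [G : NA] and c = [G : NC] be the (finite) indices of the subgroups generated by N together with A and with C respectively. Then, as an equation of integers, rank(N) = a·rank(N ∩ A) + 1 + c − a, where rank denotes the minimal number of generators of a group. -/
/-- The rank of a group: the minimal cardinality of a (finite) generating set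
(with junk value `0` via `sInf ∅` if the group is not finitely generated). -/
noncomputable def minRank (G : Type*) [Group G] : ℕ :=
  sInf {n : ℕ | ∃ S : Finset G, S.card = n ∧ Subgroup.closure (S : Set G) = ⊤}

open MulAction

section GeneratedBy

/-- The subgroup `H` is generated by at most `k` elements. -/
def Subgroup.GeneratedBy {G : Type*} [Group G] (H : Subgroup G) (k : ℕ) : Prop :=
  ∃ S : Finset G, S.card ≤ k ∧ Subgroup.closure (S : Set G) = H

namespace Subgroup.GeneratedBy

variable {G : Type*} [Group G] {H K : Subgroup G} {k l : ℕ}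

theorem sup (hH : H.GeneratedBy k) (hK : K.GeneratedBy l) : (H ⊔ K).GeneratedBy (k + l) := by
  classical
  obtain ⟨S, hS, rfl⟩ := hH
  obtain ⟨T, hT, rfl⟩ := hK
  refine ⟨S ∪ T, (Finset.card_union_le _ _).trans (by omega), ?_⟩
  rw [Finset.coe_union, Subgroup.closure_union]

theorem zpowers (g : G) : (Subgroup.zpowers g).GeneratedBy 1 :=
  ⟨{g}, by simp, by simp [Subgroup.zpowers_eq_closure]⟩

theorem bot (G : Type*) [Group G] : (⊥ : Subgroup G).GeneratedBy 0 := ⟨∅, by simp, by simp⟩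

theorem map {G' : Type*} [Group G'] (f : G →* G') (hH : H.GeneratedBy k) :
    (H.map f).GeneratedBy k := by
  classical
  obtain ⟨S, hS, rfl⟩ := hH
  refine ⟨S.image f, Finset.card_image_le.trans hS, ?_⟩
  rw [Finset.coe_image, MonoidHom.map_closure]

theorem top_subtype (hH : H.GeneratedBy k) : (⊤ : Subgroup H).GeneratedBy k := by
  classical
  obtain ⟨S, hS, rfl⟩ := hH
  refine ⟨S.preimage Subtype.val Subtype.val_injective.injOn, ?_, ?_⟩
  · exact (Finset.card_le_card_of_injOn Subtype.val (by intro a ha; simpa using ha)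
      Subtype.val_injective.injOn).trans hS
  · rw [Finset.coe_preimage]
    exact Subgroup.closure_closure_coe_preimage

theorem minRank_le (h : (⊤ : Subgroup G).GeneratedBy k) : minRank G ≤ k := by
  obtain ⟨S, hS, hc⟩ := h
  have : minRank G ≤ S.card := Nat.sInf_le ⟨S, rfl, hc⟩
  exact this.trans hS

theorem top_minRank (h : (⊤ : Subgroup G).GeneratedBy k) :
    (⊤ : Subgroup G).GeneratedBy (minRank G) := by
  obtain ⟨S, -, hc⟩ := h
  have hne : {n : ℕ | ∃ S : Finset G, S.card = n ∧ Subgroup.closure (S : Set G) = ⊤}.Nonempty :=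
    ⟨_, S, rfl, hc⟩
  obtain ⟨T, hT, hc'⟩ := Nat.sInf_mem hne
  exact ⟨T, hT.le, hc'⟩

theorem stabilizer_smul {X : Type*} [MulAction G X] {x : X} (g : G)
    (h : (stabilizer G x).GeneratedBy k) : (stabilizer G (g • x)).GeneratedBy k := by
  rw [stabilizer_smul_eq_stabilizer_map_conj]
  exact h.map _

end Subgroup.GeneratedBy

end GeneratedBy

section TreeMetric

/-- A `ℕ`-valued distance on `T` which is the path metric of a tree with vertex set `T`. -/
structure IsTreeMetric {T : Type*} (δ : T → T → ℕ) : Prop where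
  eq_zero_iff : ∀ x y, δ x y = 0 ↔ x = y
  comm : ∀ x y, δ x y = δ y x
  step : ∀ x {y z}, δ y z = 1 → δ x z = δ x y + 1 ∨ δ x y = δ x z + 1
  exists_parent : ∀ {x y}, x ≠ y → ∃ z, δ y z = 1 ∧ δ x z + 1 = δ x y
  parent_unique : ∀ {x y z z'}, δ y z = 1 → δ y z' = 1 → δ x z + 1 = δ x y →
    δ x z' + 1 = δ x y → z = z'

/-- The neighbour of `x` on the way to `y` is also on the way to each neighbour of `y` other
than `x`. -/
theorem IsTreeMetric.parent_of_adj {T : Type*} {δ : T → T → ℕ} (hδ : IsTreeMetric δ)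
    {x x' y y' : T} (hy : δ y y' = 1) (hx : δ x x' = 1) (h : δ y x' + 1 = δ y x)
    (hne : x ≠ y') : δ y' x' + 1 = δ y' x := by
  rcases hδ.step y' hx with h1 | h1
  · exfalso
    obtain ⟨x'', hx'', hp⟩ := hδ.exists_parent hne.symm
    have e1 := hδ.step x hy
    have e2 := hδ.step x' hy
    have e3 := hδ.step x'' hy
    have e4 := hδ.step y hx''
    simp only [hδ.comm _ y, hδ.comm _ y'] at e1 e2 e3 e4
    have : x' = x'' := hδ.parent_unique (x := y) hx hx'' h (by omega)
    subst this
    omega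
  · exact h1.symm

end TreeMetric

section Identify

variable {N V : Type*} [Group N] [MulAction N V]

/-- The union of the orbits of `x` and `y` under `K`. -/
def pairBlock (K : Subgroup N) (x y : V) : Set V := {z | ∃ k ∈ K, k • x = z ∨ k • y = z}

/-- The subgroup `K` contains every element that carries a point of `{x, y}` into `{x, y}`. -/
structure IsPairSubgroup (K : Subgroup N) (x y : V) : Prop where
  left : ∀ g : N, g • x = x → g ∈ K
  right : ∀ g : N, g • y = y → g ∈ K
  cross : ∀ g : N, g • x = y → g ∈ K

namespace IsPairSubgroup

variable {K : Subgroup N} {x y : V}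

theorem mem_of_smul_mem (h : IsPairSubgroup K x y) {g : N} {b : V} (hb : b ∈ pairBlock K x y)
    (hgb : g • b ∈ pairBlock K x y) : g ∈ K := by
  obtain ⟨k, hk, hb⟩ := hb
  obtain ⟨l, hl, hgb⟩ := hgb
  suffices l⁻¹ * g * k ∈ K by
    rwa [K.mul_mem_cancel_right hk, K.mul_mem_cancel_left (K.inv_mem hl)] at this
  rcases hb with rfl | rfl <;> rcases hgb with e | e
  · exact h.left _ (by rw [mul_smul, mul_smul, ← e, inv_smul_smul])
  · exact h.cross _ (by rw [mul_smul, mul_smul, ← e, inv_smul_smul])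
  · rw [← K.inv_mem_iff]
    exact h.cross _ (by rw [inv_smul_eq_iff, mul_smul, mul_smul, ← e, inv_smul_smul])
  · exact h.right _ (by rw [mul_smul, mul_smul, ← e, inv_smul_smul])

theorem smul_mem {k : N} (hk : k ∈ K) {b : V} (hb : b ∈ pairBlock K x y) :
    k • b ∈ pairBlock K x y := by
  obtain ⟨l, hl, hb⟩ := hb
  refine ⟨k * l, K.mul_mem hk hl, ?_⟩
  rcases hb with rfl | rfl <;> simp [mul_smul]

/-- The invariant equivalence relation collapsing each translate of the block of `x` and `y`. -/
def setoid (h : IsPairSubgroup K x y) : Setoid V where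
  r a b := a = b ∨ ∃ g : N, g • a ∈ pairBlock K x y ∧ g • b ∈ pairBlock K x y
  iseqv :=
    { refl := fun _ => Or.inl rfl
      symm := by
        rintro a b (rfl | ⟨g, ha, hb⟩)
        · exact Or.inl rfl
        · exact Or.inr ⟨g, hb, ha⟩
      trans := by
        rintro a b c (rfl | ⟨g, ha, hb⟩) (rfl | ⟨k, hb', hc⟩)
        · exact Or.inl rfl
        · exact Or.inr ⟨k, hb', hc⟩
        · exact Or.inr ⟨g, ha, hb⟩
        · refine Or.inr ⟨g, ha, ?_⟩
          have hm : g * k⁻¹ ∈ K := h.mem_of_smul_mem hb' (by simpa [mul_smul] using hb)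
          simpa [mul_smul] using smul_mem hm hc }

/-- The quotient of `V` by the smallest invariant relation identifying `x` and `y`. -/
def Quot (h : IsPairSubgroup K x y) : Type _ := Quotient h.setoid

/-- The projection to the quotient. -/
def proj (h : IsPairSubgroup K x y) (a : V) : h.Quot := Quotient.mk h.setoid a

theorem proj_eq_iff (h : IsPairSubgroup K x y) {a b : V} : h.proj a = h.proj b ↔
    a = b ∨ ∃ g : N, g • a ∈ pairBlock K x y ∧ g • b ∈ pairBlock K x y :=
  Quotient.eq (r := h.setoid)

theorem proj_surjective (h : IsPairSubgroup K x y) : Function.Surjective h.proj :=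
  Quotient.mk_surjective

instance (h : IsPairSubgroup K x y) : MulAction N h.Quot where
  smul n := Quotient.map (sa := h.setoid) (sb := h.setoid) (n • ·) (by
    rintro a b (rfl | ⟨g, ha, hb⟩)
    · exact Or.inl rfl
    · exact Or.inr ⟨g * n⁻¹, by simpa [mul_smul] using ha, by simpa [mul_smul] using hb⟩)
  one_smul := by
    intro q
    obtain ⟨a, rfl⟩ := h.proj_surjective q
    exact congrArg h.proj (one_smul N a)
  mul_smul := by
    intro m n q
    obtain ⟨a, rfl⟩ := h.proj_surjective q
    exact congrArg h.proj (mul_smul m n a)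

theorem proj_smul (h : IsPairSubgroup K x y) (n : N) (a : V) : h.proj (n • a) = n • h.proj a :=
  rfl

theorem left_mem (K : Subgroup N) (x y : V) : x ∈ pairBlock K x y :=
  ⟨1, K.one_mem, Or.inl (one_smul _ _)⟩

theorem right_mem (K : Subgroup N) (x y : V) : y ∈ pairBlock K x y :=
  ⟨1, K.one_mem, Or.inr (one_smul _ _)⟩

theorem proj_left_eq_right (h : IsPairSubgroup K x y) : h.proj x = h.proj y :=
  h.proj_eq_iff.2 (Or.inr ⟨1, by simpa using left_mem K x y, by simpa using right_mem K x y⟩)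

theorem stabilizer_proj_left (h : IsPairSubgroup K x y) : stabilizer N (h.proj x) = K := by
  ext n
  rw [mem_stabilizer_iff, ← proj_smul, proj_eq_iff]
  constructor
  · rintro (e | ⟨g, h1, h2⟩)
    · exact h.left _ e
    · have hg := h.mem_of_smul_mem (left_mem K x y) h2
      rw [← mul_smul] at h1
      have hgn := h.mem_of_smul_mem (left_mem K x y) h1
      rwa [K.mul_mem_cancel_left hg] at hgn
  · intro hn
    exact Or.inr ⟨1, by simpa using smul_mem hn (left_mem K x y), by simpa using left_mem K x y⟩

theorem stabilizer_proj_of_forall (h : IsPairSubgroup K x y) {a : V}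
    (ha : ∀ g : N, g • a ≠ x ∧ g • a ≠ y) : stabilizer N (h.proj a) = stabilizer N a := by
  ext n
  rw [mem_stabilizer_iff, ← proj_smul, proj_eq_iff, mem_stabilizer_iff, or_iff_left]
  rintro ⟨g, -, k, hk, e | e⟩
  · exact (ha (k⁻¹ * g)).1 (by rw [mul_smul, ← e, inv_smul_smul])
  · exact (ha (k⁻¹ * g)).2 (by rw [mul_smul, ← e, inv_smul_smul])

theorem exists_smul_eq_of_mem {b : V} (hb : b ∈ pairBlock K x y) :
    ∃ g : N, g • b = x ∨ g • b = y := by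
  obtain ⟨k, -, e⟩ := hb
  refine ⟨k⁻¹, ?_⟩
  rcases e with rfl | rfl <;> simp

end IsPairSubgroup

end Identify

theorem Fintype.sum_subtype_ne {ι M : Type*} [Fintype ι] [AddCommGroup M] (j : ι)
    [Fintype {i // i ≠ j}] (F : ι → M) : ∑ i : {i // i ≠ j}, F i = ∑ i, F i - F j := by
  classical
  rw [eq_sub_iff_add_eq, ← Finset.sum_erase_add _ _ (Finset.mem_univ j)]
  congr 1
  exact (Finset.sum_subtype _ (by simp) F).symm

theorem Fintype.card_subtype_ne_int {ι : Type*} [Fintype ι] (j : ι) [Fintype {i // i ≠ j}] :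
    (Fintype.card {i // i ≠ j} : ℤ) = Fintype.card ι - 1 := by
  simpa using Fintype.sum_subtype_ne (M := ℤ) j (fun _ => 1)

universe u v

/-- An `N`-set `V` with finitely many orbits over the `N`-set `T`, with a transversal `r` of the
orbits and bounds `d` on the numbers of generators of the corresponding stabilizers. -/
structure VertexData (N : Type u) [Group N] (T : Type v) [MulAction N T] where
  V : Type u
  [act : MulAction N V]
  f : V → T
  f_smul : ∀ (n : N) (x : V), f (n • x) = n • f x
  I : Type
  [fintypeI : Fintype I]
  r : I → V
  exists_rep : ∀ x, ∃ i, ∃ n : N, n • r i = x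
  rep_inj : ∀ i j (n : N), n • r i = r j → i = j
  d : I → ℕ
  gen : ∀ i, (stabilizer N (r i)).GeneratedBy (d i)

namespace VertexData

attribute [instance] VertexData.act VertexData.fintypeI

variable {N : Type u} [Group N] {T : Type v} [MulAction N T]

/-- The contribution of the vertices to the complexity of a graph. -/
def cost (D : VertexData N T) : ℤ := ∑ i, (D.d i : ℤ) - Fintype.card D.I

/-- The result of identifying two points of an `N`-set over `T`, given a transversal of the
orbits of the quotient. -/
def identify (D : VertexData N T) {K : Subgroup N} {x y : D.V} (h : IsPairSubgroup K x y)
    (hf : D.f x = D.f y) (hK : K ≤ stabilizer N (D.f x)) {I : Type} [Fintype I]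
    (r : I → D.V) (exists_rep : ∀ z, ∃ i, ∃ n : N, n • h.proj (r i) = h.proj z)
    (rep_inj : ∀ i j (n : N), n • h.proj (r i) = h.proj (r j) → i = j) (d : I → ℕ)
    (gen : ∀ i, (stabilizer N (h.proj (r i))).GeneratedBy (d i)) : VertexData N T where
  V := h.Quot
  f := Quotient.lift (s := h.setoid) D.f (by
    have key : ∀ b ∈ pairBlock K x y, D.f b = D.f x := by
      rintro _ ⟨k, hk, rfl | rfl⟩
      · rw [D.f_smul]; exact hK hk
      · rw [D.f_smul, ← hf]; exact hK hk
    rintro a b (rfl | ⟨g, ha, hb⟩)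
    · rfl
    · have := (key _ ha).trans (key _ hb).symm
      rwa [D.f_smul, D.f_smul, smul_left_cancel_iff] at this)
  f_smul := by
    intro n q
    obtain ⟨a, rfl⟩ := h.proj_surjective q
    exact D.f_smul n a
  I := I
  r i := h.proj (r i)
  exists_rep := by
    intro q
    obtain ⟨a, rfl⟩ := h.proj_surjective q
    exact exists_rep a
  rep_inj := rep_inj
  d := d
  gen := gen

theorem exists_identify_rep (D : VertexData N T) (i : D.I) (y : D.V) (hf : D.f (D.r i) = D.f y) :
    ∃ (D' : VertexData N T) (π : D.V → D'.V), (∀ (n : N) x, π (n • x) = n • π x) ∧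
      Function.Surjective π ∧ (∀ x, D'.f (π x) = D.f x) ∧ π (D.r i) = π y ∧
      D'.cost ≤ D.cost + 1 := by
  classical
  obtain ⟨j, g, hg⟩ := D.exists_rep y
  have stab_le : stabilizer N (D.r i) ≤ stabilizer N (D.f (D.r i)) := fun n hn => by
    rw [mem_stabilizer_iff, ← D.f_smul, hn]
  have stab_le' : stabilizer N y ≤ stabilizer N (D.f (D.r i)) := fun n hn => by
    rw [mem_stabilizer_iff, hf, ← D.f_smul, hn]
  by_cases hij : i = j
  · subst hij
    have hgK : g ∈ stabilizer N (D.r i) ⊔ Subgroup.zpowers g :=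
      Subgroup.mem_sup_right (Subgroup.mem_zpowers g)
    have hl : stabilizer N (D.r i) ≤ stabilizer N (D.r i) ⊔ Subgroup.zpowers g := le_sup_left
    have h : IsPairSubgroup (stabilizer N (D.r i) ⊔ Subgroup.zpowers g) (D.r i) y := by
      refine ⟨fun n hn => hl hn, fun n hn => ?_, fun n hn => ?_⟩
      · have : g⁻¹ * n * g ∈ stabilizer N (D.r i) := by
          rw [mem_stabilizer_iff, mul_smul, mul_smul, hg, hn, ← hg, inv_smul_smul]
        have := hl this
        rwa [Subgroup.mul_mem_cancel_right _ hgK,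
          Subgroup.mul_mem_cancel_left _ (inv_mem hgK)] at this
      · have : g⁻¹ * n ∈ stabilizer N (D.r i) := by
          rw [mem_stabilizer_iff, mul_smul, hn, ← hg, inv_smul_smul]
        have := hl this
        rwa [Subgroup.mul_mem_cancel_left _ (inv_mem hgK)] at this
    have hK : stabilizer N (D.r i) ⊔ Subgroup.zpowers g ≤ stabilizer N (D.f (D.r i)) := by
      refine sup_le stab_le ?_
      rw [Subgroup.zpowers_le, mem_stabilizer_iff, ← D.f_smul, hg, hf]
    have orb : ∀ {b : D.V}, b ∈ pairBlock (stabilizer N (D.r i) ⊔ Subgroup.zpowers g) (D.r i) y →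
        ∃ n : N, n • b = D.r i := fun hb => by
      obtain ⟨n, e | e⟩ := IsPairSubgroup.exists_smul_eq_of_mem hb
      · exact ⟨n, e⟩
      · exact ⟨g⁻¹ * n, by rw [mul_smul, e, ← hg, inv_smul_smul]⟩
    refine ⟨D.identify h hf hK D.r ?_ ?_ (Function.update D.d i (D.d i + 1)) ?_, h.proj,
      h.proj_smul, h.proj_surjective, fun _ => rfl, h.proj_left_eq_right, ?_⟩
    · intro z
      obtain ⟨k, n, rfl⟩ := D.exists_rep z
      exact ⟨k, n, rfl⟩
    · intro k l n e
      rw [← h.proj_smul, h.proj_eq_iff] at e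
      rcases e with e | ⟨m, h1, h2⟩
      · exact D.rep_inj _ _ _ e
      · obtain ⟨n1, e1⟩ := orb h1
        obtain ⟨n2, e2⟩ := orb h2
        rw [← mul_smul, ← mul_smul] at e1
        rw [← mul_smul] at e2
        rw [D.rep_inj _ _ _ e1, D.rep_inj _ _ _ e2]
    · intro k
      by_cases hk : k = i
      · subst hk
        rw [Function.update_self, h.stabilizer_proj_left]
        exact (D.gen k).sup (.zpowers g)
      · rw [Function.update_of_ne hk, h.stabilizer_proj_of_forall]
        · exact D.gen k
        · refine fun n => ⟨fun e => hk (D.rep_inj _ _ _ e), fun e => hk ?_⟩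
          refine D.rep_inj _ _ (g⁻¹ * n) ?_
          rw [mul_smul, e, ← hg, inv_smul_smul]
    · have hsum : ∑ k, (Function.update D.d i (D.d i + 1) k : ℤ) = ∑ k, (D.d k : ℤ) + 1 := by
        have : ∀ k, (Function.update D.d i (D.d i + 1) k : ℤ)
            = D.d k + if k = i then 1 else 0 := by
          intro k
          by_cases hk : k = i
          · subst hk; simp
          · simp [hk]
        simp only [this, Finset.sum_add_distrib, Finset.sum_ite_eq', Finset.mem_univ, if_true]
      change ∑ k, (Function.update D.d i (D.d i + 1) k : ℤ) - (Fintype.card D.I : ℤ) ≤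
        ∑ k, (D.d k : ℤ) - Fintype.card D.I + 1
      rw [hsum]
      linarith
  · have hl : stabilizer N (D.r i) ≤ stabilizer N (D.r i) ⊔ stabilizer N y := le_sup_left
    have hr : stabilizer N y ≤ stabilizer N (D.r i) ⊔ stabilizer N y := le_sup_right
    have ne : ∀ n : N, n • D.r i ≠ y := fun n hn => hij <| D.rep_inj i j (g⁻¹ * n) <| by
      rw [mul_smul, hn, ← hg, inv_smul_smul]
    have h : IsPairSubgroup (stabilizer N (D.r i) ⊔ stabilizer N y) (D.r i) y :=
      ⟨fun n hn => hl hn, fun n hn => hr hn, fun n hn => (ne n hn).elim⟩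
    have orb : ∀ {b : D.V}, b ∈ pairBlock (stabilizer N (D.r i) ⊔ stabilizer N y) (D.r i) y →
        ∃ n : N, n • b = D.r i ∨ n • b = D.r j := fun hb => by
      obtain ⟨n, e | e⟩ := IsPairSubgroup.exists_smul_eq_of_mem hb
      · exact ⟨n, Or.inl e⟩
      · exact ⟨g⁻¹ * n, Or.inr (by rw [mul_smul, e, ← hg, inv_smul_smul])⟩
    refine ⟨D.identify h hf (sup_le stab_le stab_le') (I := {k // k ≠ j}) (fun k => D.r k)
      ?_ ?_ (fun k => if (k : D.I) = i then D.d i + D.d j else D.d k) ?_, h.proj,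
      h.proj_smul, h.proj_surjective, fun _ => rfl, h.proj_left_eq_right, ?_⟩
    · intro z
      obtain ⟨k, n, rfl⟩ := D.exists_rep z
      by_cases hk : k = j
      · subst hk
        refine ⟨⟨i, hij⟩, n * g⁻¹, ?_⟩
        rw [h.proj_left_eq_right, ← h.proj_smul, mul_smul]
        exact congrArg (fun z => h.proj (n • z)) (by rw [← hg, inv_smul_smul])
      · exact ⟨⟨k, hk⟩, n, rfl⟩
    · intro k l n e
      rw [← h.proj_smul, h.proj_eq_iff] at e
      apply Subtype.ext
      rcases e with e | ⟨m, h1, h2⟩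
      · exact D.rep_inj _ _ _ e
      · obtain ⟨n1, e1⟩ := orb h1
        obtain ⟨n2, e2⟩ := orb h2
        rw [← mul_smul, ← mul_smul] at e1
        rw [← mul_smul] at e2
        rw [D.rep_inj _ _ _ (e1.resolve_right fun e => k.2 (D.rep_inj _ _ _ e)),
          D.rep_inj _ _ _ (e2.resolve_right fun e => l.2 (D.rep_inj _ _ _ e))]
    · rintro ⟨k, hkj⟩
      by_cases hk : k = i
      · subst hk
        rw [if_pos rfl, h.stabilizer_proj_left]
        refine (D.gen k).sup ?_
        rw [← hg]
        exact (D.gen j).stabilizer_smul g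
      · rw [if_neg hk, h.stabilizer_proj_of_forall]
        · exact D.gen k
        · refine fun n => ⟨fun e => hk (D.rep_inj _ _ _ e), fun e => hkj ?_⟩
          refine D.rep_inj _ _ (g⁻¹ * n) ?_
          rw [mul_smul, e, ← hg, inv_smul_smul]
    · have hsum : ∑ k : {k // k ≠ j}, ((if (k : D.I) = i then D.d i + D.d j else D.d k : ℕ) : ℤ)
          = ∑ k, (D.d k : ℤ) := by
        rw [Fintype.sum_subtype_ne j (fun k => ((if k = i then D.d i + D.d j else D.d k : ℕ) : ℤ)),
          if_neg (Ne.symm hij), sub_eq_iff_eq_add]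
        have : ∀ k, ((if k = i then D.d i + D.d j else D.d k : ℕ) : ℤ)
            = D.d k + if k = i then (D.d j : ℤ) else 0 := by
          intro k
          split_ifs with hk
          · subst hk; push_cast; rfl
          · simp
        simp only [this, Finset.sum_add_distrib, Finset.sum_ite_eq', Finset.mem_univ, if_true]
      change ∑ k : {k // k ≠ j}, ((if (k : D.I) = i then D.d i + D.d j else D.d k : ℕ) : ℤ)
        - (Fintype.card {k // k ≠ j} : ℤ) ≤ ∑ k, (D.d k : ℤ) - Fintype.card D.I + 1
      rw [hsum, Fintype.card_subtype_ne_int]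
      linarith

theorem exists_identify (D : VertexData N T) (x y : D.V) (hf : D.f x = D.f y) :
    ∃ (D' : VertexData N T) (π : D.V → D'.V), (∀ (n : N) x, π (n • x) = n • π x) ∧
      Function.Surjective π ∧ (∀ x, D'.f (π x) = D.f x) ∧ π x = π y ∧
      D'.cost ≤ D.cost + 1 := by
  obtain ⟨i, n, rfl⟩ := D.exists_rep x
  obtain ⟨D', π, h1, h2, h3, h4, h5⟩ := D.exists_identify_rep i (n⁻¹ • y) (by
    rw [D.f_smul, ← hf, D.f_smul, inv_smul_smul])
  refine ⟨D', π, h1, h2, h3, ?_, h5⟩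
  rw [h1, h4, ← h1, smul_inv_smul]

end VertexData

/-- A connected `N`-graph over the `N`-set `T`: the edges are the `N`-translates of finitely many
edges `J`, on which `N` acts freely, and `e j true`, `e j false` are the endpoints of `j`. -/
structure OrbitGraph (N : Type u) [Group N] (T : Type v) [MulAction N T] extends
    VertexData N T where
  nonempty : Nonempty V
  J : Type
  [fintypeJ : Fintype J]
  e : J → Bool → V
  conn : ∀ U : Set V, U.Nonempty →
    (∀ (n : N) j, n • e j true ∈ U ↔ n • e j false ∈ U) → ∀ x, x ∈ U

/-- The weight of an edge whose endpoints have images at distance `ℓ`. -/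
def edgeWeight (l : ℕ) : ℕ := max 1 (2 * l - 1)

namespace OrbitGraph

attribute [instance] OrbitGraph.fintypeJ

variable {N : Type u} [Group N] {T : Type v} [MulAction N T]

/-- The number of orbits of edges, minus the number of orbits of vertices, plus the number of
generators of the vertex stabilizers. -/
def cost (X : OrbitGraph N T) : ℤ := X.toVertexData.cost + Fintype.card X.J

/-- The total weight of the edge orbits. -/
def weight (X : OrbitGraph N T) (δ : T → T → ℕ) : ℕ :=
  ∑ j, edgeWeight (δ (X.f (X.e j true)) (X.f (X.e j false)))

/-- No graph of at most the same cost has smaller weight. -/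
def IsMinimal (X : OrbitGraph N T) (δ : T → T → ℕ) : Prop :=
  ∀ X' : OrbitGraph N T, X'.cost ≤ X.cost → X.weight δ ≤ X'.weight δ

theorem exists_isMinimal (X₀ : OrbitGraph N T) (δ : T → T → ℕ) :
    ∃ X : OrbitGraph N T, X.cost ≤ X₀.cost ∧ X.IsMinimal δ := by
  have hne : {w | ∃ X : OrbitGraph N T, X.cost ≤ X₀.cost ∧ X.weight δ = w}.Nonempty :=
    ⟨_, X₀, le_rfl, rfl⟩
  obtain ⟨X, hX, hw⟩ := Nat.sInf_mem hne
  refine ⟨X, hX, fun X' hX' => ?_⟩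
  rw [hw]
  exact Nat.sInf_le ⟨X', hX'.trans hX, rfl⟩

theorem exists_identify_delete (X : OrbitGraph N T) (δ : T → T → ℕ) (x y : X.V)
    (hf : X.f x = X.f y) (j₀ : X.J)
    (h : ∀ {W : Type u} [MulAction N W] (π : X.V → W), (∀ (n : N) x, π (n • x) = n • π x) →
      π x = π y → ∀ U : Set W,
      (∀ (n : N) j, j ≠ j₀ → (n • π (X.e j true) ∈ U ↔ n • π (X.e j false) ∈ U)) →
      ∀ n : N, n • π (X.e j₀ true) ∈ U ↔ n • π (X.e j₀ false) ∈ U) :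
    ∃ X' : OrbitGraph N T, X'.cost ≤ X.cost ∧ X'.weight δ < X.weight δ := by
  classical
  obtain ⟨D, π, hπ, hs, hfπ, hxy, hc⟩ := X.toVertexData.exists_identify x y hf
  refine ⟨
    { D with
      nonempty := X.nonempty.map π
      J := {j // j ≠ j₀}
      e := fun j b => π (X.e j b)
      conn := ?_ }, ?_, ?_⟩
  · intro U hU hcl z
    obtain ⟨z, rfl⟩ := hs z
    refine X.conn (π ⁻¹' U) (hU.preimage hs) (fun n j => ?_) z
    rw [Set.mem_preimage, Set.mem_preimage, hπ, hπ]
    by_cases hj : j = j₀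
    · subst hj
      exact h π hπ hxy U (fun n k hk => hcl n ⟨k, hk⟩) n
    · exact hcl n ⟨j, hj⟩
  · change D.cost + (Fintype.card {j // j ≠ j₀} : ℤ) ≤ X.toVertexData.cost + Fintype.card X.J
    rw [Fintype.card_subtype_ne_int]
    linarith
  · change ∑ j : {j // j ≠ j₀}, edgeWeight (δ (D.f (π (X.e j true))) (D.f (π (X.e j false))))
      < _
    simp only [hfπ]
    have := Fintype.sum_subtype_ne (M := ℤ) j₀
      (fun j => (edgeWeight (δ (X.f (X.e j true)) (X.f (X.e j false))) : ℤ))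
    have hpos : 1 ≤ edgeWeight (δ (X.f (X.e j₀ true)) (X.f (X.e j₀ false))) := le_max_left _ _
    unfold weight
    zify at hpos ⊢
    rw [this]
    linarith

theorem exists_contract (X : OrbitGraph N T) (δ : T → T → ℕ) (j : X.J)
    (hf : X.f (X.e j true) = X.f (X.e j false)) :
    ∃ X' : OrbitGraph N T, X'.cost ≤ X.cost ∧ X'.weight δ < X.weight δ :=
  X.exists_identify_delete δ _ _ hf j fun π _ hxy U _ n => by rw [hxy]

theorem exists_fold (X : OrbitGraph N T) (δ : T → T → ℕ) {n₁ n₂ : N} {j₁ j₂ : X.J}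
    {b₁ b₂ : Bool} (hj : j₁ ≠ j₂) (hsrc : n₁ • X.e j₁ b₁ = n₂ • X.e j₂ b₂)
    (htgt : X.f (n₁ • X.e j₁ !b₁) = X.f (n₂ • X.e j₂ !b₂)) :
    ∃ X' : OrbitGraph N T, X'.cost ≤ X.cost ∧ X'.weight δ < X.weight δ := by
  refine X.exists_identify_delete δ _ _ htgt j₂ fun π hπ hxy U hU n => ?_
  have key : n • π (X.e j₂ b₂) ∈ U ↔ n • π (X.e j₂ !b₂) ∈ U := by
    have h1 : n • π (X.e j₂ b₂) = (n * n₂⁻¹ * n₁) • π (X.e j₁ b₁) := by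
      rw [← hπ, ← hπ, mul_smul, hsrc, ← mul_smul, inv_mul_cancel_right]
    have h2 : n • π (X.e j₂ !b₂) = (n * n₂⁻¹ * n₁) • π (X.e j₁ !b₁) := by
      rw [mul_smul, ← hπ n₁, hxy, hπ, ← mul_smul, inv_mul_cancel_right]
    rw [h1, h2]
    cases b₁
    · exact (hU _ _ hj).symm
    · exact hU _ _ hj
  cases b₂
  · exact key.symm
  · exact key

theorem exists_subdivide (X : OrbitGraph N T) (δ : T → T → ℕ) (j₀ : X.J) (z : T)
    (h1 : δ z (X.f (X.e j₀ false)) = 1)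
    (h2 : δ (X.f (X.e j₀ true)) z + 1 = δ (X.f (X.e j₀ true)) (X.f (X.e j₀ false)))
    (h3 : δ (X.f (X.e j₀ true)) z ≠ 0) :
    ∃ X' : OrbitGraph N T, X'.cost ≤ X.cost ∧ X'.weight δ < X.weight δ := by
  classical
  let D : VertexData N T :=
    { V := X.V ⊕ N
      f := Sum.elim X.f (fun n => n • z)
      f_smul := by
        rintro n (x | m)
        · exact X.f_smul n x
        · exact mul_smul n m z
      I := Option X.I
      r := fun i => i.elim (Sum.inr 1) (fun i => Sum.inl (X.r i))
      exists_rep := by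
        rintro (x | m)
        · obtain ⟨i, n, rfl⟩ := X.exists_rep x
          exact ⟨some i, n, rfl⟩
        · exact ⟨none, m, congrArg Sum.inr (mul_one m)⟩
      rep_inj := by
        rintro (_ | i) (_ | j) n h
        · rfl
        · exact (Sum.inr_ne_inl h).elim
        · exact (Sum.inl_ne_inr h).elim
        · exact congrArg some (X.rep_inj i j n (Sum.inl_injective h))
      d := fun i => i.elim 0 X.d
      gen := by
        rintro (_ | i)
        · convert! Subgroup.GeneratedBy.bot N
          rw [eq_bot_iff]
          intro n hn
          have : n * 1 = 1 := Sum.inr_injective hn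
          simpa using this
        · convert! X.gen i using 1
          ext n
          exact Sum.inl_injective.eq_iff }
  let e : Option X.J → Bool → X.V ⊕ N := fun j => j.elim
    (fun b => if b then Sum.inr 1 else Sum.inl (X.e j₀ false))
    (fun j b => if j = j₀ then (if b then Sum.inl (X.e j₀ true) else Sum.inr 1)
      else Sum.inl (X.e j b))
  refine ⟨
    { D with
      nonempty := X.nonempty.map Sum.inl
      J := Option X.J
      e := e
      conn := ?_ }, ?_, ?_⟩
  · intro (U : Set (X.V ⊕ N)) hU hcl
    have hr : ∀ n : N, Sum.inr n ∈ U ↔ Sum.inl (n • X.e j₀ false) ∈ U := fun n => by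
      have : (Sum.inr (n * 1) : X.V ⊕ N) ∈ U ↔ _ := hcl n none
      rwa [mul_one] at this
    have hl : ∀ n : N, Sum.inl (n • X.e j₀ true) ∈ U ↔ Sum.inr n ∈ U := fun n => by
      have := hcl n (some j₀)
      simp only [e, Option.elim, if_true] at this
      have : Sum.inl (n • X.e j₀ true) ∈ U ↔ (Sum.inr (n * 1) : X.V ⊕ N) ∈ U := this
      rwa [mul_one] at this
    have hall : ∀ x, Sum.inl x ∈ U := by
      refine X.conn (Sum.inl ⁻¹' U) ?_ fun n j => ?_
      · obtain ⟨x | n, hx⟩ := hU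
        · exact ⟨x, hx⟩
        · exact ⟨_, (hr n).1 hx⟩
      · by_cases hj : j = j₀
        · subst hj
          exact (hl n).trans (hr n)
        · have := hcl n (some j)
          simp only [e, Option.elim, if_neg hj] at this
          exact this
    rintro (x | n)
    · exact hall x
    · exact (hr n).2 (hall _)
  · change (∑ i : Option X.I, ((i.elim 0 X.d : ℕ) : ℤ)) - (Fintype.card (Option X.I) : ℤ)
      + (Fintype.card (Option X.J) : ℤ) ≤ ∑ i, (X.d i : ℤ) - Fintype.card X.I + Fintype.card X.J
    simp only [Fintype.sum_option, Fintype.card_option, Option.elim]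
    push_cast
    linarith
  · change ∑ j : Option X.J, edgeWeight (δ (D.f (e j true)) (D.f (e j false))) < _
    have hlt : edgeWeight 1 + edgeWeight (δ (X.f (X.e j₀ true)) z) <
        edgeWeight (δ (X.f (X.e j₀ true)) (X.f (X.e j₀ false))) := by
      rw [← h2]
      unfold edgeWeight
      omega
    rw [Fintype.sum_option, weight, ← Finset.add_sum_erase _ _ (Finset.mem_univ j₀),
      ← Finset.add_sum_erase (a := j₀) Finset.univ
        (fun j => edgeWeight (δ (X.f (X.e j true)) (X.f (X.e j false)))) (Finset.mem_univ j₀),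
      ← add_assoc]
    have hrest : ∀ j ∈ Finset.univ.erase j₀,
        edgeWeight (δ (D.f (e (some j) true)) (D.f (e (some j) false))) =
        edgeWeight (δ (X.f (X.e j true)) (X.f (X.e j false))) := by
      intro j hj
      simp [e, D, Finset.ne_of_mem_erase hj]
    rw [Finset.sum_congr rfl hrest]
    refine Nat.add_lt_add_right ?_ _
    simpa [e, D, h1] using hlt

theorem exists_of_leaf (X : OrbitGraph N T) {δ : T → T → ℕ} (hδ : ∀ x, δ x x = 0) (j₀ : X.J)
    (b₀ : Bool) (h : ∀ (n : N) j b, n • X.e j b = X.e j₀ b₀ → n = 1 ∧ j = j₀ ∧ b = b₀) :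
    ∃ X' : OrbitGraph N T, X'.cost ≤ X.cost ∧ X'.weight δ < X.weight δ := by
  classical
  let f' : X.V → T := fun x =>
    if hx : ∃ n : N, n • X.e j₀ b₀ = x then hx.choose • X.f (X.e j₀ !b₀) else X.f x
  have hf' : ∀ n : N, f' (n • X.e j₀ b₀) = n • X.f (X.e j₀ !b₀) := fun n => by
    have hx : ∃ m : N, m • X.e j₀ b₀ = n • X.e j₀ b₀ := ⟨n, rfl⟩
    have : f' (n • X.e j₀ b₀) = hx.choose • X.f (X.e j₀ !b₀) := dif_pos hx
    rw [this]
    have h1 := (h (n⁻¹ * hx.choose) j₀ b₀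
      (by rw [mul_smul, hx.choose_spec, inv_smul_smul])).1
    rw [inv_mul_eq_one] at h1
    rw [← h1]
  have hf'' : ∀ x, (∀ n : N, n • X.e j₀ b₀ ≠ x) → f' x = X.f x := fun x hx =>
    dif_neg (by simpa using hx)
  let X₁ : OrbitGraph N T :=
    { X with
      f := f'
      f_smul := by
        intro n x
        by_cases hx : ∃ m : N, m • X.e j₀ b₀ = x
        · obtain ⟨m, rfl⟩ := hx
          rw [← mul_smul, hf', hf', mul_smul]
        · push Not at hx
          rw [hf'' x hx, hf'' _ fun m hm => hx (n⁻¹ * m) (by rw [mul_smul, hm, inv_smul_smul]),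
            X.f_smul] }
  have hne : ∀ j b, (j ≠ j₀ ∨ b ≠ b₀) → f' (X.e j b) = X.f (X.e j b) := fun j b hjb =>
    hf'' _ fun n hn => by
      have := h n⁻¹ j b (by rw [← hn, inv_smul_smul])
      tauto
  have hend : f' (X.e j₀ b₀) = f' (X.e j₀ !b₀) := by
    have := hf' 1
    rw [one_smul, one_smul] at this
    rw [this, hne _ _ (Or.inr (by simp))]
  have hend' : f' (X.e j₀ true) = f' (X.e j₀ false) := by
    cases b₀
    · exact hend.symm
    · exact hend
  obtain ⟨X', hc, hw⟩ := X₁.exists_contract δ j₀ hend'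
  refine ⟨X', hc, hw.trans_le (Finset.sum_le_sum fun j _ => ?_)⟩
  change edgeWeight (δ (f' (X.e j true)) (f' (X.e j false))) ≤ _
  by_cases hj : j = j₀
  · rw [hj, hend', hδ]
    exact max_le (le_max_left _ _) (by omega)
  · rw [hne _ _ (Or.inl hj), hne _ _ (Or.inl hj)]

end OrbitGraph

/-- The action of `N` on the tree with path metric `δ` is free on edges, without inversions and
without global fixed vertices. -/
structure IsTreeAction (N : Type*) [Group N] {T : Type*} [MulAction N T] (δ : T → T → ℕ) : Prop
    extends IsTreeMetric δ where
  smul : ∀ (n : N) (x y : T), δ (n • x) (n • y) = δ x y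
  free : ∀ (n : N) {x y : T}, δ x y = 1 → n • x = x → n • y = y → n = 1
  not_inversion : ∀ (n : N) {x y : T}, δ x y = 1 → n • x = y → n • y ≠ x
  not_fixed : ∀ x : T, ∃ n : N, n • x ≠ x

theorem IsTreeMetric.self {T : Type*} {δ : T → T → ℕ} (hδ : IsTreeMetric δ) (x : T) :
    δ x x = 0 := (hδ.eq_zero_iff x x).2 rfl

namespace OrbitGraph

variable {N : Type u} [Group N] {T : Type v} [MulAction N T] {X : OrbitGraph N T}

/-- Adjacency of vertices. -/
def Adj (X : OrbitGraph N T) (x y : X.V) : Prop :=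
  ∃ (n : N) (j : X.J) (b : Bool), n • X.e j b = x ∧ n • X.e j (!b) = y

theorem Adj.symm {x y : X.V} (h : X.Adj x y) : X.Adj y x := by
  obtain ⟨n, j, b, hx, hy⟩ := h
  exact ⟨n, j, !b, hy, by rwa [Bool.not_not]⟩

theorem mem_of_closed {U : Set X.V} (hU : U.Nonempty)
    (hcl : ∀ x y, X.Adj x y → x ∈ U → y ∈ U) (x : X.V) : x ∈ U :=
  X.conn U hU (fun n j => ⟨hcl _ _ ⟨n, j, true, rfl, rfl⟩, hcl _ _ ⟨n, j, false, rfl, rfl⟩⟩) x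

variable {δ : T → T → ℕ}

theorem IsMinimal.not_exists (hX : X.IsMinimal δ) :
    ¬∃ X' : OrbitGraph N T, X'.cost ≤ X.cost ∧ X'.weight δ < X.weight δ := by
  rintro ⟨X', hc, hw⟩
  exact (hX X' hc).not_gt hw

namespace IsMinimal

theorem length_eq_one (hX : X.IsMinimal δ) (hδ : IsTreeAction N δ) (j : X.J) :
    δ (X.f (X.e j true)) (X.f (X.e j false)) = 1 := by
  by_cases hf : X.f (X.e j true) = X.f (X.e j false)
  · exact (hX.not_exists (X.exists_contract δ j hf)).elim
  obtain ⟨z, hz, hz'⟩ := hδ.exists_parent hf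
  by_cases h3 : δ (X.f (X.e j true)) z = 0
  · omega
  · exact (hX.not_exists (X.exists_subdivide δ j z (by rwa [hδ.comm]) hz' h3)).elim

theorem dist_of_adj (hX : X.IsMinimal δ) (hδ : IsTreeAction N δ) {x y : X.V} (h : X.Adj x y) :
    δ (X.f x) (X.f y) = 1 := by
  obtain ⟨n, j, b, rfl, rfl⟩ := h
  rw [X.f_smul, X.f_smul, hδ.smul]
  cases b
  · rw [hδ.comm]; exact hX.length_eq_one hδ j
  · exact hX.length_eq_one hδ j

theorem dart_unique (hX : X.IsMinimal δ) (hδ : IsTreeAction N δ) {n₁ n₂ : N} {j₁ j₂ : X.J}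
    {b₁ b₂ : Bool} (hsrc : n₁ • X.e j₁ b₁ = n₂ • X.e j₂ b₂)
    (htgt : X.f (n₁ • X.e j₁ !b₁) = X.f (n₂ • X.e j₂ !b₂)) : n₁ = n₂ ∧ j₁ = j₂ ∧ b₁ = b₂ := by
  by_cases hj : j₁ = j₂
  swap
  · exact (hX.not_exists (X.exists_fold δ hj hsrc htgt)).elim
  subst hj
  have hd : δ (X.f (X.e j₁ b₁)) (X.f (X.e j₁ !b₁)) = 1 :=
    hX.dist_of_adj hδ ⟨1, j₁, b₁, one_smul _ _, one_smul _ _⟩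
  have hsrc' := congrArg X.f hsrc
  rw [X.f_smul, X.f_smul, ← inv_smul_eq_iff, ← mul_smul] at hsrc' htgt
  by_cases hb : b₁ = b₂
  · subst hb
    exact ⟨(inv_mul_eq_one.1 (hδ.free _ hd hsrc' htgt)).symm, rfl, rfl⟩
  · obtain rfl : b₂ = !b₁ := by cases b₁ <;> cases b₂ <;> simp_all
    rw [Bool.not_not] at htgt
    exact (hδ.not_inversion _ hd hsrc' htgt).elim

theorem eq_of_adj (hX : X.IsMinimal δ) (hδ : IsTreeAction N δ) {x y y' : X.V} (h : X.Adj x y)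
    (h' : X.Adj x y') (hf : X.f y = X.f y') : y = y' := by
  obtain ⟨n, j, b, rfl, rfl⟩ := h
  obtain ⟨n', j', b', hx, rfl⟩ := h'
  obtain ⟨rfl, rfl, rfl⟩ := hX.dart_unique hδ hx.symm hf
  rfl

end IsMinimal

/-- The vertices that can be reached from `x` along edges whose images lead away from that
of `x`. -/
inductive Descends (X : OrbitGraph N T) (δ : T → T → ℕ) (x : X.V) : X.V → Prop
  | refl : Descends X δ x x
  | tail {y z : X.V} : Descends X δ x y → X.Adj y z →
      δ (X.f x) (X.f z) = δ (X.f x) (X.f y) + 1 → Descends X δ x z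

namespace IsMinimal

theorem f_injective (hX : X.IsMinimal δ) (hδ : IsTreeAction N δ) : Function.Injective X.f := by
  intro x y hxy
  have key : ∀ z, z ∈ {z | X.Descends δ x z} := by
    refine mem_of_closed ⟨x, .refl⟩ fun z z' hzz' hz => ?_
    rcases hδ.step (X.f x) (hX.dist_of_adj hδ hzz') with h | h
    · exact .tail hz hzz' h
    · cases hz with
      | refl =>
        rw [hδ.self] at h
        omega
      | @tail w _ hw hwz hd =>
        have hf := hδ.parent_unique (hX.dist_of_adj hδ hwz.symm) (hX.dist_of_adj hδ hzz')
          hd.symm h.symm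
        rwa [Set.mem_ofPred_eq, ← hX.eq_of_adj hδ hwz.symm hzz' hf]
  cases key y with
  | refl => rfl
  | tail _ _ hd =>
    rw [hxy, hδ.self] at hd
    omega

theorem exists_two_adj (hX : X.IsMinimal δ) (hδ : IsTreeAction N δ) (x : X.V) :
    ∃ y y', X.Adj x y ∧ X.Adj x y' ∧ X.f y ≠ X.f y' := by
  by_contra! hall
  by_cases hne : ∃ y, X.Adj x y
  · obtain ⟨y, hy⟩ := hne
    obtain ⟨n, j, b, hx, rfl⟩ := id hy
    refine hX.not_exists (X.exists_of_leaf hδ.self j b fun n' j' b' h => ?_)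
    have h1 : (n * n') • X.e j' b' = n • X.e j b := by rw [mul_smul, h]
    obtain ⟨h2, h3⟩ := hX.dart_unique hδ h1
      (hall _ _ ⟨n * n', j', b', h1.trans hx, rfl⟩ hy)
    exact ⟨mul_eq_left.1 h2, h3⟩
  · push Not at hne
    obtain ⟨n, hn⟩ := hδ.not_fixed (X.f x)
    refine hn ?_
    rw [← X.f_smul]
    exact congrArg X.f (mem_of_closed (U := {x}) ⟨x, rfl⟩
      (fun y z hyz hy => (hne z (by rwa [← Set.mem_singleton_iff.1 hy])).elim) (n • x))

theorem exists_adj_of_dist (hX : X.IsMinimal δ) (hδ : IsTreeAction N δ)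
    (hs : Function.Surjective X.f) {v w : T} (hvw : δ v w = 1) :
    ∃ x y, X.Adj x y ∧ X.f x = v ∧ X.f y = w := by
  obtain ⟨x, rfl⟩ := hs v
  obtain ⟨y, rfl⟩ := hs w
  by_contra! hno
  have key := mem_of_closed (U := {z | δ (X.f z) (X.f x) + 1 = δ (X.f z) (X.f y)})
    ⟨x, by rw [Set.mem_ofPred_eq, hδ.self, hvw]⟩ (fun z z' hzz' hz => by
      have hd := hX.dist_of_adj hδ hzz'
      refine hδ.parent_of_adj hd (by rwa [hδ.comm]) hz fun he => ?_
      rw [Set.mem_ofPred_eq, he, hd] at hz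
      exact hno z z' hzz' ((hδ.eq_zero_iff _ _).1 (by omega)) he.symm) y
  rw [Set.mem_ofPred_eq, hδ.self] at key
  omega

end IsMinimal

section Normal

variable {G : Type u} [Group G] {N : Subgroup G} [hN : N.Normal] [MulAction G T]
  {X : OrbitGraph N T}

theorem IsMinimal.exists_smul_eq (hX : X.IsMinimal δ) (hδ : IsTreeAction N δ)
    (hG : ∀ (g : G) x y, δ (g • x) (g • y) = δ x y) (g : G) (w : X.V) :
    ∃ z, g • X.f z = X.f w := by
  by_contra! hw
  have := X.nonempty
  let c : X.V → ℕ := fun x => ⨅ z, δ (g • X.f z) (X.f x)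
  have hc : ∀ x, ∃ z, δ (g • X.f z) (X.f x) = c x := fun x =>
    Nat.sInf_mem (Set.range_nonempty fun z => δ (g • X.f z) (X.f x))
  have hle : ∀ x z, c x ≤ δ (g • X.f z) (X.f x) := fun x z => Nat.sInf_le ⟨z, rfl⟩
  have hinv : ∀ (n : N) x, c (n • x) ≤ c x := fun n x => by
    obtain ⟨z, hz⟩ := hc x
    have hmem : g⁻¹ * n * g ∈ N := by simpa using hN.conj_mem n n.2 g⁻¹
    refine (hle _ ((⟨_, hmem⟩ : N) • z)).trans (le_of_eq ?_)
    rw [← hz, X.f_smul, X.f_smul, ← hG n (g • X.f z)]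
    congr 1
    change g • (g⁻¹ * n * g) • X.f z = (n : G) • g • X.f z
    simp [← mul_smul, mul_assoc]
  have : Nonempty X.I := ⟨(X.exists_rep w).choose⟩
  obtain ⟨i, hi⟩ := Finite.exists_max fun i => c (X.r i)
  have hmax : ∀ x, c x ≤ c (X.r i) := fun x => by
    obtain ⟨j, n, rfl⟩ := X.exists_rep x
    exact (hinv _ _).trans (hi j)
  have hnot : ∀ z, X.f (X.r i) ≠ g • X.f z := fun z hz => by
    have h1 := hle (X.r i) z
    rw [hz, hδ.self] at h1
    obtain ⟨z', hz'⟩ := hc w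
    have h2 := hmax w
    exact hw z' ((hδ.eq_zero_iff _ _).1 (by omega))
  obtain ⟨y₁, y₂, h₁, h₂, hne⟩ := hX.exists_two_adj hδ (X.r i)
  have hpar : ∀ y, X.Adj (X.r i) y →
      ∀ z, z ∈ {z | δ (g • X.f z) (X.f y) + 1 = δ (g • X.f z) (X.f (X.r i))} := fun y hy => by
    obtain ⟨z, hz⟩ := hc y
    refine mem_of_closed ⟨z, ?_⟩ fun z z' hzz' hz => ?_
    · have h3 := hmax y
      have h4 := hle (X.r i) z
      rcases hδ.step (g • X.f z) (hX.dist_of_adj hδ hy) with h | h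
      · omega
      · exact h.symm
    · exact hδ.parent_of_adj (by rw [hG]; exact hX.dist_of_adj hδ hzz') (hX.dist_of_adj hδ hy) hz
        (hnot z')
  exact hne (hδ.parent_unique (hX.dist_of_adj hδ h₁) (hX.dist_of_adj hδ h₂) (hpar _ h₁ w)
    (hpar _ h₂ w))

theorem IsMinimal.f_bijective [IsPretransitive G T] (hX : X.IsMinimal δ) (hδ : IsTreeAction N δ)
    (hG : ∀ (g : G) x y, δ (g • x) (g • y) = δ x y) : Function.Bijective X.f := by
  refine ⟨hX.f_injective hδ, fun t => ?_⟩
  obtain ⟨x⟩ := X.nonempty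
  obtain ⟨g, hg⟩ := MulAction.exists_smul_eq G t (X.f x)
  obtain ⟨z, hz⟩ := hX.exists_smul_eq hδ hG g x
  exact ⟨z, smul_left_cancel g (hz.trans hg.symm)⟩

end Normal

theorem minRank_le_cost (X : OrbitGraph N T) : (minRank N : ℤ) ≤ X.cost + 1 := by
  let _ : MulAction N Unit :=
    { smul := fun _ x => x, one_smul := fun _ => rfl, mul_smul := fun _ _ _ => rfl }
  let X₀ : OrbitGraph N Unit := { X with f := fun _ => ⟨⟩, f_smul := fun _ _ => rfl }
  obtain ⟨Y, hc, hY⟩ := X₀.exists_isMinimal fun _ _ => 0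
  change Y.cost ≤ X.cost at hc
  have : IsEmpty Y.J := ⟨fun j => hY.not_exists (Y.exists_contract _ j rfl)⟩
  have hsub : Subsingleton Y.V :=
    ⟨fun x y => (Y.conn {x} ⟨x, rfl⟩ (fun _ j => isEmptyElim j) y).symm⟩
  obtain ⟨x⟩ := Y.nonempty
  obtain ⟨i, -⟩ := Y.exists_rep x
  let _ : Unique Y.I := { default := i, uniq := fun j => Y.rep_inj j i 1 (Subsingleton.elim _ _) }
  have hg : (⊤ : Subgroup N).GeneratedBy (Y.d i) := by
    convert! Y.gen i
    exact (eq_top_iff.2 fun n _ => Subsingleton.elim _ _).symm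
  have h1 := hg.minRank_le
  have h2 : Y.cost = Y.d i - 1 := by
    unfold cost VertexData.cost
    rw [Fintype.sum_unique, Fintype.card_unique, Fintype.card_eq_zero]
    simp
    rfl
  omega

theorem exists_cost_le {S : Finset N} (hS : Subgroup.closure (S : Set N) = ⊤) (v : T) :
    ∃ X : OrbitGraph N T, X.cost ≤ S.card - 1 := by
  let s : Fin S.card → N := fun j => S.equivFin.symm j
  refine ⟨
    { V := N
      f := fun n => n • v
      f_smul := fun n m => mul_smul n m v
      I := Unit
      r := fun _ => 1
      exists_rep := fun n => ⟨(), n, mul_one n⟩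
      rep_inj := fun _ _ _ _ => rfl
      d := fun _ => 0
      gen := fun _ => by
        convert! Subgroup.GeneratedBy.bot N
        rw [eq_bot_iff]
        intro n hn
        have : n * 1 = 1 := hn
        simpa using this
      nonempty := ⟨1⟩
      J := Fin S.card
      e := fun j b => if b then 1 else s j
      conn := ?_ }, ?_⟩
  · intro U ⟨u, hu⟩ hcl x
    have h1 : ∀ (m : N) (j : Fin S.card), m ∈ U ↔ m * s j ∈ U := fun m j => by
      simpa using hcl m j
    have h2 : ∀ y ∈ Subgroup.closure (S : Set N), ∀ m, m ∈ U ↔ m * y ∈ U := by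
      intro y hy
      induction hy using Subgroup.closure_induction with
      | mem y hy => exact fun m => by simpa [s] using h1 m (S.equivFin ⟨y, hy⟩)
      | one => simp
      | mul y z _ _ hy hz => exact fun m => by rw [hy, hz, mul_assoc]
      | inv y _ hy => exact fun m => by rw [hy (m * y⁻¹), inv_mul_cancel_right]
    have := (h2 (u⁻¹ * x) (by rw [hS]; trivial) u).1 hu
    rwa [mul_inv_cancel_left] at this
  · simp [cost, VertexData.cost]

end OrbitGraph

namespace HNNExtension

open NormalWord

variable {A : Type u} [Group A] {C D : Subgroup A} {φ : C ≃* D}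

theorem NormalWord.length_unitsSMul_of_cancels {d : TransversalPair A C D} {k : ℤˣ}
    {w : NormalWord d} (h : Cancels k w) :
    (unitsSMul φ k w).toList.length + 1 = w.toList.length := by
  rw [unitsSMul, dif_pos h]
  cases w using consRecOn with
  | ofGroup => simp [Cancels] at h
  | cons => simp [unitsSMulWithCancel]

theorem NormalWord.length_unitsSMul_of_not_cancels {d : TransversalPair A C D} {k : ℤˣ}
    {w : NormalWord d} (h : ¬Cancels k w) :
    (unitsSMul φ k w).toList.length = w.toList.length + 1 := by
  rw [unitsSMul, dif_neg h]
  simp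

/-- The normal form of an element. -/
noncomputable def toWord (g : HNNExtension A C D φ) :
    NormalWord (Classical.arbitrary (TransversalPair A C D)) := g • empty

/-- The number of occurrences of the stable letter and its inverse in a reduced word. -/
noncomputable def tLength (g : HNNExtension A C D φ) : ℕ := g.toWord.toList.length

theorem toWord_of_mul (a : A) (g : HNNExtension A C D φ) : (of a * g).toWord = a • g.toWord := by
  rw [toWord, mul_smul, of_smul_eq_smul, toWord]

theorem toWord_zpow_mul (k : ℤˣ) (g : HNNExtension A C D φ) :
    (t ^ (k : ℤ) * g).toWord = unitsSMul φ k g.toWord := by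
  rw [toWord, mul_smul, t_pow_smul_eq_unitsSMul, toWord]

@[simp]
theorem tLength_of_mul (a : A) (g : HNNExtension A C D φ) : (of a * g).tLength = g.tLength := by
  rw [tLength, toWord_of_mul, group_smul_toList, tLength]

theorem tLength_zpow_mul (k : ℤˣ) (g : HNNExtension A C D φ) :
    (t ^ (k : ℤ) * g).tLength = g.tLength + 1 ∨ g.tLength = (t ^ (k : ℤ) * g).tLength + 1 := by
  rw [tLength, toWord_zpow_mul, tLength]
  by_cases h : Cancels k g.toWord
  · exact Or.inr (length_unitsSMul_of_cancels h).symm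
  · exact Or.inl (length_unitsSMul_of_not_cancels h)

theorem cancels_of_tLength {k : ℤˣ} {g : HNNExtension A C D φ}
    (h : (t ^ (k : ℤ) * g).tLength + 1 = g.tLength) : Cancels k g.toWord := by
  by_contra hc
  have := length_unitsSMul_of_not_cancels (φ := φ) hc
  rw [tLength, toWord_zpow_mul, tLength] at h
  omega

theorem tLength_one : (1 : HNNExtension A C D φ).tLength = 0 := by
  simp [tLength, toWord]

theorem tLength_eq_zero_iff {g : HNNExtension A C D φ} :
    g.tLength = 0 ↔ g ∈ (of : A →* HNNExtension A C D φ).range := by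
  constructor
  · intro h
    refine ⟨g.toWord.head, ?_⟩
    have h1 : g.toWord.prod φ = g := by simp [toWord]
    have h2 : g.toWord.toList = [] := List.length_eq_zero_iff.1 h
    rw [ReducedWord.prod, h2] at h1
    simpa using h1
  · rintro ⟨a, rfl⟩
    rw [← mul_one (of a), tLength_of_mul, tLength_one]

theorem exists_tLength_lt {g : HNNExtension A C D φ} (hg : g.tLength ≠ 0) :
    ∃ (a : A) (k : ℤˣ), (t ^ (k : ℤ) * (of a * g)).tLength + 1 = g.tLength := by
  have hne : g.toWord.toList ≠ [] := fun h => hg (List.length_eq_zero_iff.2 h)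
  obtain ⟨⟨k, b⟩, l, hl⟩ := List.exists_cons_of_ne_nil hne
  refine ⟨g.toWord.head⁻¹, -k, ?_⟩
  have hc : Cancels (-k) (of g.toWord.head⁻¹ * g).toWord := by
    rw [toWord_of_mul]
    simp [Cancels, hl]
  have := length_unitsSMul_of_cancels (φ := φ) hc
  rwa [← toWord_zpow_mul, ← tLength, ← tLength, tLength_of_mul] at this

theorem eq_and_mem_of_tLength {g : HNNExtension A C D φ} {a b : A} {k l : ℤˣ}
    (ha : (t ^ (k : ℤ) * (of a * g)).tLength + 1 = g.tLength)
    (hb : (t ^ (l : ℤ) * (of b * g)).tLength + 1 = g.tLength) :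
    k = l ∧ a * b⁻¹ ∈ toSubgroup C D k := by
  rw [← tLength_of_mul a g] at ha
  rw [← tLength_of_mul b g] at hb
  have h1 := cancels_of_tLength ha
  have h2 := cancels_of_tLength hb
  rw [toWord_of_mul] at h1 h2
  obtain ⟨h1, h1'⟩ := h1
  obtain ⟨h2, h2'⟩ := h2
  rw [group_smul_toList] at h1' h2'
  obtain rfl : k = l := by simpa [h1'] using h2'
  refine ⟨rfl, ?_⟩
  simpa [mul_assoc] using mul_mem h1 (inv_mem h2)

theorem tLength_inv_mul_le (g x : HNNExtension A C D φ) :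
    (g⁻¹ * x).tLength ≤ g.tLength + x.tLength := by
  induction hn : g.tLength generalizing g x with
  | zero =>
    obtain ⟨a, rfl⟩ := tLength_eq_zero_iff.1 hn
    rw [← map_inv, tLength_of_mul, zero_add]
  | succ n ih =>
    obtain ⟨a, k, h⟩ := exists_tLength_lt (g := g) (by omega)
    have h1 := ih (t ^ (k : ℤ) * (of a * g)) (t ^ (k : ℤ) * (of a * x)) (by omega)
    have h2 := tLength_zpow_mul k (of a * x)
    rw [tLength_of_mul] at h2
    simp only [mul_inv_rev, mul_assoc, inv_mul_cancel_left] at h1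
    omega

theorem tLength_inv (g : HNNExtension A C D φ) : g⁻¹.tLength = g.tLength := by
  have h1 := tLength_inv_mul_le g 1
  have h2 := tLength_inv_mul_le g⁻¹ 1
  rw [tLength_one, mul_one] at h1 h2
  rw [inv_inv] at h2
  omega

@[simp]
theorem tLength_mul_of (g : HNNExtension A C D φ) (a : A) : (g * of a).tLength = g.tLength := by
  rw [← tLength_inv, mul_inv_rev, ← map_inv, tLength_of_mul, tLength_inv]

theorem tLength_zpow (k : ℤˣ) : (t ^ (k : ℤ) : HNNExtension A C D φ).tLength = 1 := by
  have := tLength_zpow_mul k (1 : HNNExtension A C D φ)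
  rw [mul_one, tLength_one] at this
  omega

theorem zpow_mul_of_mul_zpow_mem_iff (k : ℤˣ) (a : A) :
    (t ^ (k : ℤ) * of a * t ^ (-k : ℤ) : HNNExtension A C D φ) ∈
      (of : A →* HNNExtension A C D φ).range ↔ a ∈ toSubgroup C D k := by
  constructor
  · intro h
    rw [← tLength_eq_zero_iff, mul_assoc] at h
    have h1 : (t ^ (-k : ℤ) : HNNExtension A C D φ).tLength = 1 := by
      simpa using tLength_zpow (φ := φ) (-k)
    have h2 := eq_and_mem_of_tLength (g := t ^ (-k : ℤ)) (a := a) (b := 1) (k := k) (l := k)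
      (by rw [h, h1]) (by rw [map_one, one_mul, ← zpow_add, add_neg_cancel, zpow_zero,
        tLength_one, h1])
    simpa using h2.2
  · intro h
    rcases Int.units_eq_one_or k with rfl | rfl
    · refine ⟨φ ⟨a, h⟩, ?_⟩
      rw [equiv_eq_conj]
      simp
    · refine ⟨φ.symm ⟨a, h⟩, ?_⟩
      rw [equiv_symm_eq_conj]
      simp

section Tree

variable (φ) in
/-- The vertices of the Bass-Serre tree. -/
abbrev TreeVertex : Type u := HNNExtension A C D φ ⧸ (of : A →* HNNExtension A C D φ).range

/-- The distance in the Bass-Serre tree. -/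
noncomputable def treeDist (x y : TreeVertex φ) : ℕ := (x.out⁻¹ * y.out).tLength

theorem treeDist_mk (x y : HNNExtension A C D φ) :
    treeDist (x : TreeVertex φ) (y : TreeVertex φ) = (x⁻¹ * y).tLength := by
  obtain ⟨⟨_, a, rfl⟩, ha⟩ := QuotientGroup.mk_out_eq_mul (of : A →* HNNExtension A C D φ).range x
  obtain ⟨⟨_, b, rfl⟩, hb⟩ := QuotientGroup.mk_out_eq_mul (of : A →* HNNExtension A C D φ).range y
  rw [treeDist, ha, hb]
  simp only [mul_inv_rev, ← map_inv, mul_assoc, tLength_of_mul]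
  rw [← mul_assoc, tLength_mul_of]

theorem treeDist_smul (g : HNNExtension A C D φ) (x y : TreeVertex φ) :
    treeDist (g • x) (g • y) = treeDist x y := by
  induction x using QuotientGroup.induction_on
  induction y using QuotientGroup.induction_on
  rw [MulAction.Quotient.smul_coe, MulAction.Quotient.smul_coe, treeDist_mk, treeDist_mk]
  simp [mul_assoc]

theorem treeDist_mul_zpow (g : HNNExtension A C D φ) (k : ℤˣ) :
    treeDist (g : TreeVertex φ) ((g * t ^ (k : ℤ) : HNNExtension A C D φ) : TreeVertex φ) = 1 := by
  rw [treeDist_mk, inv_mul_cancel_left, tLength_zpow]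

theorem exists_mul_of_mul_zpow {g : HNNExtension A C D φ} {y : TreeVertex φ}
    (h : treeDist (g : TreeVertex φ) y = 1) :
    ∃ (a : A) (k : ℤˣ), y = (g * of a * t ^ (-k : ℤ) : HNNExtension A C D φ) := by
  induction y using QuotientGroup.induction_on with | _ y
  rw [treeDist_mk] at h
  obtain ⟨a, k, hk⟩ := exists_tLength_lt (g := g⁻¹ * y) (by omega)
  refine ⟨a⁻¹, k, ?_⟩
  rw [eq_comm, QuotientGroup.eq, ← tLength_eq_zero_iff]
  rw [h] at hk
  simp only [mul_inv_rev, ← map_inv, inv_inv, mul_assoc, zpow_neg]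
  omega

theorem exists_mul_zpow {x y : TreeVertex φ} (h : treeDist x y = 1) :
    ∃ (g : HNNExtension A C D φ) (k : ℤˣ), x = g ∧
      y = (g * t ^ (-k : ℤ) : HNNExtension A C D φ) := by
  induction x using QuotientGroup.induction_on with | _ x
  obtain ⟨a, k, rfl⟩ := exists_mul_of_mul_zpow h
  exact ⟨x * of a, k, QuotientGroup.eq.2 (by simp), rfl⟩

theorem treeDist_neighbour (g x : HNNExtension A C D φ) (a : A) (k : ℤˣ) :
    treeDist (x : TreeVertex φ) (g * of a * t ^ (-k : ℤ) : HNNExtension A C D φ) =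
      (t ^ (k : ℤ) * (of a⁻¹ * (g⁻¹ * x))).tLength := by
  rw [treeDist_mk, ← tLength_inv]
  simp [mul_assoc]

theorem treeDist_comm (x y : TreeVertex φ) : treeDist x y = treeDist y x := by
  rw [treeDist, ← tLength_inv, treeDist]
  simp

theorem isTreeMetric_treeDist : IsTreeMetric (treeDist : TreeVertex φ → TreeVertex φ → ℕ) where
  eq_zero_iff x y := by
    induction x using QuotientGroup.induction_on
    induction y using QuotientGroup.induction_on
    rw [treeDist_mk, tLength_eq_zero_iff, QuotientGroup.eq]
  comm := treeDist_comm
  step x y z h := by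
    induction x using QuotientGroup.induction_on with | _ x
    induction y using QuotientGroup.induction_on with | _ y
    obtain ⟨a, k, rfl⟩ := exists_mul_of_mul_zpow h
    rw [treeDist_neighbour, treeDist_comm, treeDist_mk, ← tLength_of_mul a⁻¹ (y⁻¹ * x)]
    exact tLength_zpow_mul _ _
  exists_parent {x y} h := by
    induction x using QuotientGroup.induction_on with | _ x
    induction y using QuotientGroup.induction_on with | _ y
    have h0 : (y⁻¹ * x).tLength ≠ 0 := by
      rwa [ne_comm, Ne, QuotientGroup.eq, ← tLength_eq_zero_iff] at h
    obtain ⟨a, k, hk⟩ := exists_tLength_lt h0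
    refine ⟨(y * of a⁻¹ * t ^ (-k : ℤ) : HNNExtension A C D φ), ?_, ?_⟩
    · rw [treeDist_mk, mul_assoc, inv_mul_cancel_left, tLength_of_mul]
      simpa using tLength_zpow (φ := φ) (-k)
    · rw [treeDist_neighbour, inv_inv, hk, treeDist_comm, treeDist_mk]
  parent_unique {x y z z'} hz hz' h h' := by
    induction x using QuotientGroup.induction_on with | _ x
    induction y using QuotientGroup.induction_on with | _ y
    obtain ⟨a, k, rfl⟩ := exists_mul_of_mul_zpow hz
    obtain ⟨b, l, rfl⟩ := exists_mul_of_mul_zpow hz'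
    rw [treeDist_neighbour, treeDist_comm, treeDist_mk] at h h'
    obtain ⟨rfl, hab⟩ := eq_and_mem_of_tLength h h'
    rw [QuotientGroup.eq]
    simpa [mul_assoc] using (zpow_mul_of_mul_zpow_mem_iff (φ := φ) k _).2 hab

/-- The exponent sum of the stable letter. -/
noncomputable def expSum : HNNExtension A C D φ →* Multiplicative ℤ :=
  lift 1 (Multiplicative.ofAdd 1) (by simp)

theorem expSum_eq {x y : HNNExtension A C D φ} (h : (x : TreeVertex φ) = y) :
    expSum x = expSum y := by
  obtain ⟨a, ha⟩ := QuotientGroup.eq.1 h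
  rw [← mul_inv_cancel_left x y, ← ha, map_mul, expSum, lift_of, MonoidHom.one_apply, mul_one]

theorem expSum_t : expSum (t : HNNExtension A C D φ) = Multiplicative.ofAdd 1 := lift_t _ _ _

end Tree

section Action

variable {N : Subgroup (HNNExtension A C D φ)}

theorem mem_range_of_smul_eq {n : N} {g : HNNExtension A C D φ}
    (h : n • (g : TreeVertex φ) = g) :
    g⁻¹ * n * g ∈ (of : A →* HNNExtension A C D φ).range := by
  have : ((n * g : HNNExtension A C D φ) : TreeVertex φ) = g := h
  rw [eq_comm, QuotientGroup.eq] at this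
  rwa [mul_assoc]

theorem eq_one_of_mem_toSubgroup [hN : N.Normal]
    (hNC : N ⊓ Subgroup.map (of : A →* HNNExtension A C D φ) C = ⊥) {k : ℤˣ} {a : A}
    (ha : a ∈ toSubgroup C D k) (hn : (of a : HNNExtension A C D φ) ∈ N) :
    (of a : HNNExtension A C D φ) = 1 := by
  have key : ∀ c ∈ C, (of c : HNNExtension A C D φ) ∈ N → (of c : HNNExtension A C D φ) = 1 :=
    fun c hc hcN => by
      rw [← Subgroup.mem_bot, ← hNC]
      exact ⟨hcN, c, hc, rfl⟩
  rcases Int.units_eq_one_or k with rfl | rfl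
  · exact key a ha hn
  · have h1 := equiv_symm_eq_conj (φ := φ) ⟨a, ha⟩
    have h2 := key _ (φ.symm ⟨a, ha⟩).2
      (by rw [h1]; simpa using hN.conj_mem _ hn t⁻¹)
    rwa [h2, eq_comm, mul_assoc, inv_mul_eq_one, right_eq_mul] at h1

theorem isTreeAction [hN : N.Normal] (hNne : N ≠ ⊥)
    (hNC : N ⊓ Subgroup.map (of : A →* HNNExtension A C D φ) C = ⊥) :
    IsTreeAction N (treeDist : TreeVertex φ → TreeVertex φ → ℕ) where
  toIsTreeMetric := isTreeMetric_treeDist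
  smul n x y := treeDist_smul (n : HNNExtension A C D φ) x y
  free n x y h hx hy := by
    obtain ⟨g, k, rfl, rfl⟩ := exists_mul_zpow h
    obtain ⟨a, ha⟩ := mem_range_of_smul_eq hx
    have h1 := mem_range_of_smul_eq hy
    have h2 : (t ^ (k : ℤ) * of a * t ^ (-k : ℤ) : HNNExtension A C D φ) ∈
        (of : A →* HNNExtension A C D φ).range := by
      rw [ha]
      simpa [mul_assoc] using h1
    rw [zpow_mul_of_mul_zpow_mem_iff] at h2
    have h3 := eq_one_of_mem_toSubgroup hNC h2
      (by rw [ha]; simpa using hN.conj_mem n n.2 g⁻¹)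
    rw [ha] at h3
    ext
    simpa [mul_assoc, inv_mul_eq_one, eq_comm] using h3
  not_inversion n x y h hx hy := by
    obtain ⟨g, k, rfl, rfl⟩ := exists_mul_zpow h
    have h1 := expSum_eq (x := (n : HNNExtension A C D φ) * g) hx
    have h2 := expSum_eq (x := (n : HNNExtension A C D φ) * (g * t ^ (-k : ℤ))) hy
    rw [map_mul, map_mul, map_zpow, expSum_t] at h1
    rw [map_mul, map_mul, map_zpow, expSum_t] at h2
    have h3 := congrArg Multiplicative.toAdd h1
    have h4 := congrArg Multiplicative.toAdd h2
    simp at h3 h4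
    rcases Int.units_eq_one_or k with rfl | rfl <;> simp at h3 h4 <;> omega
  not_fixed x := by
    induction x using QuotientGroup.induction_on with | _ g
    by_contra! hfix
    have hle : ∀ m ∈ N, m ∈ (of : A →* HNNExtension A C D φ).range := fun m hm => by
      simpa [mul_assoc] using mem_range_of_smul_eq (hfix ⟨_, hN.conj_mem m hm g⟩)
    refine hNne (eq_bot_iff.2 fun m hm => ?_)
    obtain ⟨a, rfl⟩ := hle m hm
    refine eq_one_of_mem_toSubgroup hNC (k := 1) ?_ hm
    rw [← zpow_mul_of_mul_zpow_mem_iff (φ := φ)]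
    simpa using hle _ (hN.conj_mem _ hm t)

end Action

end HNNExtension

namespace HNNExtension

variable {A : Type u} [Group A] {C D : Subgroup A} {φ : C ≃* D}
  {N : Subgroup (HNNExtension A C D φ)} [hN : N.Normal]
  {X : OrbitGraph N (TreeVertex φ)}

theorem exists_smul_eq_of_inv_mul_mem {H : Subgroup (HNNExtension A C D φ)}
    {x y : HNNExtension A C D φ} (h : x⁻¹ * y ∈ N ⊔ H) : ∃ n : N, ∃ a ∈ H, y = n * x * a := by
  obtain ⟨n, hn, a, ha, he⟩ := Subgroup.mem_sup_of_normal_left.1 h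
  refine ⟨⟨_, hN.conj_mem n hn x⟩, a, ha, ?_⟩
  rw [← mul_inv_cancel_left x y, ← he]
  simp [mul_assoc]

theorem inv_mul_mem_sup {H : Subgroup (HNNExtension A C D φ)} {x y : HNNExtension A C D φ}
    {n : N} (h : (n * x)⁻¹ * y ∈ H) : x⁻¹ * y ∈ N ⊔ H := by
  have h1 : x⁻¹ * n * x ∈ N ⊔ H :=
    Subgroup.mem_sup_left (by simpa using hN.conj_mem n n.2 x⁻¹)
  simpa [mul_assoc] using mul_mem h1 (Subgroup.mem_sup_right h)

theorem card_vertexOrbits (hf : Function.Bijective X.f) :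
    Fintype.card X.I = (N ⊔ (of : A →* HNNExtension A C D φ).range).index := by
  rw [← Nat.card_eq_fintype_card, Subgroup.index]
  refine Nat.card_eq_of_bijective
    (fun i => ((X.f (X.r i)).out : HNNExtension A C D φ ⧸ N ⊔ _)) ⟨fun i j hij => ?_, fun q => ?_⟩
  · obtain ⟨n, a, ha, h⟩ := exists_smul_eq_of_inv_mul_mem (QuotientGroup.eq.1 hij)
    refine X.rep_inj i j n (hf.1 ?_)
    rw [X.f_smul, ← QuotientGroup.out_eq' (X.f (X.r i)), ← QuotientGroup.out_eq' (X.f (X.r j)), h]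
    exact QuotientGroup.eq.2 (by simpa [mul_assoc] using ha)
  · induction q using QuotientGroup.induction_on with | _ g
    obtain ⟨x, hx⟩ := hf.2 g
    obtain ⟨i, n, rfl⟩ := X.exists_rep x
    refine ⟨i, QuotientGroup.eq.2 (inv_mul_mem_sup (n := n) ?_)⟩
    rw [← QuotientGroup.eq, ← hx, X.f_smul]
    conv_rhs => rw [← QuotientGroup.out_eq' (X.f (X.r i))]
    rfl

theorem exists_oriented {x y : TreeVertex φ} (h : treeDist x y = 1) :
    ∃ g : HNNExtension A C D φ, (x = g ∧ y = (g * t⁻¹ : HNNExtension A C D φ)) ∨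
      (y = g ∧ x = (g * t⁻¹ : HNNExtension A C D φ)) := by
  obtain ⟨g, k, rfl, rfl⟩ := exists_mul_zpow h
  rcases Int.units_eq_one_or k with rfl | rfl
  · exact ⟨g, Or.inl ⟨rfl, by simp⟩⟩
  · exact ⟨g * t, Or.inr ⟨by simp, by simp⟩⟩

theorem mk_mul_of_mul_inv_t (g : HNNExtension A C D φ) (c : C) :
    ((g * of (c : A) * t⁻¹ : HNNExtension A C D φ) : TreeVertex φ) =
      (g * t⁻¹ : HNNExtension A C D φ) := by
  rw [mul_assoc, of_mul_inv_t, ← mul_assoc, eq_comm, QuotientGroup.eq]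
  exact ⟨_, (inv_mul_cancel_left _ _).symm⟩

theorem inv_mul_mem_map {g h : HNNExtension A C D φ} (h1 : (g : TreeVertex φ) = h)
    (h2 : ((g * t⁻¹ : HNNExtension A C D φ) : TreeVertex φ) = (h * t⁻¹ : HNNExtension A C D φ)) :
    g⁻¹ * h ∈ C.map (of : A →* HNNExtension A C D φ) := by
  obtain ⟨a, ha⟩ := QuotientGroup.eq.1 h1
  rw [QuotientGroup.eq] at h2
  refine ⟨a, ?_, ha⟩
  have := (zpow_mul_of_mul_zpow_mem_iff (φ := φ) 1 a).1 (by
    rw [ha]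
    simpa [mul_assoc] using h2)
  exact this

theorem card_edgeOrbits (hX : X.IsMinimal treeDist)
    (hδ : IsTreeAction N (treeDist : TreeVertex φ → TreeVertex φ → ℕ))
    (hf : Function.Bijective X.f) :
    Fintype.card X.J = (N ⊔ C.map (of : A →* HNNExtension A C D φ)).index := by
  have horient : ∀ j, ∃ (b : Bool) (g : HNNExtension A C D φ), X.f (X.e j b) = g ∧
      X.f (X.e j !b) = (g * t⁻¹ : HNNExtension A C D φ) := fun j => by
    obtain ⟨g, h | h⟩ := exists_oriented (hX.length_eq_one hδ j)
    · exact ⟨true, g, h⟩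
    · exact ⟨false, g, h⟩
  choose b g hsrc htgt using horient
  rw [← Nat.card_eq_fintype_card, Subgroup.index]
  refine Nat.card_eq_of_bijective
    (fun j => (g j : HNNExtension A C D φ ⧸ N ⊔ _)) ⟨fun i j hij => ?_, fun q => ?_⟩
  · obtain ⟨n, _, ⟨c, hc, rfl⟩, h⟩ := exists_smul_eq_of_inv_mul_mem (QuotientGroup.eq.1 hij)
    refine (hX.dart_unique hδ (n₁ := n) (n₂ := 1) (b₁ := b i) (b₂ := b j) (hf.1 ?_) ?_).2.1
    · rw [one_smul, X.f_smul, hsrc, hsrc, h]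
      exact QuotientGroup.eq.2 (by simp [mul_assoc])
    · rw [one_smul, X.f_smul, htgt, htgt, h, mk_mul_of_mul_inv_t _ ⟨c, hc⟩, mul_assoc]
      rfl
  · induction q using QuotientGroup.induction_on with | _ h
    obtain ⟨x, y, ⟨n, j, b', rfl, rfl⟩, hx, hy⟩ := hX.exists_adj_of_dist hδ hf.2
      (v := (h : TreeVertex φ)) (w := (h * t⁻¹ : HNNExtension A C D φ))
      (by simpa using treeDist_mul_zpow h (-1))
    rw [X.f_smul] at hx hy
    refine ⟨j, QuotientGroup.eq.2 (inv_mul_mem_sup (n := n) ?_)⟩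
    by_cases hb : b' = b j
    · subst hb
      rw [hsrc] at hx
      rw [htgt] at hy
      refine inv_mul_mem_map hx ?_
      rw [mul_assoc]
      exact hy
    · obtain rfl : b' = !(b j) := by cases b' <;> cases hj : b j <;> simp_all
      rw [htgt] at hx
      rw [Bool.not_not, hsrc] at hy
      have h1 := expSum_eq (x := (n : HNNExtension A C D φ) * (g j * t⁻¹)) hx
      have h2 := expSum_eq (x := (n : HNNExtension A C D φ) * g j) hy
      rw [map_mul, map_mul, map_inv, expSum_t] at h1
      rw [map_mul, map_mul, map_inv, expSum_t] at h2
      have h3 := congrArg Multiplicative.toAdd h1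
      have h4 := congrArg Multiplicative.toAdd h2
      simp at h3 h4
      omega

theorem generatedBy_stabilizer_iff (hf : Function.Injective X.f) (x : X.V) (k : ℕ) :
    (stabilizer N x).GeneratedBy k ↔
      (⊤ : Subgroup ↥(N ⊓ (of : A →* HNNExtension A C D φ).range)).GeneratedBy k := by
  obtain ⟨g, hg⟩ := QuotientGroup.mk_surjective (X.f x)
  have hmem : ∀ n : N, n ∈ stabilizer N x ↔
      g⁻¹ * n * g ∈ (of : A →* HNNExtension A C D φ).range := fun n => by
    rw [mem_stabilizer_iff, ← hf.eq_iff, X.f_smul, ← hg, mul_assoc, eq_comm,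
      ← QuotientGroup.eq]
    rfl
  constructor
  · intro h
    have hmap : (stabilizer N x).map ((MulAut.conj g⁻¹).toMonoidHom.comp N.subtype) =
        N ⊓ (of : A →* HNNExtension A C D φ).range := by
      ext m
      constructor
      · rintro ⟨n, hn, rfl⟩
        refine ⟨?_, ?_⟩
        · simpa using hN.conj_mem n n.2 g⁻¹
        · simpa using (hmem n).1 hn
      · rintro ⟨hm, hm'⟩
        refine ⟨⟨_, hN.conj_mem m hm g⟩, (hmem _).2 ?_, ?_⟩
        · simpa [mul_assoc] using hm'
        · simp [mul_assoc]
    rw [← hmap]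
    exact (h.map _).top_subtype
  · intro h
    let θ : ↥(N ⊓ (of : A →* HNNExtension A C D φ).range) →* N :=
      (MulAut.conjNormal g).toMonoidHom.comp (Subgroup.inclusion inf_le_left)
    convert! h.map θ
    ext n
    rw [hmem]
    constructor
    · intro hn
      have hn' : g⁻¹ * n * g ∈ N := by simpa using hN.conj_mem n n.2 g⁻¹
      refine ⟨⟨_, hn', hn⟩, trivial, ?_⟩
      ext
      simp [θ, mul_assoc]
    · rintro ⟨m, -, rfl⟩
      simpa [θ, mul_assoc] using m.2.2

end HNNExtension

/-- Let `G = A∗_C` be an HNN extension with base group `A` and associated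
subgroups `C` and `D`, and let `N` be a nontrivial finitely generated normal subgroup of `G`
with `N ∩ C = {1}`.  With `a = [G : NA]` and `c = [G : NC]`, one has, as an equation of
integers, `rank N = a·rank(N ⊓ A) + 1 + c − a`. -/
theorem stmt_16 {A : Type*} [Group A] (C D : Subgroup A) (φ : C ≃* D)
    (N : Subgroup (HNNExtension A C D φ)) (hNnorm : N.Normal) (hNne : N ≠ ⊥) (hNfg : N.FG)
    (hNC : N ⊓ Subgroup.map (HNNExtension.of : A →* HNNExtension A C D φ) C = ⊥)
    (a c : ℕ)
    (ha : a = (N ⊔ (HNNExtension.of : A →* HNNExtension A C D φ).range).index)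
    (hc : c = (N ⊔ Subgroup.map (HNNExtension.of : A →* HNNExtension A C D φ) C).index) :
    (minRank N : ℤ) =
      a * minRank ↥(N ⊓ (HNNExtension.of : A →* HNNExtension A C D φ).range) + 1 + c - a := by
  have hN := hNnorm
  have hδ := HNNExtension.isTreeAction hNne hNC
  have hgen : (⊤ : Subgroup N).GeneratedBy (minRank N) := by
    obtain ⟨S, hS⟩ := hNfg
    have h : N.GeneratedBy S.card := ⟨S, le_rfl, hS⟩
    exact h.top_subtype.top_minRank
  obtain ⟨S, hS, hS'⟩ := hgen
  obtain ⟨X₀, hX₀⟩ := OrbitGraph.exists_cost_le hS'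
    ((1 : HNNExtension A C D φ) : HNNExtension.TreeVertex φ)
  obtain ⟨X, hXc, hX⟩ := X₀.exists_isMinimal HNNExtension.treeDist
  have hf := hX.f_bijective hδ HNNExtension.treeDist_smul
  have hstab := HNNExtension.generatedBy_stabilizer_iff (X := X) hf.1
  have hd : ∀ i, minRank ↥(N ⊓ (HNNExtension.of : A →* HNNExtension A C D φ).range) ≤ X.d i :=
    fun i => ((hstab _ _).1 (X.gen i)).minRank_le
  let Y : OrbitGraph N (HNNExtension.TreeVertex φ) :=
    { X with
      d := fun _ => minRank ↥(N ⊓ (HNNExtension.of : A →* HNNExtension A C D φ).range)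
      gen := fun i => (hstab _ _).2 ((hstab _ _).1 (X.gen i)).top_minRank }
  have hY : Y.cost =
      a * minRank ↥(N ⊓ (HNNExtension.of : A →* HNNExtension A C D φ).range) - a + c := by
    rw [ha, hc, ← HNNExtension.card_vertexOrbits hf, ← HNNExtension.card_edgeOrbits hX hδ hf]
    simp [OrbitGraph.cost, VertexData.cost, Y]
  have hYX : Y.cost ≤ X.cost := by
    refine add_le_add_left (sub_le_sub_right (Finset.sum_le_sum fun i _ => ?_) _) _
    exact_mod_cast hd i
  have hup := Y.minRank_le_cost
  omega
end

section
/- Let s be an element of the free group F(u,y) on two generators, let e be a positive integer, and let r = s(xᵉ, y) ∈ F(x,y), i.e., r is the image of s under the endomorphism of the free group on two generators sending the first generator u to xᵉ and fixing the second generator y. Let G = ⟨x, y | r⟩ and H = ⟨u, y | s⟩ be the corresponding one-relator presented groups, and suppose the exponent sum of r with respect to y is nonzero. Then G is an infinite cyclic extension of a free group of finite rank if and only if H is an infinite cyclic extension of a free group of finite rank. -/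
/-- `G` is an infinite cyclic extension of a free group of rank `k`: there is a normal
subgroup `N` of `G` which is free of rank `k` with `G ⧸ N` infinite cyclic. -/
def IsInfCyclicExtOfFreeRank (G : Type*) [Group G] (k : ℕ) : Prop :=
  ∃ N : Subgroup G, ∃ hN : N.Normal,
    Nonempty (N ≃* FreeGroup (Fin k)) ∧
    Nonempty ((G ⧸ N) ≃* Multiplicative ℤ)

open RegularWreathProduct

/-- A retract of a free group of finite rank is free of finite rank. -/
theorem exists_mulEquiv_freeGroup_fin_of_retract {A P α : Type} [Group A] [Group P] [Finite α]
    (hP : P ≃* FreeGroup α) (i : A →* P) (ρ : P →* A) (h : ∀ a, ρ (i a) = a) :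
    ∃ k : ℕ, Nonempty (A ≃* FreeGroup (Fin k)) := by
  have hinj : Function.Injective (hP.toMonoidHom.comp i) :=
    hP.injective.comp (Function.LeftInverse.injective h)
  have : IsFreeGroup A := IsFreeGroup.ofMulEquiv (MonoidHom.ofInjective hinj).symm
  have hsurj : Function.Surjective (ρ.comp hP.symm.toMonoidHom) :=
    (Function.RightInverse.surjective h).comp hP.symm.surjective
  have hfun : Finite (IsFreeGroup.Generators A → Multiplicative (ZMod 2)) := by
    refine Finite.of_injective
      (fun v => FreeGroup.lift.symm
        ((IsFreeGroup.lift v : A →* Multiplicative (ZMod 2)).comp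
          (ρ.comp hP.symm.toMonoidHom)) :
        (IsFreeGroup.Generators A → Multiplicative (ZMod 2)) → α → Multiplicative (ZMod 2)) ?_
    intro v w hvw
    refine IsFreeGroup.lift.injective ?_
    exact (MonoidHom.cancel_right hsurj).1 (FreeGroup.lift.symm.injective hvw)
  have : Finite (IsFreeGroup.Generators A) := by
    by_contra hinf
    rw [not_finite_iff_infinite] at hinf
    exact not_finite (IsFreeGroup.Generators A → Multiplicative (ZMod 2))
  exact ⟨_, ⟨(IsFreeGroup.toFreeGroup A).trans (FreeGroup.freeGroupCongr (Finite.equivFin _))⟩⟩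

theorem Multiplicative.int_zpow_eq_one {a : Multiplicative ℤ} {n : ℤ} (hn : n ≠ 0)
    (h : a ^ n = 1) : a = 1 := by
  have h' : n * a.toAdd = 0 := by simpa using congrArg Multiplicative.toAdd h
  exact (mul_eq_zero.1 h').resolve_left hn

/-- A nontrivial homomorphism to `ℤ` is a nonzero multiple of a surjective one. -/
theorem MonoidHom.exists_surjective_zpow_eq {A : Type*} [Group A] (χ : A →* Multiplicative ℤ)
    (hχ : χ ≠ 1) :
    ∃ (f : ℤ) (χ' : A →* Multiplicative ℤ), f ≠ 0 ∧ Function.Surjective χ' ∧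
      ∀ a, χ a = χ' a ^ f := by
  obtain ⟨g, hg⟩ := IsCyclic.exists_generator (α := χ.range)
  have hg1 : (g : Multiplicative ℤ) ≠ 1 := by
    intro h
    refine hχ (MonoidHom.ext fun a => ?_)
    obtain ⟨k, hk⟩ := Subgroup.mem_zpowers_iff.1 (hg ⟨χ a, a, rfl⟩)
    have := congrArg Subtype.val hk
    simpa [h] using this.symm
  have hinj : Function.Injective (zpowersHom χ.range g) := by
    rw [injective_iff_map_eq_one]
    intro n hn
    by_contra hn1
    refine hg1 (Multiplicative.int_zpow_eq_one (n := n.toAdd) hn1 ?_)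
    simpa using congrArg Subtype.val hn
  have hsurj : Function.Surjective (zpowersHom χ.range g) := by
    intro b
    obtain ⟨k, hk⟩ := Subgroup.mem_zpowers_iff.1 (hg b)
    exact ⟨Multiplicative.ofAdd k, by simpa using hk⟩
  let E := MulEquiv.ofBijective (zpowersHom χ.range g) ⟨hinj, hsurj⟩
  refine ⟨Multiplicative.toAdd (g : Multiplicative ℤ),
    E.symm.toMonoidHom.comp χ.rangeRestrict, hg1,
    E.symm.surjective.comp χ.rangeRestrict_surjective, fun a => ?_⟩
  have h1 : (zpowersHom χ.range g) (E.symm (χ.rangeRestrict a)) = χ.rangeRestrict a :=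
    E.apply_symm_apply _
  have h2 := congrArg Subtype.val h1
  rw [zpowersHom_apply] at h2
  have h3 : (g : Multiplicative ℤ) ^ (E.symm (χ.rangeRestrict a)).toAdd = χ a := by simpa using h2
  rw [← h3]
  apply Multiplicative.toAdd.injective
  simp [mul_comm]

theorem isInfCyclicExtOfFreeRank_iff {G : Type*} [Group G] {k : ℕ} :
    IsInfCyclicExtOfFreeRank G k ↔ ∃ χ : G →* Multiplicative ℤ,
      Function.Surjective χ ∧ Nonempty (χ.ker ≃* FreeGroup (Fin k)) := by
  constructor
  · rintro ⟨N, hN, ⟨E⟩, ⟨F⟩⟩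
    have hker : (F.toMonoidHom.comp (QuotientGroup.mk' N)).ker = N := by
      ext g
      simp
    refine ⟨F.toMonoidHom.comp (QuotientGroup.mk' N),
      F.surjective.comp (QuotientGroup.mk'_surjective N), ⟨?_⟩⟩
    exact (MulEquiv.subgroupCongr hker).trans E
  · rintro ⟨χ, hχ, hE⟩
    exact ⟨χ.ker, inferInstance, hE, ⟨QuotientGroup.quotientKerEquivOfSurjective χ hχ⟩⟩

section Cocycles

variable {A P : Type*} [Group A] [Group P]

/-- A surjection to `ℤ` has a section equivariant under a given element of nonzero image. -/
theorem exists_equivariant_section (χ : A →* Multiplicative ℤ) (hχ : Function.Surjective χ)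
    (a : A) (ha : χ a ≠ 1) :
    ∃ t : Multiplicative ℤ → A, (∀ m, χ (t m) = m) ∧ (∀ m, t (χ a * m) = a * t m) ∧ t 1 = 1 := by
  have hex : ∀ m : ℤ, ∃ b : A, χ b = Multiplicative.ofAdd m ∧ (m = 0 → b = 1) := by
    intro m
    by_cases hm : m = 0
    · exact ⟨1, by simp [hm], fun _ => rfl⟩
    · obtain ⟨b, hb⟩ := hχ (Multiplicative.ofAdd m)
      exact ⟨b, hb, fun h => absurd h hm⟩
  choose b hb hb0 using hex
  have hc : (χ a).toAdd ≠ 0 := ha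
  refine ⟨fun m => a ^ (m.toAdd / (χ a).toAdd) * b (m.toAdd % (χ a).toAdd), ?_, ?_, ?_⟩
  · intro m
    apply Multiplicative.toAdd.injective
    simp only [map_mul, map_zpow, hb, toAdd_mul, toAdd_zpow, toAdd_ofAdd, smul_eq_mul]
    rw [mul_comm]
    exact Int.mul_ediv_add_emod _ _
  · intro m
    simp only [toAdd_mul]
    rw [Int.add_emod_left, Int.add_ediv_of_dvd_left (dvd_refl _), Int.ediv_self hc, zpow_one_add,
      mul_assoc]
  · simp [hb0]

/-- The cocycle of left multiplication on `A`, trivialised along a section of `χ`. -/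
def sectionCocycle (χ : A →* Multiplicative ℤ) (t : Multiplicative ℤ → A)
    (ht : ∀ m, χ (t m) = m) : A →* χ.ker ≀ᵣ Multiplicative ℤ where
  toFun a := ⟨fun n => ⟨(t n)⁻¹ * a * t ((χ a)⁻¹ * n), by simp [MonoidHom.mem_ker, ht]⟩, χ a⟩
  map_one' := by
    ext <;> simp
  map_mul' a b := by
    ext n
    · simp [mul_assoc]
    · simp

/-- A cocycle over `χ` restricts at the base point to a homomorphism on `χ.ker`. -/
def kerEval (χ : A →* Multiplicative ℤ) (Φ : A →* P ≀ᵣ Multiplicative ℤ)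
    (h : ∀ a, (Φ a).right = χ a) : χ.ker →* P where
  toFun a := (Φ a).left 1
  map_one' := by simp
  map_mul' a b := by
    have ha : χ a = 1 := a.2
    simp [h, ha]

/-- The cocycle over `χ ^ f` which on the residue class of `i` modulo `f` is the image under `ι i`
of the section cocycle, modified by the coboundary of `T`. -/
def twistedCocycle (χ : A →* Multiplicative ℤ) (t : Multiplicative ℤ → A)
    (ht : ∀ m, χ (t m) = m) (f : ℤ) (hf : f ≠ 0) (ι : ℤ → χ.ker →* P)
    (T : Multiplicative ℤ → P) : A →* P ≀ᵣ Multiplicative ℤ where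
  toFun a := ⟨fun n => (T n)⁻¹ * ι (n.toAdd % f)
    ((sectionCocycle χ t ht a).left (Multiplicative.ofAdd (n.toAdd / f))) *
      T ((χ a ^ f)⁻¹ * n), χ a ^ f⟩
  map_one' := by
    ext <;> simp
  map_mul' a b := by
    ext n
    · have h1 : (-(f * (χ a).toAdd) + n.toAdd) % f = n.toAdd % f := by
        rw [neg_mul_eq_mul_neg, Int.mul_add_emod_self_left]
      have h2 : (-(f * (χ a).toAdd) + n.toAdd) / f = -(χ a).toAdd + n.toAdd / f := by
        rw [neg_mul_eq_mul_neg, Int.mul_add_ediv_left _ _ hf]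
      have h3 : ((χ a ^ f)⁻¹ * n).toAdd = -(f * (χ a).toAdd) + n.toAdd := by simp
      have h4 : Multiplicative.ofAdd (-(χ a).toAdd + n.toAdd / f) =
        (χ a)⁻¹ * Multiplicative.ofAdd (n.toAdd / f) := rfl
      have h5 : (sectionCocycle χ t ht a).right = χ a := rfl
      simp only [map_mul, mul_left, Pi.mul_apply, h3, h1, h2, h4, h5, mul_zpow, mul_inv_rev]
      simp only [mul_assoc, mul_inv_cancel_left]
    · simp [mul_zpow]

end Cocycles

/-- `G` is obtained from `H` by adjoining an `e`-th root `x` of `u`. -/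
structure IsRootAdjunction {G H : Type} [Group G] [Group H] (j : H →* G) (u : H) (x : G)
    (e : ℕ) : Prop where
  map_eq : j u = x ^ e
  exists_lift : ∀ {Q : Type} [Group Q] (φ : H →* Q) (q : Q), φ u = q ^ e →
    ∃ Φ : G →* Q, (∀ h, Φ (j h) = φ h) ∧ Φ x = q
  hom_ext : ∀ {Q : Type} [Group Q] (Φ Ψ : G →* Q), (∀ h, Φ (j h) = Ψ (j h)) → Φ x = Ψ x → Φ = Ψ

namespace IsRootAdjunction

variable {G H : Type} [Group G] [Group H] {j : H →* G} {u : H} {x : G} {e : ℕ}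

/-- A cocycle on `H` over `χH ^ f` trivial on `u` extends to `G`, trivially on `x`. -/
theorem exists_twistedCocycle (hj : IsRootAdjunction j u x e) {P : Type} [Group P]
    {χG : G →* Multiplicative ℤ} {χH : H →* Multiplicative ℤ} {f : ℤ} (hf : f ≠ 0)
    (hχ : ∀ h, χG (j h) = χH h ^ f) {t : Multiplicative ℤ → H} (ht : ∀ m, χH (t m) = m)
    (htu : ∀ m, t (χH u * m) = u * t m) (ι : ℤ → χH.ker →* P) (T : Multiplicative ℤ → P)
    (hT : ∀ n, T (χH u ^ f * n) = T n) :
    ∃ Φ : G →* P ≀ᵣ Multiplicative ℤ, (∀ h, Φ (j h) = twistedCocycle χH t ht f hf ι T h) ∧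
      Φ x = inl (χG x) ∧ ∀ g, (Φ g).right = χG g := by
  have hu : twistedCocycle χH t ht f hf ι T u = inl (χG x) ^ e := by
    have h0 : χG x ^ e = χH u ^ f := by rw [← hχ, hj.map_eq, map_pow]
    rw [← map_pow, h0]
    have ht' : ∀ m, u * t ((χH u)⁻¹ * m) = t m := fun m => by rw [← htu, mul_inv_cancel_left]
    have hT' : ∀ n, T ((χH u ^ f)⁻¹ * n) = T n := fun n => by
      rw [← hT ((χH u ^ f)⁻¹ * n), mul_inv_cancel_left]
    ext n
    · have h1 : (sectionCocycle χH t ht u).left (Multiplicative.ofAdd (n.toAdd / f)) = 1 := by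
        ext
        simp [sectionCocycle, mul_assoc, ht']
      simp [twistedCocycle, h1, hT', -map_zpow]
    · simp [twistedCocycle, -map_zpow]
  obtain ⟨Φ, h1, h2⟩ := hj.exists_lift _ _ hu
  refine ⟨Φ, h1, h2, fun g => ?_⟩
  have : rightHom.comp Φ = χG := by
    refine hj.hom_ext _ _ (fun h => ?_) ?_
    · simp [h1, twistedCocycle, hχ]
    · simp [h2]
  exact DFunLike.congr_fun this g

/-- The kernel in `H` is a retract of the kernel in `G`. -/
theorem exists_free_ker_of_free_ker (hj : IsRootAdjunction j u x e)
    {χG : G →* Multiplicative ℤ} {χH : H →* Multiplicative ℤ} {f : ℤ} (hf : f ≠ 0)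
    (hχ : ∀ h, χG (j h) = χH h ^ f) (hsurj : Function.Surjective χH) (hu : χH u ≠ 1) {k : ℕ}
    (E : χG.ker ≃* FreeGroup (Fin k)) :
    ∃ l : ℕ, Nonempty (χH.ker ≃* FreeGroup (Fin l)) := by
  obtain ⟨t, ht, htu, ht1⟩ := exists_equivariant_section χH hsurj u hu
  obtain ⟨Φ, h1, -, h3⟩ := hj.exists_twistedCocycle hf hχ ht htu (fun _ => MonoidHom.id χH.ker)
    (fun _ => 1) (fun _ => rfl)
  let i : χH.ker →* χG.ker := (j.comp χH.ker.subtype).codRestrict χG.ker fun h => by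
    have hh : χH h = 1 := h.2
    simp [MonoidHom.mem_ker, hχ, hh]
  refine exists_mulEquiv_freeGroup_fin_of_retract E i (kerEval χG Φ h3) fun h => ?_
  have hh : χH h = 1 := h.2
  change (Φ (j h)).left 1 = h
  ext
  simp [h1, twistedCocycle, sectionCocycle, hh, ht1]

/-- The kernel in `G` is a retract of the free product of copies of the kernel in `H` and a free
group of finite rank. -/
theorem exists_free_ker_of_free_ker_base (hj : IsRootAdjunction j u x e)
    {χG : G →* Multiplicative ℤ} {χH : H →* Multiplicative ℤ} {f : ℤ} (hf : f ≠ 0)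
    (hχ : ∀ h, χG (j h) = χH h ^ f) (hsurjH : Function.Surjective χH)
    (hsurjG : Function.Surjective χG) (hu : χH u ≠ 1) (hx : χG x ≠ 1) {k : ℕ}
    (E : χH.ker ≃* FreeGroup (Fin k)) :
    ∃ l : ℕ, Nonempty (χG.ker ≃* FreeGroup (Fin l)) := by
  obtain ⟨t, ht, htu, -⟩ := exists_equivariant_section χH hsurjH u hu
  obtain ⟨s, hs, hsx, hs1⟩ := exists_equivariant_section χG hsurjG x hx
  have hsx_pow : ∀ (i : ℕ) n, s (χG x ^ i * n) = x ^ i * s n := by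
    intro i n
    induction i with
    | zero => simp
    | succ i ih => rw [pow_succ', mul_assoc, hsx, ih, pow_succ', mul_assoc]
  have hpow : χG x ^ e = χH u ^ f := by rw [← hχ, hj.map_eq, map_pow]
  have hsu : ∀ n, s (χH u ^ f * n) = j u * s n := fun n => by rw [← hpow, hsx_pow, hj.map_eq]
  have hd : f * (χH u).toAdd ≠ 0 := mul_ne_zero hf hu
  let residue (d : ℤ) (h : d ≠ 0) (n : ℤ) : Set.Ico (0 : ℤ) |d| :=
    ⟨n % d, Int.emod_nonneg _ h, Int.emod_lt_abs _ h⟩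
  let P := FreeGroup ((Set.Ico (0 : ℤ) |f| × Fin k) ⊕ Set.Ico (0 : ℤ) |f * (χH u).toAdd|)
  let ι (i : ℤ) : χH.ker →* P :=
    (FreeGroup.map fun b => Sum.inl (residue f hf i, b)).comp E.toMonoidHom
  let T (n : Multiplicative ℤ) : P := FreeGroup.of (Sum.inr (residue _ hd n.toAdd))
  have hT : ∀ n, T (χH u ^ f * n) = T n := by
    intro n
    simp [T, residue]
  obtain ⟨Φ, h1, h2, h3⟩ := hj.exists_twistedCocycle hf hχ ht htu ι T hT
  let conj (i : ℤ) : χH.ker →* χG.ker :=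
    ((MulAut.conj (s (Multiplicative.ofAdd i))⁻¹).toMonoidHom.comp
      (j.comp χH.ker.subtype)).codRestrict χG.ker fun h => by
        have hh : χH h = 1 := h.2
        simp [MonoidHom.mem_ker, hχ, hh]
  let τ (n : ℤ) : χG.ker :=
    ⟨(s (Multiplicative.ofAdd (n % f)))⁻¹ * (j (t (Multiplicative.ofAdd (n / f))))⁻¹ *
      s (Multiplicative.ofAdd n), by
        rw [MonoidHom.mem_ker]
        apply Multiplicative.toAdd.injective
        simp only [map_mul, map_inv, hs, hχ, ht, toAdd_mul, toAdd_inv, toAdd_zpow, toAdd_ofAdd,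
          smul_eq_mul, toAdd_one]
        linarith [Int.mul_ediv_add_emod n f]⟩
  have hτ : Function.Periodic τ (f * (χH u).toAdd) := by
    intro n
    have e1 : Multiplicative.ofAdd (n + f * (χH u).toAdd) =
        χH u ^ f * Multiplicative.ofAdd n := by
      apply Multiplicative.toAdd.injective
      simp only [toAdd_ofAdd, toAdd_mul, toAdd_zpow, smul_eq_mul, add_comm]
    have e2 : Multiplicative.ofAdd (n / f + (χH u).toAdd) =
        χH u * Multiplicative.ofAdd (n / f) := by
      apply Multiplicative.toAdd.injective
      simp [add_comm]
    apply Subtype.ext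
    simp only [τ]
    rw [Int.add_mul_emod_self_left, Int.add_mul_ediv_left _ _ hf, e1, e2, hsu, htu]
    simp [mul_assoc]
  let ψ : P →* χG.ker := FreeGroup.lift
    (Sum.elim (fun ib => conj ib.1 (E.symm (FreeGroup.of ib.2))) fun n => τ n)
  have hψT : ∀ n, ψ (T n) = τ n.toAdd := by
    intro n
    have : τ (n.toAdd % (f * (χH u).toAdd)) = τ n.toAdd := by
      rw [Int.emod_def, mul_comm (f * _)]
      exact hτ.sub_int_mul_eq _
    exact FreeGroup.lift_apply_of.trans this
  have hψι : ∀ (n : ℤ) h, ψ (ι (n % f) h) = conj (n % f) h := by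
    intro n h
    have : ψ.comp (FreeGroup.map fun b => Sum.inl (residue f hf (n % f), b)) =
        (conj (n % f)).comp E.symm.toMonoidHom := by
      refine FreeGroup.ext_hom _ _ fun b => ?_
      refine (congrArg ψ FreeGroup.map.of).trans ?_
      refine FreeGroup.lift_apply_of.trans ?_
      simp [residue]
    simpa [ι] using DFunLike.congr_fun this (E h)
  let Ψ : P ≀ᵣ Multiplicative ℤ →* χG.ker ≀ᵣ Multiplicative ℤ :=
    { toFun := fun a => ⟨fun n => ψ (a.left n), a.right⟩
      map_one' := by ext <;> simp
      map_mul' := fun a b => by ext <;> simp }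
  have key : Ψ.comp Φ = sectionCocycle χG s hs := by
    refine hj.hom_ext _ _ (fun h => ?_) ?_
    · have hl : ∀ n, ψ ((Φ (j h)).left n) = (sectionCocycle χG s hs (j h)).left n := by
        intro n
        have e1 : (((χH h ^ f)⁻¹ * n).toAdd) = n.toAdd + f * -(χH h).toAdd := by
          simp only [toAdd_mul, toAdd_inv, toAdd_zpow, smul_eq_mul]
          ring
        have e2 : Multiplicative.ofAdd (n.toAdd / f + -(χH h).toAdd) =
            (χH h)⁻¹ * Multiplicative.ofAdd (n.toAdd / f) := by
          apply Multiplicative.toAdd.injective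
          simp [add_comm]
        have e3 : Multiplicative.ofAdd (n.toAdd + f * -(χH h).toAdd) = (χH h ^ f)⁻¹ * n := by
          rw [← e1, ofAdd_toAdd]
        rw [h1]
        simp only [twistedCocycle, MonoidHom.coe_mk, OneHom.coe_mk, map_mul, map_inv, hψT, hψι]
        ext
        simp only [e1, τ, Int.add_mul_emod_self_left, Int.add_mul_ediv_left _ _ hf, e2, e3]
        simp [conj, sectionCocycle, mul_assoc, hχ]
      ext n
      · exact congrArg Subtype.val (hl n)
      · simp [Ψ, sectionCocycle, h3]
    · ext n
      · have : x * s ((χG x)⁻¹ * n) = s n := by rw [← hsx, mul_inv_cancel_left]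
        simp [Ψ, h2, sectionCocycle, mul_assoc, this]
      · simp [Ψ, sectionCocycle, h3]
  refine exists_mulEquiv_freeGroup_fin_of_retract (MulEquiv.refl P) (kerEval χG Φ h3) ψ
    fun a => ?_
  have ha : χG a = 1 := a.2
  have := congrFun (congrArg RegularWreathProduct.left (DFunLike.congr_fun key (a : G))) 1
  change ψ ((Φ a).left 1) = a
  refine Eq.trans this ?_
  ext
  simp [sectionCocycle, ha, hs1]

/-- Ranks of free kernels transfer along a root adjunction on which maps to `ℤ` are detected by
`u` and `x`. -/
theorem exists_isInfCyclicExtOfFreeRank_iff (hj : IsRootAdjunction j u x e) (he : e ≠ 0)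
    (hG : ∀ χ : G →* Multiplicative ℤ, χ x = 1 → χ = 1)
    (hH : ∀ χ : H →* Multiplicative ℤ, χ u = 1 → χ = 1) :
    (∃ k : ℕ, IsInfCyclicExtOfFreeRank G k) ↔ ∃ l : ℕ, IsInfCyclicExtOfFreeRank H l := by
  have ne_one : ∀ {A : Type} [Group A] {χ : A →* Multiplicative ℤ},
      Function.Surjective χ → χ ≠ 1 := by
    rintro A _ χ hχ rfl
    obtain ⟨a, ha⟩ := hχ (Multiplicative.ofAdd 1)
    exact one_ne_zero (congrArg Multiplicative.toAdd ha).symm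
  simp only [isInfCyclicExtOfFreeRank_iff]
  constructor
  · rintro ⟨k, χG, hsurjG, ⟨E⟩⟩
    have hx : χG x ≠ 1 := fun h => ne_one hsurjG (hG _ h)
    have hne : χG.comp j ≠ 1 := by
      intro h
      have h' : χG x ^ e = 1 := by
        rw [← map_pow, ← hj.map_eq]
        exact DFunLike.congr_fun h u
      exact hx (Multiplicative.int_zpow_eq_one (n := e) (by exact_mod_cast he) (by simpa using h'))
    obtain ⟨f, χH, hf, hsurjH, hχ⟩ := (χG.comp j).exists_surjective_zpow_eq hne
    have hu : χH u ≠ 1 := fun h => ne_one hsurjH (hH _ h)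
    obtain ⟨l, hl⟩ := hj.exists_free_ker_of_free_ker hf hχ hsurjH hu E
    exact ⟨l, χH, hsurjH, hl⟩
  · rintro ⟨l, χH, hsurjH, ⟨E⟩⟩
    have hu : χH u ≠ 1 := fun h => ne_one hsurjH (hH _ h)
    obtain ⟨χ, hχj, hχx⟩ := hj.exists_lift (χH ^ e) (χH u) (by simp)
    have hne : χ ≠ 1 := by
      rintro rfl
      exact hu hχx.symm
    obtain ⟨d, χG, hd, hsurjG, hχ⟩ := χ.exists_surjective_zpow_eq hne
    have hx : χG x ≠ 1 := fun h => ne_one hsurjG (hG _ h)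
    obtain ⟨a, ha⟩ := hsurjH (Multiplicative.ofAdd 1)
    obtain ⟨f, hf⟩ : ∃ f : ℤ, f = (χG (j a)).toAdd := ⟨_, rfl⟩
    have hdf : d * f = e := by
      have := congrArg Multiplicative.toAdd ((hχ (j a)).symm.trans (hχj a))
      simpa [ha, hf] using this
    have hχf : ∀ h, χG (j h) = χH h ^ f := by
      intro h
      have := congrArg Multiplicative.toAdd ((hχ (j h)).symm.trans (hχj h))
      apply Multiplicative.toAdd.injective
      refine mul_left_cancel₀ hd ?_
      simp only [toAdd_zpow, smul_eq_mul, MonoidHom.pow_apply, toAdd_pow, nsmul_eq_mul] at this ⊢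
      rw [this, ← mul_assoc, hdf]
    have hf0 : f ≠ 0 := by
      rintro rfl
      exact he (by exact_mod_cast (by simpa using hdf.symm : (e : ℤ) = 0))
    obtain ⟨k, hk⟩ := hj.exists_free_ker_of_free_ker_base hf0 hχf hsurjH hsurjG hu hx E
    exact ⟨k, χG, hsurjG, hk⟩

end IsRootAdjunction

/-- A homomorphism to a commutative group killing the first generator factors through the
exponent sum of the second. -/
theorem FreeGroup.map_eq_zpow_exponentSum {M : Type*} [CommGroup M] (φ : FreeGroup (Fin 2) →* M)
    (h0 : φ (FreeGroup.of 0) = 1) (w : FreeGroup (Fin 2)) :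
    φ w = φ (FreeGroup.of 1) ^ (FreeGroup.lift
      (fun i : Fin 2 => Multiplicative.ofAdd (if i = 1 then (1 : ℤ) else 0)) w).toAdd := by
  have : φ = (zpowersHom M (φ (FreeGroup.of 1))).comp (FreeGroup.lift
      (fun i : Fin 2 => Multiplicative.ofAdd (if i = 1 then (1 : ℤ) else 0))) := by
    ext i
    fin_cases i <;> simp [h0]
  conv_lhs => rw [this]
  simp

theorem PresentedGroup.eq_one_of_exponentSum_ne_zero (w : FreeGroup (Fin 2))
    (hw : Multiplicative.toAdd (FreeGroup.lift
      (fun i : Fin 2 => Multiplicative.ofAdd (if i = 1 then (1 : ℤ) else 0)) w) ≠ 0)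
    (χ : PresentedGroup ({w} : Set (FreeGroup (Fin 2))) →* Multiplicative ℤ)
    (h0 : χ (PresentedGroup.of 0) = 1) : χ = 1 := by
  have h := FreeGroup.map_eq_zpow_exponentSum (χ.comp (PresentedGroup.mk {w})) h0 w
  have hw1 : PresentedGroup.mk {w} w = 1 := PresentedGroup.one_of_mem rfl
  rw [MonoidHom.comp_apply, hw1, map_one] at h
  have h1 := Multiplicative.int_zpow_eq_one hw h.symm
  ext i
  fin_cases i
  · simpa using h0
  · exact h1

theorem FreeGroup.lift_rootSubstitution {Q : Type*} [Group Q] (e : ℕ) (v : Fin 2 → Q)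
    (s : FreeGroup (Fin 2)) :
    FreeGroup.lift v (FreeGroup.lift (fun i : Fin 2 =>
      if i = 0 then FreeGroup.of (0 : Fin 2) ^ e else FreeGroup.of (1 : Fin 2)) s) =
    FreeGroup.lift ![v 0 ^ e, v 1] s := by
  rw [← MonoidHom.comp_apply]
  congr 1
  ext i
  fin_cases i <;> simp

/-- Substituting `x ^ e` for the first generator of a one-relator presentation adjoins an
`e`-th root. -/
theorem PresentedGroup.exists_isRootAdjunction (e : ℕ) (s : FreeGroup (Fin 2)) :
    ∃ j : PresentedGroup ({s} : Set (FreeGroup (Fin 2))) →*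
        PresentedGroup ({FreeGroup.lift (fun i : Fin 2 =>
          if i = 0 then FreeGroup.of (0 : Fin 2) ^ e else FreeGroup.of (1 : Fin 2)) s} :
            Set (FreeGroup (Fin 2))),
      IsRootAdjunction j (PresentedGroup.of 0) (PresentedGroup.of 0) e := by
  set r := FreeGroup.lift (fun i : Fin 2 =>
    if i = 0 then FreeGroup.of (0 : Fin 2) ^ e else FreeGroup.of (1 : Fin 2)) s
  have hlift : ∀ {Q : Type} [Group Q] (v : Fin 2 → Q),
      FreeGroup.lift v r = FreeGroup.lift ![v 0 ^ e, v 1] s := fun v =>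
    FreeGroup.lift_rootSubstitution e v s
  have hj : ∀ w ∈ ({s} : Set (FreeGroup (Fin 2))),
      FreeGroup.lift ![(PresentedGroup.of 0 : PresentedGroup {r}) ^ e, PresentedGroup.of 1] w =
        1 := by
    rintro w rfl
    rw [← hlift]
    have : FreeGroup.lift (PresentedGroup.of (rels := {r})) = PresentedGroup.mk {r} := by
      ext i
      simp [PresentedGroup.of]
    rw [this]
    exact PresentedGroup.one_of_mem rfl
  refine ⟨PresentedGroup.toGroup hj, by simp, ?_, ?_⟩
  · intro Q _ φ q hq
    have hΦ : ∀ w ∈ ({r} : Set (FreeGroup (Fin 2))),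
        FreeGroup.lift ![q, φ (PresentedGroup.of 1)] w = 1 := by
      rintro w rfl
      rw [hlift]
      have : FreeGroup.lift ![q ^ e, φ (PresentedGroup.of 1)] =
          φ.comp (PresentedGroup.mk {s}) := by
        ext i
        fin_cases i
        · simpa [PresentedGroup.of] using hq.symm
        · simp [PresentedGroup.of]
      simp only [Matrix.cons_val_zero, Matrix.cons_val_one]
      rw [this, MonoidHom.comp_apply, PresentedGroup.one_of_mem (Set.mem_singleton s), map_one]
    refine ⟨PresentedGroup.toGroup hΦ, fun h => ?_, by simp⟩
    rw [← MonoidHom.comp_apply]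
    congr 1
    ext i
    fin_cases i
    · simp [hq]
    · simp
  · intro Q _ Φ Ψ h hx
    ext i
    fin_cases i
    · exact hx
    · simpa using h (PresentedGroup.of 1)

/-- Let `s ∈ F(u,y)`, let `e > 0`, and let `r = s(xᵉ, y)` be the image of `s`
under the endomorphism of the free group on two generators sending the first generator to the
`e`-th power of the first generator and fixing the second.  If the exponent sum of `r` with
respect to the second generator `y` is nonzero, then `G = ⟨x, y | r⟩` is an infinite cyclic
extension of a free group of finite rank if and only if `H = ⟨u, y | s⟩` is. -/
theorem stmt_17 (e : ℕ) (he : 0 < e) (s r : FreeGroup (Fin 2))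
    (hr : r = FreeGroup.lift
      (fun i : Fin 2 => if i = 0 then FreeGroup.of (0 : Fin 2) ^ e else FreeGroup.of (1 : Fin 2)) s)
    (hq : Multiplicative.toAdd
      (FreeGroup.lift (fun i : Fin 2 => Multiplicative.ofAdd (if i = 1 then (1 : ℤ) else 0)) r) ≠ 0) :
    (∃ k : ℕ, IsInfCyclicExtOfFreeRank (PresentedGroup ({r} : Set (FreeGroup (Fin 2)))) k) ↔
    (∃ l : ℕ, IsInfCyclicExtOfFreeRank (PresentedGroup ({s} : Set (FreeGroup (Fin 2)))) l) := by
  have hs : Multiplicative.toAdd (FreeGroup.lift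
      (fun i : Fin 2 => Multiplicative.ofAdd (if i = 1 then (1 : ℤ) else 0)) s) ≠ 0 := by
    have : (FreeGroup.lift
        (fun i : Fin 2 => Multiplicative.ofAdd (if i = 1 then (1 : ℤ) else 0))) r =
        FreeGroup.lift
          (fun i : Fin 2 => Multiplicative.ofAdd (if i = 1 then (1 : ℤ) else 0)) s := by
      rw [hr, FreeGroup.lift_rootSubstitution]
      congr 2
      ext i
      fin_cases i <;> simp
    rwa [this] at hq
  subst hr
  obtain ⟨j, hj⟩ := PresentedGroup.exists_isRootAdjunction e s
  exact hj.exists_isInfCyclicExtOfFreeRank_iff he.ne'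
    (PresentedGroup.eq_one_of_exponentSum_ne_zero _ hq)
    (PresentedGroup.eq_one_of_exponentSum_ne_zero _ hs)
end

section
/- Let s be an element of the free group F(u,y) on two generators, let e be a positive integer, and let r = s(xᵉ, y) ∈ F(x,y) be the image of s under the endomorphism sending u to xᵉ and fixing y. Let G = ⟨x, y | r⟩ and H = ⟨u, y | s⟩ be the corresponding one-relator presented groups. Let p and q be the exponent sums of r with respect to x and y respectively, suppose q ≠ 0, let m = gcd(p, q), and let a = p/m and b = q/m. If G is an infinite cyclic extension of a free group of finite rank k and H is an infinite cyclic extension of a free group of finite rank ℓ, then k = 1 + gcd(a, e)·(ℓ − 1) + |b|·(e − 1). -/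
/-- The exponent sum of a word in the free group on two generators with respect to the
generator `j`. -/
def expSum (j : Fin 2) (w : FreeGroup (Fin 2)) : ℤ :=
  Multiplicative.toAdd
    (FreeGroup.lift (fun i : Fin 2 => Multiplicative.ofAdd (if i = j then (1 : ℤ) else 0)) w)

/-- A crossed homomorphism from `G` to the module of functions `ℤ → ℚ`, on which `G` acts by
translations through `φ`. -/
def IsCrossedHom {G : Type*} [Group G] (φ : G →* Multiplicative ℤ) (d : G → ℤ → ℚ) : Prop :=
  ∀ g h j, d (g * h) j = d g j + d h (j + (φ g).toAdd)

/-- The space of crossed homomorphisms from `G` to the module of functions `ℤ → ℚ`, on which `G`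
acts by translations through `φ`, that vanish on `x`. -/
def crossedHoms {G : Type*} [Group G] (φ : G →* Multiplicative ℤ) (x : G) :
    Submodule ℚ (G → ℤ → ℚ) where
  carrier := {d | IsCrossedHom φ d ∧ ∀ j, d x j = 0}
  add_mem' := by
    rintro c d ⟨hc, hcx⟩ ⟨hd, hdx⟩
    refine ⟨fun g h j => ?_, fun j => ?_⟩
    · simp only [Pi.add_apply, hc g h j, hd g h j]; ring
    · simp [hcx, hdx]
  zero_mem' := by simp [IsCrossedHom]
  smul_mem' := by
    rintro c d ⟨hd, hdx⟩
    refine ⟨fun g h j => ?_, fun j => ?_⟩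
    · simp only [Pi.smul_apply, smul_eq_mul, hd g h j]; ring
    · simp [hdx]

/-- The space of functions `ℤ → ℚ` with period `b`. -/
def periodicFunctions (b : ℤ) : Submodule ℚ (ℤ → ℚ) where
  carrier := {f | ∀ j, f (j + b) = f j}
  add_mem' := by
    intro f g hf hg j
    simp [hf j, hg j]
  zero_mem' := by simp
  smul_mem' := by
    intro c f hf j
    simp [hf j]

theorem add_mul_emod_of_fin {b : ℤ} (i : Fin b.natAbs) (j : ℤ) :
    ((i : ℕ) + b * j) % b = (i : ℕ) := by
  rw [Int.add_mul_emod_self_left, ← Int.emod_abs]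
  exact Int.emod_eq_of_lt (by omega) (by have := i.2; rw [Int.abs_eq_natAbs]; omega)

theorem add_mul_ediv_of_fin {b : ℤ} (i : Fin b.natAbs) (j : ℤ) :
    ((i : ℕ) + b * j) / b = j := by
  have hb : b ≠ 0 := by have := i.2; omega
  have h1 := Int.emod_add_mul_ediv ((i : ℕ) + b * j) b
  rw [add_mul_emod_of_fin] at h1
  exact mul_left_cancel₀ hb (by linarith)

/-- The remainder of `n` modulo a nonzero integer `b`, as an element of `Fin |b|`. -/
def finRem {b : ℤ} (hb : b ≠ 0) (n : ℤ) : Fin b.natAbs :=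
  ⟨(n % b).toNat, by
    have h1 := Int.emod_nonneg n hb
    have h2 := Int.emod_lt_abs n hb
    rw [Int.abs_eq_natAbs] at h2
    omega⟩

theorem finRem_coe {b : ℤ} (hb : b ≠ 0) (n : ℤ) : ((finRem hb n : ℕ) : ℤ) = n % b :=
  Int.toNat_of_nonneg (Int.emod_nonneg n hb)

theorem finRem_add_mul_ediv {b : ℤ} (hb : b ≠ 0) (n : ℤ) :
    ((finRem hb n : ℕ) : ℤ) + b * (n / b) = n := by
  rw [finRem_coe]
  exact Int.emod_add_mul_ediv n b

theorem finRem_add_mul {b : ℤ} (hb : b ≠ 0) (i : Fin b.natAbs) (j : ℤ) :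
    finRem hb ((i : ℕ) + b * j) = i := by
  apply Fin.ext
  have := finRem_coe hb ((i : ℕ) + b * j)
  rw [add_mul_emod_of_fin] at this
  exact_mod_cast this

theorem periodicFunctions.apply_add_mul {b : ℤ} {f : ℤ → ℚ} (hf : f ∈ periodicFunctions b)
    (i n : ℤ) : f (i + b * n) = f i := by
  induction n using Int.induction_on with
  | zero => simp
  | succ n ih => rw [mul_add, mul_one, ← add_assoc]; exact (hf _).trans ih
  | pred n ih =>
    rw [← ih, ← hf (i + b * (-n - 1))]
    congr 1
    ring

/-- A periodic function amounts to its values on a fundamental domain. -/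
def periodicFunctionsEquiv {b : ℤ} (hb : b ≠ 0) :
    periodicFunctions b ≃ₗ[ℚ] (Fin b.natAbs → ℚ) where
  toFun f i := f.1 (i : ℕ)
  map_add' _ _ := rfl
  map_smul' _ _ := rfl
  invFun v := ⟨fun n => v (finRem hb n), fun j => by
    refine congrArg v (Fin.ext ?_)
    have h1 := finRem_coe hb j
    have h2 := finRem_coe hb (j + b)
    rw [Int.add_emod_right] at h2
    exact_mod_cast h2.trans h1.symm⟩
  left_inv f := by
    ext n
    have h := periodicFunctions.apply_add_mul f.2 (finRem hb n : ℕ) (n / b)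
    rw [finRem_add_mul_ediv] at h
    exact h.symm
  right_inv v := by
    ext i
    have h := finRem_add_mul hb i 0
    rw [mul_zero, add_zero] at h
    exact congrArg v h

theorem exists_forward_difference_eq (v : ℤ → ℚ) : ∃ f : ℤ → ℚ, ∀ j, f (j + 1) - f j = v j := by
  refine ⟨fun n => ∑ i ∈ Finset.range n.toNat, v i
    - ∑ i ∈ Finset.range (-n).toNat, v (-(i : ℤ) - 1), fun j => ?_⟩
  rcases le_or_gt 0 j with hj | hj
  · obtain ⟨n, rfl⟩ := Int.eq_ofNat_of_zero_le hj
    have h1 : ((n : ℤ) + 1).toNat = n + 1 := by omega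
    have h2 : (-((n : ℤ) + 1)).toNat = 0 := by omega
    have h3 : (-(n : ℤ)).toNat = 0 := by omega
    simp only [h1, h2, h3, Finset.sum_range_succ]
    simp
  · obtain ⟨n, rfl⟩ : ∃ n : ℕ, j = -(n : ℤ) - 1 := ⟨(-j - 1).toNat, by omega⟩
    have h1 : (-(n : ℤ) - 1 + 1).toNat = 0 := by omega
    have h2 : (-(-(n : ℤ) - 1)).toNat = n + 1 := by omega
    have h3 : (-(n : ℤ) - 1).toNat = 0 := by omega
    have h4 : (-(-(n : ℤ) - 1 + 1)).toNat = n := by omega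
    simp only [h1, h2, h3, h4, Finset.sum_range_succ]
    ring

theorem exists_difference_eq {b : ℤ} (hb : b ≠ 0) (v : ℤ → ℚ) :
    ∃ f : ℤ → ℚ, ∀ j, f (j + b) - f j = v j := by
  choose F hF using fun i : Fin b.natAbs =>
    exists_forward_difference_eq fun j => v ((i : ℕ) + b * j)
  refine ⟨fun n => F (finRem hb n) (n / b), fun n => ?_⟩
  obtain ⟨i, j, rfl⟩ : ∃ (i : Fin b.natAbs) (j : ℤ), n = (i : ℕ) + b * j :=
    ⟨_, _, (finRem_add_mul_ediv hb n).symm⟩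
  have h : ((i : ℕ) : ℤ) + b * j + b = (i : ℕ) + b * (j + 1) := by ring
  simp only [h, finRem_add_mul, add_mul_ediv_of_fin]
  exact hF i j

section

variable {G : Type*} [Group G] {φ : G →* Multiplicative ℤ} {x : G}

theorem IsCrossedHom.map_one {d : G → ℤ → ℚ} (hd : IsCrossedHom φ d) (j : ℤ) : d 1 j = 0 := by
  have := hd 1 1 j
  simpa using this

theorem IsCrossedHom.map_inv {d : G → ℤ → ℚ} (hd : IsCrossedHom φ d) (g : G) (j : ℤ) :
    d g⁻¹ j = -d g (j - (φ g).toAdd) := by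
  have := hd g g⁻¹ (j - (φ g).toAdd)
  rw [mul_inv_cancel, hd.map_one, sub_add_cancel] at this
  linarith

theorem IsCrossedHom.comp {G' : Type*} [Group G'] {d : G → ℤ → ℚ} (hd : IsCrossedHom φ d)
    (f : G' →* G) : IsCrossedHom (φ.comp f) fun g => d (f g) := by
  intro g h j
  simp [hd _ _ j]

theorem IsCrossedHom.map_pow_eq_zero {d : G → ℤ → ℚ} (hd : IsCrossedHom φ d) {g : G}
    (hg : ∀ j, d g j = 0) (n : ℕ) (j : ℤ) : d (g ^ n) j = 0 := by
  induction n with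
  | zero => simp [hd.map_one]
  | succ n ih => rw [pow_succ, hd, ih, hg, add_zero]

theorem IsCrossedHom.freeGroup_ext {α : Type*} {ψ : FreeGroup α →* Multiplicative ℤ}
    {d d' : FreeGroup α → ℤ → ℚ} (hd : IsCrossedHom ψ d) (hd' : IsCrossedHom ψ d')
    (h : ∀ i j, d (FreeGroup.of i) j = d' (FreeGroup.of i) j) (w : FreeGroup α) (j : ℤ) :
    d w j = d' w j := by
  induction w using FreeGroup.induction_on generalizing j with
  | C1 => rw [hd.map_one, hd'.map_one]
  | of i => exact h i j
  | inv_of i _ => rw [hd.map_inv, hd'.map_inv, h]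
  | mul v w hv hw => rw [hd, hd', hv, hw]

/-- A periodic function defines an inner crossed homomorphism. -/
def innerCrossedHom (φ : G →* Multiplicative ℤ) (x : G) :
    periodicFunctions (φ x).toAdd →ₗ[ℚ] crossedHoms φ x where
  toFun f := ⟨fun g j => f.1 (j + (φ g).toAdd) - f.1 j, fun g h j => by
    simp only [map_mul, toAdd_mul, ← add_assoc]
    ring, fun j => sub_eq_zero.2 (f.2 j)⟩
  map_add' f g := by
    ext
    simp only [Submodule.coe_add, Pi.add_apply]
    ring
  map_smul' c f := by
    ext
    simp [mul_sub]

/-- The restriction of a crossed homomorphism to finitely many elements, evaluated at `0`. -/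
def crossedHomEval {k : ℕ} (φ : G →* Multiplicative ℤ) (x : G) (n : Fin k → G) :
    crossedHoms φ x →ₗ[ℚ] (Fin k → ℚ) where
  toFun d i := d.1 (n i) 0
  map_add' _ _ := rfl
  map_smul' _ _ := rfl

theorem finrank_ker_innerCrossedHom (hφ : Function.Surjective φ) :
    Module.finrank ℚ (LinearMap.ker (innerCrossedHom φ x)) = 1 := by
  have hone : (fun _ => 1 : ℤ → ℚ) ∈ periodicFunctions (φ x).toAdd := fun _ => rfl
  have : LinearMap.ker (innerCrossedHom φ x)
      = Submodule.span ℚ {(⟨_, hone⟩ : periodicFunctions (φ x).toAdd)} := by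
    ext f
    rw [LinearMap.mem_ker, Submodule.mem_span_singleton]
    constructor
    · intro h
      refine ⟨f.1 0, ?_⟩
      ext j
      obtain ⟨g, hg⟩ := hφ (Multiplicative.ofAdd j)
      have h1 := congrFun (congrFun (congrArg Subtype.val h) g) 0
      have h2 : f.1 (0 + (φ g).toAdd) - f.1 0 = 0 := h1
      rw [hg, toAdd_ofAdd, zero_add] at h2
      simpa using (sub_eq_zero.1 h2).symm
    · rintro ⟨c, rfl⟩
      ext g j
      simp [innerCrossedHom]
  rw [this]
  apply finrank_span_singleton
  intro h
  have := congrFun (congrArg Subtype.val h) 0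
  simp at this

variable {k : ℕ}

theorem crossedHomEval_surjective (β : FreeGroup (Fin k) ≃* φ.ker)
    (hφ : Function.Surjective φ) (hx : (φ x).toAdd ≠ 0) :
    Function.Surjective (crossedHomEval φ x fun i => (β (FreeGroup.of i) : G)) := by
  intro v
  obtain ⟨t, ht⟩ := hφ (Multiplicative.ofAdd 1)
  have htj (j : ℤ) : φ (t ^ j) = Multiplicative.ofAdd j := by
    rw [map_zpow, ht, ← ofAdd_zsmul]; simp
  let h : φ.ker →* Multiplicative ℚ :=
    (FreeGroup.lift fun i => Multiplicative.ofAdd (v i)).comp β.symm.toMonoidHom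
  let c (g : G) (j : ℤ) : φ.ker := ⟨t ^ j * g * t ^ (-(j + (φ g).toAdd)), by
    rw [MonoidHom.mem_ker, map_mul, map_mul, htj, htj]
    apply Multiplicative.toAdd.injective
    simp⟩
  have hc (g g' : G) (j : ℤ) : c (g * g') j = c g j * c g' (j + (φ g).toAdd) := by
    apply Subtype.ext
    simp only [c, Subgroup.coe_mul, map_mul, toAdd_mul, zpow_neg, add_assoc]
    group
  obtain ⟨f, hf⟩ := exists_difference_eq hx fun j => (h (c x j)).toAdd
  refine ⟨⟨fun g j => (h (c g j)).toAdd - (f (j + (φ g).toAdd) - f j), fun g g' j => ?_,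
    fun j => ?_⟩, ?_⟩
  · simp only [hc, map_mul, toAdd_mul, ← add_assoc]
    ring
  · exact sub_eq_zero.2 (hf j).symm
  · ext i
    have hi : φ (β (FreeGroup.of i) : G) = 1 := (β (FreeGroup.of i)).2
    have hci : c (β (FreeGroup.of i)) 0 = β (FreeGroup.of i) := by
      apply Subtype.ext
      simp [c, hi]
    simp [crossedHomEval, hci, hi, h]

theorem ker_crossedHomEval (β : FreeGroup (Fin k) ≃* φ.ker)
    (hφ : Function.Surjective φ) :
    LinearMap.ker (crossedHomEval φ x fun i => (β (FreeGroup.of i) : G))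
      = LinearMap.range (innerCrossedHom φ x) := by
  ext d
  rw [LinearMap.mem_ker, LinearMap.mem_range]
  constructor
  · intro h
    let F : φ.ker →* Multiplicative ℚ :=
      { toFun := fun n => Multiplicative.ofAdd (d.1 n 0)
        map_one' := by simp [d.2.1.map_one]
        map_mul' := fun n n' => by
          have hn : φ n = 1 := n.2
          simp [d.2.1 n n' 0, hn] }
    have hF : F.comp β.toMonoidHom = 1 := by
      apply FreeGroup.ext_hom
      intro i
      exact congrArg Multiplicative.ofAdd (congrFun h i)
    have hker (n : G) (hn : φ n = 1) : d.1 n 0 = 0 := by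
      have := DFunLike.congr_fun hF (β.symm ⟨n, hn⟩)
      simpa [F] using this
    obtain ⟨t, ht⟩ := hφ (Multiplicative.ofAdd 1)
    have htj (j : ℤ) : φ (t ^ j) = Multiplicative.ofAdd j := by
      rw [map_zpow, ht, ← ofAdd_zsmul]; simp
    have key (g : G) (j : ℤ) :
        d.1 (t ^ (j + (φ g).toAdd)) 0 - d.1 (t ^ j) 0 = d.1 g j := by
      have hn : φ (t ^ j * g * t ^ (-(j + (φ g).toAdd))) = 1 := by
        rw [map_mul, map_mul, htj, htj]
        apply Multiplicative.toAdd.injective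
        simp
      have h1 := d.2.1 (t ^ j) g 0
      have h2 := d.2.1 (t ^ j * g * t ^ (-(j + (φ g).toAdd))) (t ^ (j + (φ g).toAdd)) 0
      rw [hker _ hn, hn, zpow_neg, inv_mul_cancel_right, h1, htj] at h2
      simp only [toAdd_ofAdd, toAdd_one, zero_add, add_zero] at h2
      rw [← h2]
      ring
    refine ⟨⟨fun j => d.1 (t ^ j) 0, fun j => ?_⟩, ?_⟩
    · exact sub_eq_zero.1 ((key x j).trans (d.2.2 j))
    · ext g j
      exact key g j
  · rintro ⟨f, rfl⟩
    ext i
    have hi : φ (β (FreeGroup.of i) : G) = 1 := (β (FreeGroup.of i)).2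
    simp [crossedHomEval, innerCrossedHom, hi]

theorem finite_and_finrank_crossedHoms (β : FreeGroup (Fin k) ≃* φ.ker)
    (hφ : Function.Surjective φ) (hx : (φ x).toAdd ≠ 0) :
    Module.Finite ℚ (crossedHoms φ x) ∧
      Module.finrank ℚ (crossedHoms φ x) + 1 = k + (φ x).toAdd.natAbs := by
  let E := crossedHomEval φ x fun i => (β (FreeGroup.of i) : G)
  have hE : Function.Surjective E := crossedHomEval_surjective β hφ hx
  have hk : LinearMap.ker E = _ := ker_crossedHomEval β hφ
  have : Module.Finite ℚ (periodicFunctions (φ x).toAdd) :=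
    Module.Finite.equiv (periodicFunctionsEquiv hx).symm
  have : Module.Finite ℚ (LinearMap.ker E) := by
    rw [hk]
    infer_instance
  have : Module.Finite ℚ (crossedHoms φ x ⧸ LinearMap.ker E) :=
    Module.Finite.equiv (E.quotKerEquivOfSurjective hE).symm
  have : Module.Finite ℚ (crossedHoms φ x) :=
    Module.Finite.of_submodule_quotient (LinearMap.ker E)
  refine ⟨this, ?_⟩
  have h1 := LinearMap.finrank_range_add_finrank_ker E
  have h2 := LinearMap.finrank_range_add_finrank_ker (innerCrossedHom φ x)
  rw [LinearMap.range_eq_top.2 hE, finrank_top, hk, Module.finrank_fin_fun] at h1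
  rw [finrank_ker_innerCrossedHom hφ, (periodicFunctionsEquiv hx).finrank_eq,
    Module.finrank_fin_fun] at h2
  omega

end

/-- The wreath product of `ℚ` with `ℤ`, without support condition. -/
structure FunWreath where
  /-- The component in the base group. -/
  base : ℤ → ℚ
  /-- The translation. -/
  shift : ℤ

namespace FunWreath

instance : Mul FunWreath :=
  ⟨fun v w => ⟨fun j => v.base j + w.base (j + v.shift), v.shift + w.shift⟩⟩

instance : One FunWreath := ⟨⟨fun _ => 0, 0⟩⟩

instance : Inv FunWreath := ⟨fun v => ⟨fun j => -v.base (j - v.shift), -v.shift⟩⟩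

theorem mul_def (v w : FunWreath) :
    v * w = ⟨fun j => v.base j + w.base (j + v.shift), v.shift + w.shift⟩ := rfl

theorem one_def : (1 : FunWreath) = ⟨fun _ => 0, 0⟩ := rfl

theorem inv_def (v : FunWreath) : v⁻¹ = ⟨fun j => -v.base (j - v.shift), -v.shift⟩ := rfl

instance : Group FunWreath :=
  Group.ofLeftAxioms
    (fun u v w => by simp only [mul_def, add_assoc])
    (fun v => by simp [mul_def, one_def])
    (fun v => by simp [mul_def, one_def, inv_def, ← sub_eq_add_neg])

end FunWreath

/-- The projection to the group of translations. -/
def FunWreath.shiftHom : FunWreath →* Multiplicative ℤ where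
  toFun v := Multiplicative.ofAdd v.shift
  map_one' := rfl
  map_mul' _ _ := rfl

/-- A crossed homomorphism as a homomorphism to a wreath product. -/
def IsCrossedHom.toFunWreath {G : Type*} [Group G] {φ : G →* Multiplicative ℤ} {d : G → ℤ → ℚ}
    (hd : IsCrossedHom φ d) : G →* FunWreath where
  toFun g := ⟨d g, (φ g).toAdd⟩
  map_one' := by
    rw [FunWreath.one_def, FunWreath.mk.injEq]
    exact ⟨funext hd.map_one, by simp⟩
  map_mul' g h := by
    rw [FunWreath.mul_def, FunWreath.mk.injEq]
    exact ⟨funext (hd g h), by simp⟩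

theorem isCrossedHom_of_funWreath {G : Type*} [Group G] {φ : G →* Multiplicative ℤ}
    (Θ : G →* FunWreath) (h : FunWreath.shiftHom.comp Θ = φ) :
    IsCrossedHom φ fun g => (Θ g).base := by
  subst h
  intro g g' j
  simp only [map_mul]
  rfl

theorem exists_isCrossedHom_freeGroup {α : Type*} (ψ : FreeGroup α →* Multiplicative ℤ)
    (v : α → ℤ → ℚ) : ∃ d, IsCrossedHom ψ d ∧ ∀ i, d (FreeGroup.of i) = v i := by
  refine ⟨_, isCrossedHom_of_funWreath
    (FreeGroup.lift fun i => ⟨v i, (ψ (FreeGroup.of i)).toAdd⟩) ?_, fun i => ?_⟩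
  · apply FreeGroup.ext_hom
    intro i
    simp [FunWreath.shiftHom]
  · simp

theorem IsCrossedHom.exists_presentedGroup {α : Type*} {r : FreeGroup α}
    {φ : PresentedGroup {r} →* Multiplicative ℤ} {d : FreeGroup α → ℤ → ℚ}
    (hd : IsCrossedHom (φ.comp (PresentedGroup.mk {r})) d) (hr : ∀ j, d r j = 0) :
    ∃ d', IsCrossedHom φ d' ∧ ∀ w, d' (PresentedGroup.mk {r} w) = d w := by
  have hle : Subgroup.normalClosure {r} ≤ hd.toFunWreath.ker := by
    apply Subgroup.normalClosure_le_normal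
    rw [Set.singleton_subset_iff, SetLike.mem_coe, MonoidHom.mem_ker]
    change (⟨d r, _⟩ : FunWreath) = _
    rw [FunWreath.one_def, FunWreath.mk.injEq]
    refine ⟨funext hr, ?_⟩
    rw [MonoidHom.comp_apply, PresentedGroup.one_of_mem (Set.mem_singleton _), _root_.map_one,
      toAdd_one]
  refine ⟨_, isCrossedHom_of_funWreath
    (QuotientGroup.lift (Subgroup.normalClosure {r}) hd.toFunWreath hle) ?_, fun w => rfl⟩
  refine MonoidHom.ext fun g => ?_
  obtain ⟨w, rfl⟩ := PresentedGroup.mk_surjective {r} g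
  rfl

section

variable {r s : FreeGroup (Fin 2)} {φ : PresentedGroup {r} →* Multiplicative ℤ}
  {ψ : PresentedGroup {s} →* Multiplicative ℤ} {J : PresentedGroup {s} →* PresentedGroup {r}}
  {c : ℤ} {e : ℕ}

/-- Pulling back a crossed homomorphism and restricting it to the residue classes modulo `c`. -/
def crossedHomsResidues (hJ : ∀ h, (φ (J h)).toAdd = c * (ψ h).toAdd)
    (hJ0 : J (PresentedGroup.of 0) = PresentedGroup.of 0 ^ e) :
    crossedHoms φ (PresentedGroup.of 0) →ₗ[ℚ]
      (Fin c.natAbs → crossedHoms ψ (PresentedGroup.of 0)) where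
  toFun d i := ⟨fun h j => d.1 (J h) ((i : ℕ) + c * j), fun g h j => by
    simp only [map_mul, d.2.1 _ _ _, hJ, mul_add, add_assoc], fun j => by
    simp only [hJ0, d.2.1.map_pow_eq_zero d.2.2]⟩
  map_add' _ _ := rfl
  map_smul' _ _ := rfl

theorem crossedHomsResidues_bijective (hJ : ∀ h, (φ (J h)).toAdd = c * (ψ h).toAdd)
    (hJ0 : J (PresentedGroup.of 0) = PresentedGroup.of 0 ^ e)
    (hJ1 : J (PresentedGroup.of 1) = PresentedGroup.of 1) (hc : c ≠ 0)
    {ι : FreeGroup (Fin 2) →* FreeGroup (Fin 2)} (hι : ι s = r)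
    (hι0 : ι (FreeGroup.of 0) = FreeGroup.of 0 ^ e) (hι1 : ι (FreeGroup.of 1) = FreeGroup.of 1)
    (hJι : ∀ w, J (PresentedGroup.mk {s} w) = PresentedGroup.mk {r} (ι w)) :
    Function.Bijective (crossedHomsResidues hJ hJ0) := by
  constructor
  · rw [← LinearMap.ker_eq_bot, LinearMap.ker_eq_bot']
    intro d hd
    ext g j
    obtain ⟨w, rfl⟩ := PresentedGroup.mk_surjective {r} g
    have hz : IsCrossedHom (φ.comp (PresentedGroup.mk {r})) fun _ _ => 0 := by
      simp [IsCrossedHom]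
    refine (d.2.1.comp (PresentedGroup.mk {r})).freeGroup_ext hz (fun i j => ?_) w j
    fin_cases i
    · exact d.2.2 j
    · have h1 := congrFun (congrFun (congrArg Subtype.val (congrFun hd (finRem hc j)))
        (PresentedGroup.of 1)) (j / c)
      change d.1 (J (PresentedGroup.of 1)) ((finRem hc j : ℕ) + c * (j / c)) = 0 at h1
      rwa [hJ1, finRem_add_mul_ediv] at h1
  · intro v
    obtain ⟨D, hD, hDv⟩ := exists_isCrossedHom_freeGroup (φ.comp (PresentedGroup.mk {r}))
      ![0, fun n => (v (finRem hc n)).1 (PresentedGroup.of 1) (n / c)]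
    have hD0 (j : ℤ) : D (FreeGroup.of 0) j = 0 := congrFun (hDv 0) j
    have key (i : Fin c.natAbs) (w : FreeGroup (Fin 2)) (j : ℤ) :
        D (ι w) ((i : ℕ) + c * j) = (v i).1 (PresentedGroup.mk {s} w) j := by
      have hDι : IsCrossedHom (ψ.comp (PresentedGroup.mk {s}))
          fun w j => D (ι w) ((i : ℕ) + c * j) := by
        intro w w' j
        simp only [map_mul, hD _ _ _, MonoidHom.comp_apply, ← hJι, hJ, mul_add, add_assoc]
      refine hDι.freeGroup_ext ((v i).2.1.comp (PresentedGroup.mk {s})) (fun n j => ?_) w j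
      fin_cases n
      · change D (ι (FreeGroup.of 0)) _ = (v i).1 (PresentedGroup.of 0) j
        rw [hι0, hD.map_pow_eq_zero hD0, (v i).2.2]
      · change D (ι (FreeGroup.of 1)) _ = (v i).1 (PresentedGroup.of 1) j
        rw [hι1, hDv]
        simp [finRem_add_mul, add_mul_ediv_of_fin]
    obtain ⟨d, hd, hdD⟩ := hD.exists_presentedGroup fun j => by
      rw [← finRem_add_mul_ediv hc j, ← hι, key, PresentedGroup.one_of_mem (Set.mem_singleton _)]
      exact (v _).2.1.map_one _
    refine ⟨⟨d, hd, fun j => ?_⟩, ?_⟩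
    · exact (congrFun (hdD (FreeGroup.of 0)) j).trans (hD0 j)
    · ext i g j
      obtain ⟨w, rfl⟩ := PresentedGroup.mk_surjective {s} g
      change d (J _) _ = _
      rw [hJι, hdD, key]

end

theorem toAdd_eq_expSum (f : FreeGroup (Fin 2) →* Multiplicative ℤ) (w : FreeGroup (Fin 2)) :
    (f w).toAdd = expSum 0 w * (f (FreeGroup.of 0)).toAdd
      + expSum 1 w * (f (FreeGroup.of 1)).toAdd := by
  induction w using FreeGroup.induction_on with
  | C1 => simp [expSum]
  | of i => fin_cases i <;> simp [expSum]
  | inv_of i _ => fin_cases i <;> simp [expSum]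
  | mul v w hv hw =>
    have h (j : Fin 2) : expSum j (v * w) = expSum j v + expSum j w := by simp [expSum]
    rw [map_mul, toAdd_mul, hv, hw, h, h]
    ring

theorem IsInfCyclicExtOfFreeRank.exists_hom {G : Type*} [Group G] {k : ℕ}
    (h : IsInfCyclicExtOfFreeRank G k) : ∃ φ : G →* Multiplicative ℤ, Function.Surjective φ ∧
      Nonempty (FreeGroup (Fin k) ≃* φ.ker) := by
  obtain ⟨N, hN, ⟨β⟩, ⟨γ⟩⟩ := h
  have hker : (γ.toMonoidHom.comp (QuotientGroup.mk' N)).ker = N := by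
    ext g
    simp
  exact ⟨γ.toMonoidHom.comp (QuotientGroup.mk' N),
    γ.surjective.comp (QuotientGroup.mk'_surjective N),
    ⟨β.symm.trans (MulEquiv.subgroupCongr hker.symm)⟩⟩

theorem PresentedGroup.isCoprime_of_surjective {rels : Set (FreeGroup (Fin 2))}
    {φ : PresentedGroup rels →* Multiplicative ℤ} (hφ : Function.Surjective φ) :
    IsCoprime (φ (PresentedGroup.of 0)).toAdd (φ (PresentedGroup.of 1)).toAdd := by
  obtain ⟨g, hg⟩ := hφ (Multiplicative.ofAdd 1)
  obtain ⟨w, rfl⟩ := PresentedGroup.mk_surjective rels g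
  refine ⟨expSum 0 w, expSum 1 w, ?_⟩
  have := toAdd_eq_expSum (φ.comp (PresentedGroup.mk rels)) w
  rw [MonoidHom.comp_apply, hg] at this
  exact this.symm

theorem natAbs_eq_of_mul_add_mul_eq_zero {a b x y : ℤ} (hab : IsCoprime a b) (hxy : IsCoprime x y)
    (h : a * x + b * y = 0) : y.natAbs = a.natAbs := by
  apply Int.natAbs_eq_of_dvd_dvd
  · exact hxy.symm.dvd_of_dvd_mul_right ⟨-b, by linarith⟩
  · exact hab.dvd_of_dvd_mul_left ⟨-x, by linarith⟩

theorem exists_eq_mul_of_mul_add_mul_eq_zero {p q x y x' y' : ℤ} (hq : q ≠ 0)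
    (hxy : IsCoprime x' y') (h : p * x + q * y = 0) (h' : p * x' + q * y' = 0) :
    ∃ c, x = c * x' ∧ y = c * y' := by
  obtain ⟨u, v, huv⟩ := hxy
  have hcross : y * x' = x * y' := mul_left_cancel₀ hq (by linear_combination x' * h - x * h')
  exact ⟨u * x + v * y, by linear_combination (-x) * huv - v * hcross,
    by linear_combination (-y) * huv + u * hcross⟩

/-- Let `s ∈ F(u,y)`, `e > 0`, and `r = s(xᵉ, y)`.  Let `p`, `q` be the
exponent sums of `r` with respect to `x`, `y`, suppose `q ≠ 0`, let `m = gcd(p,q)`, `a = p/m`,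
`b = q/m`.  If `G = ⟨x, y | r⟩` is an infinite cyclic extension of a free group of finite rank
`k` and `H = ⟨u, y | s⟩` is an infinite cyclic extension of a free group of finite rank `ℓ`,
then `k = 1 + gcd(a,e)·(ℓ − 1) + |b|·(e − 1)`. -/
theorem stmt_18 (e : ℕ) (he : 0 < e) (s r : FreeGroup (Fin 2))
    (hr : r = FreeGroup.lift
      (fun i : Fin 2 => if i = 0 then FreeGroup.of (0 : Fin 2) ^ e else FreeGroup.of (1 : Fin 2)) s)
    (p q : ℤ) (hp : p = expSum 0 r) (hqdef : q = expSum 1 r) (hq : q ≠ 0)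
    (m : ℕ) (hm : m = Int.gcd p q) (a b : ℤ) (ha : a = p / m) (hb : b = q / m)
    (k l : ℕ)
    (hk : IsInfCyclicExtOfFreeRank (PresentedGroup ({r} : Set (FreeGroup (Fin 2)))) k)
    (hl : IsInfCyclicExtOfFreeRank (PresentedGroup ({s} : Set (FreeGroup (Fin 2)))) l) :
    (k : ℤ) = 1 + (Int.gcd a e : ℤ) * ((l : ℤ) - 1) + |b| * ((e : ℤ) - 1) := by
  obtain ⟨φ, hφ, ⟨β⟩⟩ := hk.exists_hom
  obtain ⟨ψ, hψ, ⟨γ⟩⟩ := hl.exists_hom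
  set ι : FreeGroup (Fin 2) →* FreeGroup (Fin 2) := FreeGroup.lift
    (fun i : Fin 2 => if i = 0 then FreeGroup.of (0 : Fin 2) ^ e else FreeGroup.of (1 : Fin 2))
    with hιdef
  have hι0 : ι (FreeGroup.of 0) = FreeGroup.of 0 ^ e := by simp [hιdef]
  have hι1 : ι (FreeGroup.of 1) = FreeGroup.of 1 := by simp [hιdef]
  clear_value ι
  have hxy := PresentedGroup.isCoprime_of_surjective hφ
  have hxy' := PresentedGroup.isCoprime_of_surjective hψ
  have hφr : φ (PresentedGroup.mk {r} r) = 1 := by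
    rw [PresentedGroup.one_of_mem (Set.mem_singleton _), map_one]
  have hψs : ψ (PresentedGroup.mk {s} s) = 1 := by
    rw [PresentedGroup.one_of_mem (Set.mem_singleton _), map_one]
  have hr0 := toAdd_eq_expSum (φ.comp (PresentedGroup.mk {r})) r
  have hs0 := toAdd_eq_expSum (ψ.comp (PresentedGroup.mk {s})) s
  have hs1 := toAdd_eq_expSum ((φ.comp (PresentedGroup.mk {r})).comp ι) s
  have hqs : expSum 1 s = q := by
    have h := toAdd_eq_expSum ((FreeGroup.lift
      (fun i : Fin 2 => Multiplicative.ofAdd (if i = 1 then (1 : ℤ) else 0))).comp ι) s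
    simp only [MonoidHom.comp_apply, ← hr, hι0, hι1] at h
    rw [hqdef]
    simpa [expSum] using h.symm
  simp only [MonoidHom.comp_apply, ← hr, hι0, hι1, hφr, hψs, hqs, ← hp, ← hqdef, map_pow,
    toAdd_pow, toAdd_one, nsmul_eq_mul] at hr0 hs0 hs1
  have hJr : ∀ w ∈ ({s} : Set (FreeGroup (Fin 2))), PresentedGroup.mk {r} (ι w) = 1 := by
    rintro w rfl
    rw [← hr, PresentedGroup.one_of_mem (Set.mem_singleton _)]
  let J : PresentedGroup {s} →* PresentedGroup {r} :=
    QuotientGroup.lift (Subgroup.normalClosure {s}) ((PresentedGroup.mk {r}).comp ι)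
      (Subgroup.normalClosure_le_normal fun w hw => hJr w hw)
  have hJι (w : FreeGroup (Fin 2)) :
      J (PresentedGroup.mk {s} w) = PresentedGroup.mk {r} (ι w) := rfl
  have hJ0 : J (PresentedGroup.of 0) = PresentedGroup.of 0 ^ e := by
    refine (hJι _).trans ?_
    rw [hι0, map_pow]
    rfl
  have hJ1 : J (PresentedGroup.of 1) = PresentedGroup.of 1 := by
    refine (hJι _).trans ?_
    rw [hι1]
    rfl
  clear_value J
  change 0 = p * (φ (PresentedGroup.of 0)).toAdd + q * (φ (PresentedGroup.of 1)).toAdd at hr0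
  change 0 = _ * (ψ (PresentedGroup.of 0)).toAdd + q * (ψ (PresentedGroup.of 1)).toAdd at hs0
  change 0 = _ * (e * (φ (PresentedGroup.of 0)).toAdd) + q * (φ (PresentedGroup.of 1)).toAdd at hs1
  have hE := finite_and_finrank_crossedHoms (x := PresentedGroup.of 0) β hφ
  have hE' := finite_and_finrank_crossedHoms (x := PresentedGroup.of 0) γ hψ
  obtain ⟨c, hcx, hcy⟩ := exists_eq_mul_of_mul_add_mul_eq_zero hq hxy' hs1.symm hs0.symm
  have hJ (h : PresentedGroup {s}) : (φ (J h)).toAdd = c * (ψ h).toAdd := by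
    obtain ⟨w, rfl⟩ := PresentedGroup.mk_surjective {s} h
    have h1 := toAdd_eq_expSum ((φ.comp J).comp (PresentedGroup.mk {s})) w
    have h2 := toAdd_eq_expSum (ψ.comp (PresentedGroup.mk {s})) w
    change (φ (J (PresentedGroup.mk {s} w))).toAdd
      = _ * (φ (J (PresentedGroup.of 0))).toAdd + _ * (φ (J (PresentedGroup.of 1))).toAdd at h1
    change (ψ (PresentedGroup.mk {s} w)).toAdd
      = _ * (ψ (PresentedGroup.of 0)).toAdd + _ * (ψ (PresentedGroup.of 1)).toAdd at h2
    rw [hJ0, hJ1, map_pow, toAdd_pow, nsmul_eq_mul, hcx, hcy] at h1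
    rw [h1, h2]
    ring
  have hbij := fun hc => crossedHomsResidues_bijective hJ hJ0 hJ1 hc hr.symm hι0 hι1 hJι
  generalize (φ (PresentedGroup.of 0)).toAdd = X at *
  generalize (φ (PresentedGroup.of 1)).toAdd = Y at *
  generalize (ψ (PresentedGroup.of 0)).toAdd = X' at *
  generalize (ψ (PresentedGroup.of 1)).toAdd = Y' at *
  have hm0 : (m : ℤ) ≠ 0 := by
    rw [hm]
    exact_mod_cast (Int.gcd_pos_of_ne_zero_right p hq).ne'
  have hpa : p = m * a := by
    rw [ha, Int.mul_ediv_cancel']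
    rw [hm]
    exact Int.gcd_dvd_left ..
  have hqb : q = m * b := by
    rw [hb, Int.mul_ediv_cancel']
    rw [hm]
    exact Int.gcd_dvd_right ..
  have hab : IsCoprime a b := by
    rw [Int.isCoprime_iff_gcd_eq_one, ha, hb, hm]
    exact Int.gcd_ediv_gcd_ediv_gcd (Int.gcd_pos_of_ne_zero_right p hq)
  have hrel : a * X + b * Y = 0 :=
    mul_left_cancel₀ hm0 (by rw [hpa, hqb] at hr0; linear_combination -hr0)
  have hYa : Y.natAbs = a.natAbs := natAbs_eq_of_mul_add_mul_eq_zero hab hxy hrel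
  have hXb : X.natAbs = b.natAbs :=
    natAbs_eq_of_mul_add_mul_eq_zero hab.symm hxy.symm (by linarith)
  have hb0 : b ≠ 0 := by
    rintro rfl
    exact hq (by simpa using hqb)
  have hX0 : X ≠ 0 := by omega
  have hcX' : c * X' ≠ 0 := by
    rw [← hcx]
    exact mul_ne_zero (by omega) hX0
  have hc0 : c ≠ 0 := left_ne_zero_of_mul hcX'
  have hX'0 : X' ≠ 0 := right_ne_zero_of_mul hcX'
  have hgcd : Int.gcd a e = c.natAbs := by
    have h1 : Int.gcd (e * X) Y = c.natAbs := by
      rw [hcx, hcy, Int.gcd_mul_left, Int.isCoprime_iff_gcd_eq_one.1 hxy', mul_one]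
    have h2 : Nat.Coprime X.natAbs a.natAbs := hYa ▸ Int.isCoprime_iff_nat_coprime.1 hxy
    rw [← h1, Int.gcd_comm, Int.gcd, Int.gcd, Int.natAbs_mul, hYa, h2.gcd_mul_right_cancel]
  obtain ⟨-, hE2⟩ := hE hX0
  obtain ⟨hfin, hE'2⟩ := hE' hX'0
  have hfr := (LinearEquiv.ofBijective _ (hbij hc0)).finrank_eq
  rw [Module.finrank_pi_fintype, Finset.sum_const, Finset.card_univ, Fintype.card_fin,
    smul_eq_mul] at hfr
  have hnat : e * b.natAbs = c.natAbs * X'.natAbs := by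
    rw [← Int.natAbs_mul, ← hcx, Int.natAbs_mul, hXb, Int.natAbs_natCast]
  rw [hgcd, Int.abs_eq_natAbs]
  rw [hXb] at hE2
  rw [hfr] at hE2
  zify at hE2 hE'2 hnat ⊢
  linear_combination |c| * hE'2 - hE2 - hnat
end
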